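/- With λ a partition of r of length n, 0 ≤ j ≤ min{n, r−n−1}, and d = r+n−j, the pullback closure of CH_j(Δ_λ) under Ψ_{d,r} has codimension 1 in ℙ^d if and only if CH_j(Δ_λ) has codimension 1 in 𝔾(r−n−1+j, r), which happens exactly when j ≤ n − m_1(λ), where m_1(λ) is the number of parts of λ equal to 1. -/

import Mathlib

open MvPolynomial

noncomputable section

/-- The Zariski closure of a subset of the affine space `σ → K`. -/
def zClosure {K : Type} [Field K] {σ : Type} [Fintype σ] [DecidableEq σ]
    (S : Set (σ → K)) : Set (σ → K) :=
  {x | ∀ p : MvPolynomial σ K, (∀ y ∈ S, eval y p = 0) → eval x p = 0}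

/-- A subset of affine space is Zariski closed if it equals its Zariski closure. -/
def zClosed {K : Type} [Field K] {σ : Type} [Fintype σ] [DecidableEq σ]
    (S : Set (σ → K)) : Prop :=
  zClosure S = S

/-- Irreducibility of a subset of affine space in the Zariski topology,
tested against the basic open sets. -/
def zIrreducible {K : Type} [Field K] {σ : Type} [Fintype σ] [DecidableEq σ]
    (S : Set (σ → K)) : Prop :=
  S.Nonempty ∧ ∀ p q : MvPolynomial σ K,
    (∀ x ∈ S, eval x p = 0 ∨ eval x q = 0) →
    (∀ x ∈ S, eval x p = 0) ∨ (∀ x ∈ S, eval x q = 0)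

/-- There is a strictly increasing chain of `m+1` irreducible Zariski-closed
subsets contained in `S`. -/
def zChain {K : Type} [Field K] {σ : Type} [Fintype σ] [DecidableEq σ]
    (S : Set (σ → K)) (m : ℕ) : Prop :=
  ∃ c : Fin (m+1) → Set (σ → K),
    (∀ i, zIrreducible (c i) ∧ zClosed (c i) ∧ c i ⊆ S) ∧
    ∀ i j : Fin (m+1), i < j → c i ⊂ c j

/-- `S` has (Krull) dimension `m` in the Zariski topology. -/
def zDimEq {K : Type} [Field K] {σ : Type} [Fintype σ] [DecidableEq σ]
    (S : Set (σ → K)) (m : ℕ) : Prop :=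
  zChain S m ∧ ¬ zChain S (m+1)

/-- The (embedded, affine) Zariski tangent space to `S` at `a`: the common kernel of the
differentials at `a` of all polynomials vanishing on `S`. -/
def zTangentAt {K : Type} [Field K] {σ : Type} [Fintype σ] [DecidableEq σ]
    (S : Set (σ → K)) (a : σ → K) : Set (σ → K) :=
  {v | ∀ p : MvPolynomial σ K, (∀ y ∈ S, eval y p = 0) →
        ∑ i : σ, eval a (pderiv i p) * v i = 0}

/-- Dimension of the Zariski tangent space at a point. -/
def zTangentDim {K : Type} [Field K] {σ : Type} [Fintype σ] [DecidableEq σ]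
    (S : Set (σ → K)) (a : σ → K) : ℕ :=
  Module.finrank K (Submodule.span K (zTangentAt S a))

/-- The binary form of degree `r` with coefficient vector `a`. -/
def binForm {K : Type} [CommSemiring K] (r : ℕ) (a : Fin (r+1) → K) :
    MvPolynomial (Fin 2) K :=
  ∑ i : Fin (r+1), C (a i) * X 0 ^ (r - (i : ℕ)) * X 1 ^ (i : ℕ)

/-- The linear binary form `u·x + v·y`. -/
def linForm {K : Type} [CommSemiring K] (u v : K) : MvPolynomial (Fin 2) K :=
  C u * X 0 + C v * X 1

/-- The affine cone over the coincident root locus `Δ_λ ⊆ ℙ^r`, in coefficient coordinates: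
scalar multiples of forms `∏ ℓ_i ^ λ_i`. -/
def crlCone (r n : ℕ) (lam : Fin n → ℕ) : Set (Fin (r+1) → ℂ) :=
  {a | ∃ (t : ℂ) (u v : Fin n → ℂ),
    binForm r a = C t * ∏ i, (linForm (u i) (v i)) ^ lam i}

/-- `lam` is a partition of `r` of length `n` (all parts positive). -/
def isPartitionOf (r n : ℕ) (lam : Fin n → ℕ) : Prop :=
  (∀ i, 1 ≤ lam i) ∧ ∑ i, lam i = r

/-- The multiplicity `m_j` of the part `j` in the partition `lam`. -/
def multOf {n : ℕ} (lam : Fin n → ℕ) (jj : ℕ) : ℕ :=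
  (Finset.univ.filter fun i => lam i = jj).card

/-- The differential operator of degree `s` with coefficient vector `b`, i.e.
`∑ b_i ∂x^(s-i) ∂y^i`, applied to `f`. -/
def diffOp {K : Type} [CommSemiring K] (s : ℕ) (b : Fin (s+1) → K)
    (f : MvPolynomial (Fin 2) K) : MvPolynomial (Fin 2) K :=
  ∑ i : Fin (s+1), b i •
    ((fun g => pderiv (0 : Fin 2) g)^[s - (i : ℕ)]
      (((fun g => pderiv (1 : Fin 2) g)^[(i : ℕ)]) f))

/-- The apolarity pairing between a degree-`d` operator (coefficients `h`) and a
degree-`d` form (coefficients `a`). -/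
def apolarPair (d : ℕ) (h a : Fin (d+1) → ℂ) : ℂ :=
  eval (fun _ => (0 : ℂ)) (diffOp d h (binForm d a))

/-- The cone over the dual variety of the cone `S ⊆ ℂ^(m+1)` (with `k` the dimension of the
cone `S`, used to select smooth points): closure of the set of hyperplanes, written in dual
coordinates via the apolarity pairing, containing an embedded tangent space at a smooth point. -/
def dualConeOf (m : ℕ) (S : Set (Fin (m+1) → ℂ)) (k : ℕ) : Set (Fin (m+1) → ℂ) :=
  zClosure {h | h ≠ 0 ∧ ∃ a ∈ S, a ≠ 0 ∧ zTangentDim S a = k ∧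
      ∀ v ∈ zTangentAt S a, apolarPair m h v = 0}

/-- The row span of a matrix, as a subspace of `ℂ^m`. -/
def rowSpan {k m : ℕ} (M : Matrix (Fin k) (Fin m) ℂ) : Submodule ℂ (Fin m → ℂ) :=
  Submodule.span ℂ (Set.range fun i => M i)

/-- The (redundant) Plücker coordinate vector of the row span of `M`: all maximal minors. -/
def plucker {k m : ℕ} (M : Matrix (Fin k) (Fin m) ℂ) : (Fin k → Fin m) → ℂ :=
  fun s => (M.submatrix id s).det

/-- The degree-`s` component of the apolar ideal of the degree-`d` form with
coefficients `a`, as a subset of the coefficient space of operators. -/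
def apolarSet (d s : ℕ) (a : Fin (d+1) → ℂ) : Set (Fin (s+1) → ℂ) :=
  {b | diffOp s b (binForm d a) = 0}

/-- The (pre-closure) cone, in Plücker coordinates, over the `j`-th higher associated variety
`CH_j(S)`: spans of `k`-row matrices whose row space contains a smooth point `x` of the cone
`S` (`dimS` = dimension of the cone `S`) and meets the tangent space at `x` in projective
dimension at least `j`. -/
def smoothCHCone (m : ℕ) (S : Set (Fin (m+1) → ℂ)) (dimS k j : ℕ) :
    Set ((Fin k → Fin (m+1)) → ℂ) :=
  {u | ∃ M : Matrix (Fin k) (Fin (m+1)) ℂ, u = plucker M ∧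
    Module.finrank ℂ (rowSpan M) = k ∧
    ∃ x, x ≠ 0 ∧ x ∈ S ∧ zTangentDim S x = dimS ∧ x ∈ rowSpan M ∧
      j + 1 ≤ Module.finrank ℂ ↥(rowSpan M ⊓ Submodule.span ℂ (zTangentAt S x))}

/-- The (pre-closure) cone, in Plücker coordinates, over `Ξ_0(S)`: spans of `k`-row matrices
whose row space meets the cone `S` nontrivially. -/
def meetCone (m : ℕ) (S : Set (Fin (m+1) → ℂ)) (k : ℕ) :
    Set ((Fin k → Fin (m+1)) → ℂ) :=
  {u | ∃ M : Matrix (Fin k) (Fin (m+1)) ℂ, u = plucker M ∧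
    Module.finrank ℂ (rowSpan M) = k ∧ ∃ x, x ≠ 0 ∧ x ∈ S ∧ x ∈ rowSpan M}

/-- The preimage under the apolar map `Ψ_{d,s}` of a subset `T` of the Grassmannian
(in Plücker coordinates) of `(k-1)`-projective-dimensional subspaces of `ℙ(D_s)`. -/
def apolarPull (d s k : ℕ) (T : Set ((Fin k → Fin (s+1)) → ℂ)) : Set (Fin (d+1) → ℂ) :=
  {a | ∃ M : Matrix (Fin k) (Fin (s+1)) ℂ,
    rowSpan M = Submodule.span ℂ (apolarSet d s a) ∧
    Module.finrank ℂ (rowSpan M) = k ∧ plucker M ∈ T}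

/-- The Waring rank over `K` of a binary form: the least `r` such that `f` is a sum of `r`
scalar multiples of `d`-th powers of linear forms. -/
def waringRank {K : Type} [Field K] (d : ℕ) (f : MvPolynomial (Fin 2) K) : ℕ :=
  sInf {r | ∃ (α u v : Fin r → K), f = ∑ i, α i • (linForm (u i) (v i)) ^ d}

/-- The set of coefficient vectors of real binary forms of degree `d` of real rank `r`. -/
def realRankSet (d r : ℕ) : Set (Fin (d+1) → ℝ) :=
  {a | waringRank d (binForm d a) = r}

/-- `R_{d,r}`: the interior, in the Euclidean topology, of the set of real binary forms of
degree `d` and real rank `r`. -/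
def Rdr (d r : ℕ) : Set (Fin (d+1) → ℝ) := interior (realRankSet d r)

/-- The topological boundary of `R_{d,r}`: the closure of `R_{d,r}` minus the interior of
the closure. -/
def topBoundary (d r : ℕ) : Set (Fin (d+1) → ℝ) :=
  closure (Rdr d r) \ interior (closure (Rdr d r))

/-- The algebraic boundary `∂_alg(R_{d,r})`: the Zariski closure over `ℂ` of the topological
boundary of `R_{d,r}`. -/
def algBoundary (d r : ℕ) : Set (Fin (d+1) → ℂ) :=
  zClosure ((fun a i => ((a i : ℝ) : ℂ)) '' topBoundary d r)

section
/-! ### Polynomial functions -/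

theorem eval_aeval' {α β : Type} (f : α → MvPolynomial β ℂ) (x : β → ℂ) (P : MvPolynomial α ℂ) :
    eval x (aeval f P) = eval (fun i => eval x (f i)) P := by
  induction P using MvPolynomial.induction_on with
  | C a => simp
  | add p q hp hq => simp only [map_add, hp, hq]
  | mul_X p i hp => simp only [map_mul, hp, aeval_X, eval_X]

/-- `f` is a polynomial function. -/
def PolyFn {ι : Type} (f : (ι → ℂ) → ℂ) : Prop := ∃ P : MvPolynomial ι ℂ, ∀ a, f a = eval a P

namespace PolyFn
variable {ι κ : Type} {f g : (ι → ℂ) → ℂ}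

theorem const (c : ℂ) : PolyFn (fun _ : ι → ℂ => c) := ⟨C c, fun a => by simp⟩
theorem coord (i : ι) : PolyFn (fun a : ι → ℂ => a i) := ⟨X i, fun a => by simp⟩
theorem add (hf : PolyFn f) (hg : PolyFn g) : PolyFn (fun a => f a + g a) := by
  obtain ⟨P, hP⟩ := hf; obtain ⟨Q, hQ⟩ := hg
  exact ⟨P + Q, fun a => by simp [hP, hQ]⟩
theorem mul (hf : PolyFn f) (hg : PolyFn g) : PolyFn (fun a => f a * g a) := by
  obtain ⟨P, hP⟩ := hf; obtain ⟨Q, hQ⟩ := hg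
  exact ⟨P * Q, fun a => by simp [hP, hQ]⟩
theorem neg (hf : PolyFn f) : PolyFn (fun a => - f a) := by
  obtain ⟨P, hP⟩ := hf
  exact ⟨-P, fun a => by simp [hP]⟩
theorem sub (hf : PolyFn f) (hg : PolyFn g) : PolyFn (fun a => f a - g a) := by
  obtain ⟨P, hP⟩ := hf; obtain ⟨Q, hQ⟩ := hg
  exact ⟨P - Q, fun a => by simp [hP, hQ]⟩
theorem pow (hf : PolyFn f) (k : ℕ) : PolyFn (fun a => f a ^ k) := by
  obtain ⟨P, hP⟩ := hf
  exact ⟨P ^ k, fun a => by simp [hP]⟩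
theorem sum {α : Type*} (s : Finset α) {F : α → (ι → ℂ) → ℂ} (h : ∀ i ∈ s, PolyFn (F i)) :
    PolyFn (fun a => ∑ i ∈ s, F i a) := by
  classical
  induction s using Finset.induction_on with
  | empty => simpa using const 0
  | insert i s hi ih =>
    simp only [Finset.sum_insert hi]
    exact (h i (by simp)).add (ih fun j hj => h j (by simp [hj]))
theorem prod {α : Type*} (s : Finset α) {F : α → (ι → ℂ) → ℂ} (h : ∀ i ∈ s, PolyFn (F i)) :
    PolyFn (fun a => ∏ i ∈ s, F i a) := by
  classical
  induction s using Finset.induction_on with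
  | empty => simpa using const 1
  | insert i s hi ih =>
    simp only [Finset.prod_insert hi]
    exact (h i (by simp)).mul (ih fun j hj => h j (by simp [hj]))
theorem comp {φ : (κ → ℂ) → (ι → ℂ)} (hf : PolyFn f) (hφ : ∀ i, PolyFn (fun a => φ a i)) :
    PolyFn (fun a => f (φ a)) := by
  obtain ⟨P, hP⟩ := hf
  choose Q hQ using hφ
  refine ⟨aeval Q P, fun a => ?_⟩
  show f (φ a) = _
  rw [hP, eval_aeval']
  have : φ a = fun i => (eval a) (Q i) := funext fun i => hQ i a
  rw [this]
theorem eval_poly (P : MvPolynomial ι ℂ) : PolyFn (fun a => eval a P) := ⟨P, fun _ => rfl⟩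
theorem det {m : Type*} [Fintype m] [DecidableEq m] {M : (ι → ℂ) → Matrix m m ℂ}
    (h : ∀ i j, PolyFn (fun a => M a i j)) : PolyFn (fun a => (M a).det) := by
  simp only [Matrix.det_apply']
  exact sum _ fun σ _ => (const _).mul (prod _ fun i _ => h _ _)
theorem ext_eq {f' : (ι → ℂ) → ℂ} (hf : PolyFn f) (h : ∀ a, f' a = f a) : PolyFn f' := by
  have : f' = f := funext h
  rwa [this]
theorem cancel (hf : PolyFn f) (hg : PolyFn g) (h : ∀ a, f a = 0 ∨ g a = 0)
    (hg0 : ∃ a, g a ≠ 0) (a : ι → ℂ) : f a = 0 := by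
  obtain ⟨P, hP⟩ := hf; obtain ⟨Q, hQ⟩ := hg
  have : P * Q = 0 := by
    apply MvPolynomial.funext
    intro a
    rw [map_mul, map_zero, ← hP, ← hQ, mul_eq_zero]
    exact h a
  rcases mul_eq_zero.1 this with h0 | h0
  · rw [hP, h0, map_zero]
  · obtain ⟨a, ha⟩ := hg0
    rw [hQ, h0, map_zero] at ha
    exact absurd rfl ha
theorem continuous (hf : PolyFn f) : Continuous f := by
  obtain ⟨P, hP⟩ := hf
  have : f = fun a => eval a P := funext hP
  rw [this]
  exact MvPolynomial.continuous_eval P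
end PolyFn

/-! ### Zariski closure -/
section zc
variable {σ τ : Type} [Fintype σ] [DecidableEq σ] [Fintype τ] [DecidableEq τ]

theorem subset_zClosure (S : Set (σ → ℂ)) : S ⊆ zClosure S := fun x hx _ hp => hp x hx
theorem zClosure_mono {S T : Set (σ → ℂ)} (h : S ⊆ T) : zClosure S ⊆ zClosure T :=
  fun _ hx p hp => hx p fun y hy => hp y (h hy)
theorem zClosure_idem (S : Set (σ → ℂ)) : zClosure (zClosure S) = zClosure S := by
  refine Set.Subset.antisymm (fun x hx p hp => hx p fun y hy => hy p hp) (subset_zClosure _)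
theorem zClosure_subset {S T : Set (σ → ℂ)} (h : S ⊆ zClosure T) : zClosure S ⊆ zClosure T := by
  have := zClosure_mono h
  rwa [zClosure_idem] at this

theorem irred_prod {c : Set (σ → ℂ)} (hc : zIrreducible c) {α : Type*} (s : Finset α)
    (p : α → MvPolynomial σ ℂ) (h : ∀ x ∈ c, eval x (∏ i ∈ s, p i) = 0) :
    ∃ i ∈ s, ∀ x ∈ c, eval x (p i) = 0 := by
  classical
  induction s using Finset.induction_on with
  | empty =>
    obtain ⟨x, hx⟩ := hc.1
    simpa using h x hx
  | insert i s hi ih =>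
    simp only [Finset.prod_insert hi, map_mul, mul_eq_zero] at h
    rcases hc.2 _ _ h with h1 | h1
    · exact ⟨i, by simp, h1⟩
    · obtain ⟨k, hk, hk'⟩ := ih h1
      exact ⟨k, by simp [hk], hk'⟩

theorem irred_cover {c S : Set (σ → ℂ)} (hc : zIrreducible c) {G : Type*} [Fintype G]
    (A : G → Set (σ → ℂ)) (hcS : c ⊆ zClosure S) (hS : S ⊆ ⋃ g, zClosure (A g)) :
    ∃ g, c ⊆ zClosure (A g) := by
  by_contra! hcon
  have : ∀ g, ∃ p : MvPolynomial σ ℂ, (∀ y ∈ A g, eval y p = 0) ∧ ∃ x ∈ c, eval x p ≠ 0 := by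
    intro g
    obtain ⟨x, hx, hxA⟩ := Set.not_subset.1 (hcon g)
    simp only [zClosure, Set.mem_ofPred_eq, not_forall] at hxA
    obtain ⟨p, hp, hp'⟩ := hxA
    exact ⟨p, hp, x, hx, hp'⟩
  choose p hp hp' using this
  obtain ⟨g, -, hg⟩ := irred_prod hc Finset.univ p (by
    intro x hx
    apply hcS hx
    intro y hy
    obtain ⟨g, hg⟩ := Set.mem_iUnion.1 (hS hy)
    rw [map_prod]
    exact Finset.prod_eq_zero (Finset.mem_univ g) (hg _ (hp g)))
  obtain ⟨x, hx, hx'⟩ := hp' g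
  exact hx' (hg x hx)

theorem exists_sep {a b : Set (σ → ℂ)} (ha : zClosed a) (hab : a ⊂ b) :
    ∃ f : MvPolynomial σ ℂ, (∀ x ∈ a, eval x f = 0) ∧ ∃ x ∈ b, eval x f ≠ 0 := by
  obtain ⟨x, hx, hxa⟩ := Set.exists_of_ssubset hab
  rw [← ha] at hxa
  simp only [zClosure, Set.mem_ofPred_eq, not_forall] at hxa
  obtain ⟨p, hp, hp'⟩ := hxa
  exact ⟨p, hp, x, hx, hp'⟩

theorem chain_algInd (t : ℕ) (c : Fin (t+1) → Set (σ → ℂ))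
    (hc : ∀ i, zIrreducible (c i) ∧ zClosed (c i)) (hlt : ∀ i j : Fin (t+1), i < j → c i ⊂ c j) :
    ∃ f : Fin t → MvPolynomial σ ℂ, ∀ P : MvPolynomial (Fin t) ℂ,
      (∀ x ∈ c (Fin.last t), eval (fun i => eval x (f i)) P = 0) → P = 0 := by
  induction t with
  | zero =>
    refine ⟨Fin.elim0, fun P hP => ?_⟩
    obtain ⟨x, hx⟩ := (hc (Fin.last 0)).1.1
    apply MvPolynomial.funext
    intro a
    rw [map_zero, ← hP x hx]
    congr 2
    exact Subsingleton.elim _ _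
  | succ t ih =>
    obtain ⟨f, hf⟩ := ih (fun i => c i.castSucc) (fun i => hc _) (fun i k hik => hlt _ _ (by simpa using hik))
    obtain ⟨fn, hfn, x0, hx0, hx0'⟩ := exists_sep (hc (Fin.last t).castSucc).2
      (hlt (Fin.last t).castSucc (Fin.last (t+1)) (Fin.castSucc_lt_last _))
    have hsub := (hlt (Fin.last t).castSucc (Fin.last (t+1)) (Fin.castSucc_lt_last _)).1
    refine ⟨Fin.cons fn f, ?_⟩
    have hev : ∀ x : σ → ℂ, (fun i => eval x ((Fin.cons fn f : Fin (t+1) → MvPolynomial σ ℂ) i)) =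
        (Fin.cons (eval x fn) (fun i => eval x (f i)) : Fin (t+1) → ℂ) := by
      intro x; funext i
      refine Fin.cases ?_ (fun i => ?_) i <;> simp
    simp only [hev, MvPolynomial.eval_eq_eval_mv_eval']
    suffices H : ∀ (N : ℕ) (p : Polynomial (MvPolynomial (Fin t) ℂ)), p.natDegree ≤ N →
        (∀ x ∈ c (Fin.last (t+1)), Polynomial.eval (eval x fn)
          (Polynomial.map (eval fun i => eval x (f i)) p) = 0) → p = 0 by
      intro P hP
      have := H _ (finSuccEquiv ℂ t P) le_rfl hP
      simpa using this
    intro N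
    induction N with
    | zero =>
      intro p hp h
      rw [Polynomial.eq_C_of_natDegree_le_zero hp] at h ⊢
      simp only [Polynomial.map_C, Polynomial.eval_C] at h
      rw [hf _ (fun x hx => h x (hsub hx))]
      simp
    | succ N ihN =>
      intro p hp h
      have h0 : p.coeff 0 = 0 := by
        apply hf
        intro x hx
        have := h x (hsub hx)
        rw [hfn x hx] at this
        rw [← Polynomial.coeff_zero_eq_eval_zero, Polynomial.coeff_map] at this
        exact this
      have hX := Polynomial.X_mul_divX_add p
      rw [h0, Polynomial.C_0, add_zero] at hX
      have hd : p.divX = 0 := by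
        apply ihN
        · rw [Polynomial.natDegree_divX_eq_natDegree_tsub_one]; omega
        · have key := (hc (Fin.last (t+1))).1.2 fn
            (∑ k ∈ Finset.range (p.divX.natDegree + 1), (aeval f (p.divX.coeff k)) * fn ^ k)
          have hE : ∀ x : σ → ℂ, eval x (∑ k ∈ Finset.range (p.divX.natDegree + 1),
              (aeval f (p.divX.coeff k)) * fn ^ k) = Polynomial.eval (eval x fn)
                (Polynomial.map (eval fun i => eval x (f i)) p.divX) := by
            intro x
            rw [Polynomial.eval_map, Polynomial.eval₂_eq_sum_range, map_sum]
            refine Finset.sum_congr rfl fun k _ => ?_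
            rw [map_mul, map_pow]
            congr 1
            rw [eval_aeval']
          rcases key (by
            intro x hx
            have := h x hx
            rw [← hX, Polynomial.map_mul, Polynomial.eval_mul, Polynomial.map_X, Polynomial.eval_X,
              mul_eq_zero] at this
            rw [hE]; exact this) with h1 | h1
          · exact absurd (h1 x0 hx0) hx0'
          · intro x hx; rw [← hE]; exact h1 x hx
      rw [← hX, hd, mul_zero]

theorem not_zChain_of_param {S : Set (σ → ℂ)} {G : Type*} [Fintype G] {N : ℕ} (ι : G → Type)
    [∀ g, Fintype (ι g)] (φ : ∀ g, (ι g → ℂ) → (σ → ℂ)) (hφ : ∀ g s, PolyFn fun a => φ g a s)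
    (hN : ∀ g, Fintype.card (ι g) ≤ N) (hS : S ⊆ ⋃ g, zClosure (Set.range (φ g))) :
    ¬ zChain (zClosure S) (N+1) := by
  rintro ⟨c, hc, hlt⟩
  obtain ⟨f, hf⟩ := chain_algInd (N+1) c (fun i => ⟨(hc i).1, (hc i).2.1⟩) hlt
  obtain ⟨g, hg⟩ := irred_cover (hc (Fin.last _)).1 (fun g => Set.range (φ g)) (hc (Fin.last _)).2.2 hS
  choose Q hQ using hφ g
  have hind : AlgebraicIndependent ℂ (fun i => aeval Q (f i)) := by
    rw [algebraicIndependent_iff]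
    intro P hP
    apply hf
    intro x hx
    have h1 := hg hx (aeval f P) (by
      rintro _ ⟨a, rfl⟩
      have h2 : eval a (aeval (fun i => aeval Q (f i)) P) = 0 := by rw [hP, map_zero]
      have h3 : φ g a = fun s => eval a (Q s) := funext fun s => hQ s a
      rw [eval_aeval'] at h2 ⊢
      simp only [eval_aeval'] at h2
      rw [h3]; exact h2)
    rw [← h1, eval_aeval']
  have h1 := hind.lift_cardinalMk_le_trdeg
  rw [MvPolynomial.trdeg_of_isDomain] at h1
  simp at h1
  have := hN g
  exact absurd h1 (by exact_mod_cast (by omega))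
end zc

end

section
theorem exists_primes_chain {B : Type} [CommRing B] [IsDomain B] [Algebra ℂ B] [Algebra.FiniteType ℂ B]
    {τ : Type} [Fintype τ] (f : MvPolynomial τ ℂ →ₐ[ℂ] B) (hf : Function.Injective f) :
    ∃ L : LTSeries (PrimeSpectrum B), L.length = Fintype.card τ := by
  obtain ⟨s, g, hg, hgi⟩ := exists_integral_inj_algHom_of_fg ℂ B
  let := g.toRingHom.toAlgebra
  have : IsScalarTower ℂ (MvPolynomial (Fin s) ℂ) B := IsScalarTower.of_algebraMap_eq fun x => by
    exact (g.commutes x).symm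
  have hInt : Algebra.IsIntegral (MvPolynomial (Fin s) ℂ) B := ⟨hgi⟩
  have : FaithfulSMul (MvPolynomial (Fin s) ℂ) B := (faithfulSMul_iff_algebraMap_injective _ _).2 hg
  have htr : Fintype.card τ ≤ s := by
    have h1 := _root_.trdeg_add_eq ℂ (MvPolynomial (Fin s) ℂ) (A := B)
    have h2 : Algebra.trdeg (MvPolynomial (Fin s) ℂ) B = 0 := _root_.trdeg_eq_zero
    rw [h2, MvPolynomial.trdeg_of_isDomain] at h1
    have h3 := trdeg_le_of_injective f hf
    rw [MvPolynomial.trdeg_of_isDomain, ← h1] at h3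
    simpa using h3
  have hk : ((Fintype.card τ : ℕ) : WithBot ℕ∞) ≤ ringKrullDim (MvPolynomial (Fin s) ℂ) := by
    rw [MvPolynomial.ringKrullDim_of_isNoetherianRing]
    simp
    exact_mod_cast htr
  rw [ringKrullDim, Order.le_krullDim_iff] at hk
  obtain ⟨l, hl⟩ := hk
  obtain ⟨Q, hQ, hQp, hQc⟩ := Ideal.exists_ideal_over_prime_of_isIntegral_of_isPrime (S := B)
    (RelSeries.head l).asIdeal (⊥ : Ideal B) (by
      rw [Ideal.comap_bot_of_injective (algebraMap (MvPolynomial (Fin s) ℂ) B) hg]; exact bot_le)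
  have : Q.LiesOver (RelSeries.head l).asIdeal := ⟨hQc.symm⟩
  obtain ⟨L, hL, -⟩ := Ideal.exists_ltSeries_of_hasGoingUp l Q
  exact ⟨L, hL.trans hl⟩

theorem zChain_of_dominant {σ τ : Type} [Fintype σ] [DecidableEq σ] [Fintype τ] {S : Set (σ → ℂ)}
    (ψ : (σ → ℂ) → (τ → ℂ)) (hψ : ∀ t, PolyFn fun x => ψ x t)
    (h : ∀ P : MvPolynomial τ ℂ, (∀ x ∈ S, eval (ψ x) P = 0) → P = 0) :
    zChain (zClosure S) (Fintype.card τ) := by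
  choose Q hQ using hψ
  have hQ' : ∀ x, ψ x = fun t => eval x (Q t) := fun x => funext fun t => hQ t x
  set I := vanishingIdeal ℂ S with hI
  have hinj : Function.Injective ((Ideal.Quotient.mk I).comp (aeval Q : MvPolynomial τ ℂ →ₐ[ℂ] _).toRingHom) := by
    rw [injective_iff_map_eq_zero]
    intro P hP
    apply h
    intro x hx
    have : aeval Q P ∈ I := Ideal.Quotient.eq_zero_iff_mem.1 hP
    have := (mem_vanishingIdeal_iff.1 this) x hx
    rw [hQ', ← eval_aeval']
    simpa [aeval_eq_eval] using this
  obtain ⟨p', hp', hpc⟩ := Ideal.exists_comap_eq_of_mem_minimalPrimes_of_injective hinj ⊥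
    (by rw [IsDomain.minimalPrimes_eq_singleton_bot]; rfl)
  set p := p'.comap (Ideal.Quotient.mk I) with hp
  have : p.IsPrime := Ideal.comap_isPrime _ _
  have hIp : I ≤ p := by
    intro x hx
    rw [hp, Ideal.mem_comap, Ideal.Quotient.eq_zero_iff_mem.2 hx]
    exact zero_mem _
  obtain ⟨L, hL⟩ := exists_primes_chain ((Ideal.Quotient.mkₐ ℂ p).comp (aeval Q)) (by
    rw [injective_iff_map_eq_zero]
    intro P hP
    have h1 : aeval Q P ∈ p := Ideal.Quotient.eq_zero_iff_mem.1 hP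
    have h2 : P ∈ (⊥ : Ideal (MvPolynomial τ ℂ)) := by
      rw [← hpc, Ideal.mem_comap]
      exact h1
    simpa using h2)
  let q : Fin (L.length + 1) → Ideal (MvPolynomial σ ℂ) :=
    fun i => (L i).asIdeal.comap (Ideal.Quotient.mk p)
  have hqp : ∀ i, (q i).IsPrime := fun i => Ideal.comap_isPrime _ _
  have hpq : ∀ i, p ≤ q i := by
    intro i x hx
    show Ideal.Quotient.mk p x ∈ (L i).asIdeal
    rw [Ideal.Quotient.eq_zero_iff_mem.2 hx]
    exact zero_mem _
  have hlt : ∀ i j, i < j → q i < q j := by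
    intro i j hij
    have h1 : (L i).asIdeal < (L j).asIdeal := L.strictMono hij
    refine lt_of_le_of_ne (Ideal.comap_mono h1.le) fun he => h1.ne ?_
    exact Ideal.comap_injective_of_surjective _ Ideal.Quotient.mk_surjective he
  rw [← hL]
  refine ⟨fun i => zeroLocus ℂ (q i.rev), fun i => ⟨⟨?_, ?_⟩, ?_, ?_⟩, ?_⟩
  · by_contra hne
    rw [Set.not_nonempty_iff_eq_empty] at hne
    change zeroLocus ℂ (q i.rev) = ∅ at hne
    have := IsPrime.vanishingIdeal_zeroLocus (K := ℂ) (q i.rev)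
    rw [hne, vanishingIdeal_empty] at this
    exact (hqp i.rev).ne_top this.symm
  · intro a b hab
    have h1 : a * b ∈ q i.rev := by
      rw [← IsPrime.vanishingIdeal_zeroLocus (K := ℂ) (q i.rev), mem_vanishingIdeal_iff]
      intro x hx
      have := hab x hx
      rw [aeval_eq_eval]
      simpa using this
    rcases (hqp i.rev).mem_or_mem h1 with h2 | h2
    · left; intro x hx; simpa [aeval_eq_eval] using hx _ h2
    · right; intro x hx; simpa [aeval_eq_eval] using hx _ h2
  · refine Set.Subset.antisymm (fun x hx P hP => ?_) (subset_zClosure _)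
    rw [aeval_eq_eval]
    exact hx P fun y hy => by simpa [aeval_eq_eval] using hy P hP
  · intro x hx P hP
    have : P ∈ I := mem_vanishingIdeal_iff.2 fun y hy => by simpa [aeval_eq_eval] using hP y hy
    simpa [aeval_eq_eval] using hx P (hpq _ (hIp this))
  · intro i k hik
    have h1 := hlt k.rev i.rev (by simpa using hik)
    refine lt_of_le_of_ne (zeroLocus_anti_mono h1.le) fun he => h1.ne ?_
    have he' : zeroLocus ℂ (q i.rev) = zeroLocus ℂ (q k.rev) := he
    rw [← IsPrime.vanishingIdeal_zeroLocus (K := ℂ) (q i.rev), ← IsPrime.vanishingIdeal_zeroLocus (K := ℂ) (q k.rev), he']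

end

section
/-! ### Univariate translation -/

/-- The polynomial with given coefficient vector. -/
def toP (N : ℕ) : (Fin (N+1) → ℂ) →ₗ[ℂ] Polynomial ℂ where
  toFun a := ∑ i : Fin (N+1), Polynomial.monomial (i : ℕ) (a i)
  map_add' a b := by simp [Finset.sum_add_distrib]
  map_smul' c a := by simp [Finset.smul_sum, Polynomial.smul_monomial]

/-- The coefficient vector of a polynomial. -/
def vec (N : ℕ) : Polynomial ℂ →ₗ[ℂ] (Fin (N+1) → ℂ) where
  toFun p := fun i => p.coeff i
  map_add' p q := by ext; simp
  map_smul' c p := by ext; simp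

@[simp] theorem vec_apply (N : ℕ) (p : Polynomial ℂ) (i : Fin (N+1)) : vec N p i = p.coeff i := rfl

theorem coeff_toP (N : ℕ) (a : Fin (N+1) → ℂ) (k : ℕ) :
    (toP N a).coeff k = if h : k < N + 1 then a ⟨k, h⟩ else 0 := by
  simp only [toP, LinearMap.coe_mk, AddHom.coe_mk, Polynomial.finsetSum_coeff,
    Polynomial.coeff_monomial]
  split_ifs with h
  · rw [Finset.sum_eq_single ⟨k, h⟩]
    · simp
    · intro b _ hb
      rw [if_neg]
      intro hbk
      exact hb (Fin.ext hbk)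
    · simp
  · apply Finset.sum_eq_zero
    intro b _
    rw [if_neg]
    have := b.2
    omega

@[simp] theorem coeff_toP_fin (N : ℕ) (a : Fin (N+1) → ℂ) (k : Fin (N+1)) :
    (toP N a).coeff (k : ℕ) = a k := by
  rw [coeff_toP, dif_pos k.2]

@[simp] theorem vec_toP (N : ℕ) (a : Fin (N+1) → ℂ) : vec N (toP N a) = a := by
  ext i; simp

theorem natDegree_toP (N : ℕ) (a : Fin (N+1) → ℂ) : (toP N a).natDegree ≤ N := by
  rw [Polynomial.natDegree_le_iff_coeff_eq_zero]
  intro k hk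
  rw [coeff_toP, dif_neg (by omega)]

theorem toP_vec {N : ℕ} {p : Polynomial ℂ} (hp : p.natDegree ≤ N) : toP N (vec N p) = p := by
  ext k
  rw [coeff_toP]
  split_ifs with h
  · simp
  · rw [Polynomial.coeff_eq_zero_of_natDegree_lt (by omega)]

theorem toP_injective (N : ℕ) : Function.Injective (toP N) :=
  Function.LeftInverse.injective (vec_toP N)

theorem vec_inj {N : ℕ} {p q : Polynomial ℂ} (hp : p.natDegree ≤ N) (hq : q.natDegree ≤ N)
    (h : vec N p = vec N q) : p = q := by
  rw [← toP_vec hp, ← toP_vec hq, h]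

/-- The univariate linear form. -/
def lin (u v : ℂ) : Polynomial ℂ := Polynomial.C u + Polynomial.C v * Polynomial.X

theorem natDegree_lin (u v : ℂ) : (lin u v).natDegree ≤ 1 := by
  unfold lin; compute_degree

theorem lin_ne_zero {u v : ℂ} (h : u ≠ 0 ∨ v ≠ 0) : lin u v ≠ 0 := by
  intro h0
  have h1 := congrArg (fun p => Polynomial.coeff p 0) h0
  have h2 := congrArg (fun p => Polynomial.coeff p 1) h0
  simp [lin] at h1 h2
  rcases h with h | h <;> contradiction

theorem eval_binForm (r : ℕ) (a : Fin (r+1) → ℂ) (x : Fin 2 → ℂ) (hx : x 0 ≠ 0) :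
    eval x (binForm r a) = x 0 ^ r * (toP r a).eval (x 1 / x 0) := by
  simp only [binForm, map_sum, map_mul, eval_C, map_pow, eval_X, toP, LinearMap.coe_mk,
    AddHom.coe_mk, Polynomial.eval_finsetSum, Polynomial.eval_monomial, Finset.mul_sum]
  refine Finset.sum_congr rfl fun i _ => ?_
  have hi : x 0 ^ r = x 0 ^ (r - (i:ℕ)) * x 0 ^ (i : ℕ) := by
    rw [← pow_add]; congr 1; have := i.2; omega
  rw [hi, div_pow]
  field_simp

theorem mvpoly_ext_of_ne {F G : MvPolynomial (Fin 2) ℂ}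
    (h : ∀ x : Fin 2 → ℂ, x 0 ≠ 0 → eval x F = eval x G) : F = G := by
  apply MvPolynomial.funext
  intro x
  have := PolyFn.cancel (f := fun x => eval x F - eval x G) (g := fun x => x 0)
    ((PolyFn.eval_poly F).sub (PolyFn.eval_poly G)) (PolyFn.coord 0) (by
      intro a
      by_cases ha : a 0 = 0
      · exact Or.inr ha
      · left; rw [h a ha, sub_self]) ⟨fun _ => 1, by simp⟩ x
  exact sub_eq_zero.1 this

theorem toP_eq_of_binForm {r : ℕ} {a : Fin (r+1) → ℂ} {F : MvPolynomial (Fin 2) ℂ}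
    (h : binForm r a = F) (p : Polynomial ℂ)
    (hp : ∀ z : ℂ, eval ![1, z] F = p.eval z) : toP r a = p := by
  apply Polynomial.funext
  intro z
  rw [← hp, ← h, eval_binForm _ _ _ (by simp)]
  simp

theorem binForm_injective (r : ℕ) : Function.Injective (binForm (K := ℂ) r) := by
  intro a b h
  apply toP_injective
  refine toP_eq_of_binForm h _ fun z => ?_
  rw [eval_binForm _ _ _ (by simp)]
  simp

theorem mem_crlCone {r n : ℕ} {lam : Fin n → ℕ} (hs : ∑ i, lam i = r) (a : Fin (r+1) → ℂ) :
    a ∈ crlCone r n lam ↔ ∃ (t : ℂ) (u v : Fin n → ℂ),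
      toP r a = Polynomial.C t * ∏ i, lin (u i) (v i) ^ lam i := by
  constructor
  · rintro ⟨t, u, v, h⟩
    refine ⟨t, u, v, toP_eq_of_binForm h _ fun z => ?_⟩
    simp [linForm, lin, Polynomial.eval_prod]
  · rintro ⟨t, u, v, h⟩
    refine ⟨t, u, v, mvpoly_ext_of_ne fun x hx => ?_⟩
    rw [eval_binForm _ _ _ hx, h]
    simp only [linForm, lin, Polynomial.eval_prod, map_mul, map_prod, map_pow, map_add, eval_C, eval_X,
      Polynomial.eval_mul, Polynomial.eval_C, Polynomial.eval_pow, Polynomial.eval_add,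
      Polynomial.eval_X]
    rw [← hs, ← Finset.prod_pow_eq_pow_sum]
    rw [mul_left_comm, ← Finset.prod_mul_distrib]
    congr 1
    refine Finset.prod_congr rfl fun i _ => ?_
    rw [← mul_pow]
    congr 1
    field_simp

/-! ### Apolarity as a Hankel condition -/

theorem pderiv0_iter (k p q : ℕ) (a : ℂ) :
    (fun g : MvPolynomial (Fin 2) ℂ => pderiv (0 : Fin 2) g)^[k] (C a * X 0 ^ p * X 1 ^ q) =
      C (a * p.descFactorial k) * X 0 ^ (p - k) * X 1 ^ q := by
  induction k with
  | zero => simp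
  | succ k ih =>
    rw [Function.iterate_succ_apply', ih, Nat.descFactorial_succ]
    simp [Derivation.leibniz, Derivation.leibniz_pow, pderiv_X]
    rw [Nat.sub_sub]
    ring

theorem pderiv1_iter (k p q : ℕ) (a : ℂ) :
    (fun g : MvPolynomial (Fin 2) ℂ => pderiv (1 : Fin 2) g)^[k] (C a * X 0 ^ p * X 1 ^ q) =
      C (a * q.descFactorial k) * X 0 ^ p * X 1 ^ (q - k) := by
  induction k with
  | zero => simp
  | succ k ih =>
    rw [Function.iterate_succ_apply', ih, Nat.descFactorial_succ]
    simp [Derivation.leibniz, Derivation.leibniz_pow, pderiv_X]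
    rw [Nat.sub_sub]
    ring

theorem pderiv_iter_sum (i : Fin 2) (k : ℕ) {α : Type*} (s : Finset α) (F : α → MvPolynomial (Fin 2) ℂ) :
    (fun g : MvPolynomial (Fin 2) ℂ => pderiv i g)^[k] (∑ x ∈ s, F x) =
      ∑ x ∈ s, (fun g : MvPolynomial (Fin 2) ℂ => pderiv i g)^[k] (F x) := by
  induction k with
  | zero => simp
  | succ k ih => simp only [Function.iterate_succ_apply', ih, map_sum]

/-- The functional attached to a form by apolarity. -/
def alph (d : ℕ) (a : Fin (d+1) → ℂ) : Polynomial ℂ →ₗ[ℂ] ℂ :=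
  ∑ l : Fin (d+1), (((d - (l : ℕ)).factorial : ℂ) * ((l : ℕ).factorial : ℂ) * a l) •
    Polynomial.lcoeff ℂ (l : ℕ)

theorem alph_X_pow (d : ℕ) (a : Fin (d+1) → ℂ) (l : Fin (d+1)) :
    alph d a (Polynomial.X ^ (l : ℕ)) =
      ((d - (l : ℕ)).factorial : ℂ) * ((l : ℕ).factorial : ℂ) * a l := by
  simp only [alph, LinearMap.sum_apply, LinearMap.smul_apply, Polynomial.lcoeff_apply,
    Polynomial.coeff_X_pow, smul_eq_mul]
  rw [Finset.sum_eq_single l]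
  · simp
  · intro b _ hb
    rw [if_neg (by intro h; exact hb (Fin.ext h)), mul_zero]
  · simp

theorem mem_apolarSet (r m : ℕ) (a : Fin (r+m+1) → ℂ) (b : Fin (r+1) → ℂ) :
    b ∈ apolarSet (r+m) r a ↔ ∀ c : ℕ, c ≤ m → alph (r+m) a (Polynomial.X ^ c * toP r b) = 0 := by
  have hal : ∀ c : ℕ, c ≤ m → alph (r+m) a (Polynomial.X ^ c * toP r b) =
      ∑ i : Fin (r+1), b i * alph (r+m) a (Polynomial.X ^ (c + i)) := by
    intro c _
    conv_lhs => rw [toP]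
    simp only [LinearMap.coe_mk, AddHom.coe_mk, Finset.mul_sum, map_sum]
    refine Finset.sum_congr rfl fun i _ => ?_
    rw [← Polynomial.C_mul_X_pow_eq_monomial, mul_left_comm, ← pow_add, ← Polynomial.smul_eq_C_mul,
      map_smul, smul_eq_mul]
  have key : diffOp r b (binForm (r+m) a) = binForm m (fun c =>
      ((m - (c : ℕ)).factorial : ℂ)⁻¹ * ((c : ℕ).factorial : ℂ)⁻¹ *
        alph (r+m) a (Polynomial.X ^ (c : ℕ) * toP r b)) := by
    simp only [diffOp, binForm]
    have h1 : ∀ i : Fin (r+1), b i •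
        ((fun g => pderiv (0 : Fin 2) g)^[r - (i : ℕ)]
          (((fun g => pderiv (1 : Fin 2) g)^[(i : ℕ)]) (∑ l : Fin (r+m+1),
            C (a l) * X 0 ^ (r + m - (l : ℕ)) * X 1 ^ (l : ℕ)))) =
        ∑ c : Fin (m+1), C (((m - (c : ℕ)).factorial : ℂ)⁻¹ * ((c : ℕ).factorial : ℂ)⁻¹ *
          (b i * alph (r+m) a (Polynomial.X ^ ((c:ℕ) + i)))) * X 0 ^ (m - (c:ℕ)) * X 1 ^ (c:ℕ) := by
      intro i
      rw [pderiv_iter_sum, pderiv_iter_sum, Finset.smul_sum]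
      simp only [pderiv1_iter, pderiv0_iter]
      symm
      have hb : ∀ c : Fin (m+1), (c : ℕ) + i < r + m + 1 := fun c => by
        have := c.2; have := i.2; omega
      refine Finset.sum_of_injOn (fun c => ⟨(c : ℕ) + i, hb c⟩) ?_ ?_ ?_ ?_
      · intro c _ c' _ h
        simp at h
        exact Fin.ext h
      · intro c _; simp
      · intro l _ hl
        have : (l : ℕ) < i ∨ i + m < l := by
          by_contra hcon
          push Not at hcon
          apply hl
          refine ⟨⟨l - i, by omega⟩, by simp, Fin.ext ?_⟩
          simp; omega
        rcases this with h | h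
        · rw [Nat.descFactorial_of_lt h]; simp
        · rw [Nat.descFactorial_of_lt (n := r + m - l) (k := r - i) (by have := l.2; have := i.2; omega)]
          simp
      · intro c _
        have := alph_X_pow (r+m) a ⟨(c : ℕ) + i, hb c⟩
        simp only at this
        simp only
        rw [this]
        have hc := c.2
        have hi := i.2
        have e1 : r + m - ((c:ℕ) + i) - (r - i) = m - c := by omega
        have e2 : (c : ℕ) + i - i = c := by omega
        rw [e1, e2, MvPolynomial.smul_eq_C_mul, mul_assoc (C _) (X 0 ^ _) (X 1 ^ _), mul_assoc (C _) (X 0 ^ _) (X 1 ^ _),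
          ← mul_assoc (C (b i)), ← C_mul]
        congr 2
        have f1 := Nat.factorial_mul_descFactorial (n := r + m - ((c:ℕ) + i)) (k := r - i) (by omega)
        have f2 := Nat.factorial_mul_descFactorial (n := (c:ℕ) + i) (k := i) (by omega)
        rw [e1] at f1
        rw [e2] at f2
        rw [← f1, ← f2]
        push_cast
        have g1 : ((m - (c:ℕ)).factorial : ℂ) ≠ 0 := by exact_mod_cast Nat.factorial_ne_zero _
        have g2 : ((c:ℕ).factorial : ℂ) ≠ 0 := by exact_mod_cast Nat.factorial_ne_zero _
        field_simp
    rw [Finset.sum_congr rfl fun i _ => h1 i, Finset.sum_comm]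
    refine Finset.sum_congr rfl fun c _ => ?_
    rw [hal c (by have := c.2; omega), Finset.mul_sum, map_sum, Finset.sum_mul, Finset.sum_mul]
  show diffOp r b (binForm (r+m) a) = 0 ↔ _
  have h0 : binForm (K := ℂ) m 0 = 0 := by simp [binForm]
  rw [key, ← h0, (binForm_injective m).eq_iff, _root_.funext_iff]
  constructor
  · intro h c hc
    have := h ⟨c, by omega⟩
    simp only [Pi.zero_apply, mul_eq_zero, inv_eq_zero, Nat.cast_eq_zero, Nat.factorial_ne_zero,
      false_or] at this
    exact this
  · intro h c
    rw [h c (by have := c.2; omega)]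
    simp

theorem mem_apolarSet' (r m : ℕ) (a : Fin (r+m+1) → ℂ) (b : Fin (r+1) → ℂ) :
    b ∈ apolarSet (r+m) r a ↔ ∀ p : Polynomial ℂ, p.natDegree ≤ m → alph (r+m) a (p * toP r b) = 0 := by
  rw [mem_apolarSet]
  constructor
  · intro h p hp
    rw [p.as_sum_range' (m+1) (by omega), Finset.sum_mul, map_sum]
    apply Finset.sum_eq_zero
    intro c hc
    rw [← Polynomial.C_mul_X_pow_eq_monomial, mul_assoc, ← Polynomial.smul_eq_C_mul, map_smul,
      h c (by simpa [Nat.lt_succ_iff] using hc), smul_zero]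
  · intro h c hc
    exact h _ (by simpa using hc)

/-- `apolarSet` as a submodule. -/
def apolarSub (r m : ℕ) (a : Fin (r+m+1) → ℂ) : Submodule ℂ (Fin (r+1) → ℂ) where
  carrier := apolarSet (r+m) r a
  zero_mem' := by rw [mem_apolarSet]; simp
  add_mem' := by
    intro x y hx hy
    rw [mem_apolarSet] at *
    intro c hc
    rw [map_add, mul_add, map_add, hx c hc, hy c hc, add_zero]
  smul_mem' := by
    intro t x hx
    rw [mem_apolarSet] at *
    intro c hc
    rw [map_smul, mul_smul_comm, map_smul, hx c hc, smul_zero]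

theorem span_apolarSet (r m : ℕ) (a : Fin (r+m+1) → ℂ) :
    Submodule.span ℂ (apolarSet (r+m) r a) = apolarSub r m a :=
  Submodule.span_eq (apolarSub r m a)

end

section
set_option linter.unusedSectionVars false

/-- Coefficientwise polynomial dependence. -/
def PolyFnP {ι : Type} (f : (ι → ℂ) → Polynomial ℂ) : Prop := ∀ k, PolyFn fun a => (f a).coeff k

namespace PolyFnP
variable {ι : Type} {f g : (ι → ℂ) → Polynomial ℂ}
theorem const (p : Polynomial ℂ) : PolyFnP (fun _ : ι → ℂ => p) := fun _ => PolyFn.const _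
theorem C {f : (ι → ℂ) → ℂ} (hf : PolyFn f) : PolyFnP (fun a => Polynomial.C (f a)) := by
  intro k
  simp only [Polynomial.coeff_C]
  split_ifs
  · exact hf
  · exact PolyFn.const 0
theorem add (hf : PolyFnP f) (hg : PolyFnP g) : PolyFnP (fun a => f a + g a) := by
  intro k; simp only [Polynomial.coeff_add]; exact (hf k).add (hg k)
theorem sub (hf : PolyFnP f) (hg : PolyFnP g) : PolyFnP (fun a => f a - g a) := by
  intro k; simp only [Polynomial.coeff_sub]; exact (hf k).sub (hg k)
theorem mul (hf : PolyFnP f) (hg : PolyFnP g) : PolyFnP (fun a => f a * g a) := by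
  intro k; simp only [Polynomial.coeff_mul]
  exact PolyFn.sum _ fun i _ => (hf _).mul (hg _)
theorem pow (hf : PolyFnP f) (k : ℕ) : PolyFnP (fun a => f a ^ k) := by
  induction k with
  | zero => simpa using const 1
  | succ k ih => simp only [pow_succ]; exact ih.mul hf
theorem prod {α : Type*} (s : Finset α) {F : α → (ι → ℂ) → Polynomial ℂ} (h : ∀ i ∈ s, PolyFnP (F i)) :
    PolyFnP (fun a => ∏ i ∈ s, F i a) := by
  classical
  induction s using Finset.induction_on with
  | empty => simpa using const 1
  | insert i s hi ih =>
    simp only [Finset.prod_insert hi]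
    exact (h i (by simp)).mul (ih fun j hj => h j (by simp [hj]))
theorem sum {α : Type*} (s : Finset α) {F : α → (ι → ℂ) → Polynomial ℂ} (h : ∀ i ∈ s, PolyFnP (F i)) :
    PolyFnP (fun a => ∑ i ∈ s, F i a) := by
  intro k; simp only [Polynomial.finsetSum_coeff]
  exact PolyFn.sum _ fun i hi => h i hi k
theorem lin {f g : (ι → ℂ) → ℂ} (hf : PolyFn f) (hg : PolyFn g) :
    PolyFnP (fun a => lin (f a) (g a)) := (C hf).add ((C hg).mul (const _))
end PolyFnP

/-! ### Bounded degree polynomials -/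
theorem mem_PD {D : ℕ} {p : Polynomial ℂ} : p ∈ Polynomial.degreeLT ℂ (D+1) ↔ p.natDegree ≤ D := by
  rw [Polynomial.mem_degreeLT, Polynomial.natDegree_le_iff_degree_le, Polynomial.degree_lt_iff_coeff_zero,
    Polynomial.degree_le_iff_coeff_zero]
  simp only [Nat.succ_le_iff, Nat.cast_lt]

theorem finrank_PD (D : ℕ) : Module.finrank ℂ (Polynomial.degreeLT ℂ (D+1)) = D + 1 := by
  rw [(Polynomial.degreeLTEquiv ℂ (D+1)).finrank_eq]; simp

/-- The space `q · S_n`, in coefficient coordinates. -/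
def qSub (r n : ℕ) (q : Polynomial ℂ) : Submodule ℂ (Fin (r+1) → ℂ) :=
  (Polynomial.degreeLT ℂ (n+1)).map ((vec r).comp (LinearMap.mulLeft ℂ q))

theorem mem_qSub {r n : ℕ} {q : Polynomial ℂ} {x : Fin (r+1) → ℂ} :
    x ∈ qSub r n q ↔ ∃ s : Polynomial ℂ, s.natDegree ≤ n ∧ vec r (q * s) = x := by
  simp only [qSub, Submodule.mem_map, mem_PD]
  rfl

theorem finrank_qSub {r n e : ℕ} {q : Polynomial ℂ} (hq : q ≠ 0) (hqd : q.natDegree ≤ e)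
    (he : e + n ≤ r) : Module.finrank ℂ (qSub r n q) = n + 1 := by
  rw [← finrank_PD n]
  apply LinearEquiv.finrank_eq
  symm
  refine (LinearEquiv.ofInjective (((vec r).comp (LinearMap.mulLeft ℂ q)).domRestrict
    (Polynomial.degreeLT ℂ (n+1))) ?_).trans (LinearEquiv.ofEq _ _ ?_)
  · rw [injective_iff_map_eq_zero]
    rintro ⟨s, hs⟩ h
    have h' : vec r (q * s) = vec r 0 := by rw [map_zero]; exact h
    have hd : (q * s).natDegree ≤ r := Polynomial.natDegree_mul_le.trans (by
      have := mem_PD.1 hs; omega)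
    have := vec_inj hd (by simp) h'
    rcases mul_eq_zero.1 this with h0 | h0
    · contradiction
    · exact Subtype.ext h0
  · rw [LinearMap.range_domRestrict]; rfl

/-! ### Tangent spaces -/
section tangent
variable {σ : Type} [Fintype σ] [DecidableEq σ]

/-- Tangent space as a submodule. -/
def tanSub (S : Set (σ → ℂ)) (a : σ → ℂ) : Submodule ℂ (σ → ℂ) where
  carrier := zTangentAt S a
  zero_mem' := by intro p _; simp
  add_mem' := by
    intro x y hx hy p hp
    have h1 := hx p hp
    have h2 := hy p hp
    simp only [Pi.add_apply, mul_add, Finset.sum_add_distrib, h1, h2, add_zero]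
  smul_mem' := by
    intro c x hx p hp
    have h1 := hx p hp
    simp only [Pi.smul_apply, smul_eq_mul, mul_left_comm _ c, ← Finset.mul_sum, h1, mul_zero]

theorem span_tan (S : Set (σ → ℂ)) (a : σ → ℂ) : Submodule.span ℂ (zTangentAt S a) = tanSub S a :=
  Submodule.span_eq (tanSub S a)

theorem derivative_aeval (γ : σ → Polynomial ℂ) (p : MvPolynomial σ ℂ) :
    Polynomial.derivative (aeval γ p) = ∑ i, aeval γ (pderiv i p) * Polynomial.derivative (γ i) := by
  induction p using MvPolynomial.induction_on with
  | C a => simp [Polynomial.algebraMap_eq]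
  | add p q hp hq => simp only [map_add, hp, hq, add_mul, Finset.sum_add_distrib]
  | mul_X p i hp =>
    have h1 : ∀ k, aeval γ (pderiv k (p * X i)) * Polynomial.derivative (γ k) =
        (aeval γ (pderiv k p) * Polynomial.derivative (γ k)) * γ i +
          (if k = i then aeval γ p * Polynomial.derivative (γ i) else 0) := by
      intro k
      rw [Derivation.leibniz, pderiv_X]
      split_ifs with hk
      · subst hk
        rw [Pi.single_eq_same, map_add, smul_eq_mul, smul_eq_mul, map_mul, map_mul, aeval_X, map_one]
        ring
      · rw [Pi.single_eq_of_ne (fun h => hk h.symm), map_add, smul_eq_mul, smul_eq_mul, map_mul, map_mul,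
          aeval_X, map_zero]
        ring
    rw [Finset.sum_congr rfl fun k _ => h1 k, Finset.sum_add_distrib, ← Finset.sum_mul, ← hp,
      Finset.sum_ite_eq' Finset.univ i, if_pos (Finset.mem_univ i), map_mul, aeval_X,
      Polynomial.derivative_mul]

theorem aeval_curve (γ : σ → Polynomial ℂ) (p : MvPolynomial σ ℂ) (e : ℂ) :
    (aeval γ p).eval e = eval (fun i => (γ i).eval e) p := by
  induction p using MvPolynomial.induction_on with
  | C a => simp [Polynomial.algebraMap_eq]
  | add p q hp hq => simp only [map_add, Polynomial.eval_add, hp, hq]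
  | mul_X p i hp => simp only [map_mul, Polynomial.eval_mul, hp, aeval_X, eval_X]

/-- velocity of a polynomial curve in `S` is tangent -/
theorem curve_tangent {S : Set (σ → ℂ)} (γ : σ → Polynomial ℂ)
    (h : ∀ e : ℂ, (fun i => (γ i).eval e) ∈ S) :
    (fun i => (γ i).coeff 1) ∈ zTangentAt S (fun i => (γ i).coeff 0) := by
  intro p hp
  have h0 : aeval γ p = 0 := by
    apply Polynomial.funext
    intro e
    rw [aeval_curve, hp _ (h e), Polynomial.eval_zero]
  have h1 := congrArg (Polynomial.eval 0) (derivative_aeval γ p)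
  rw [h0, Polynomial.derivative_zero, Polynomial.eval_zero, Polynomial.eval_finsetSum] at h1
  simp only [Polynomial.eval_mul, aeval_curve] at h1
  simp only [← Polynomial.coeff_zero_eq_eval_zero, Polynomial.coeff_derivative] at h1
  rw [h1]
  simp

theorem exists_alg_rel {A B : Type} [CommRing A] [CommRing B] [Algebra A B] [IsDomain A] [CharZero A]
    (hinj : Function.Injective (algebraMap A B)) (b : B) (h : IsAlgebraic A b) :
    ∃ P : Polynomial A, Polynomial.aeval b P = 0 ∧ Polynomial.aeval b (Polynomial.derivative P) ≠ 0 := by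
  classical
  have hex : ∃ N : ℕ, ∃ P : Polynomial A, P ≠ 0 ∧ Polynomial.aeval b P = 0 ∧ P.natDegree = N := by
    obtain ⟨P, h1, h2⟩ := h
    exact ⟨_, P, h1, h2, rfl⟩
  obtain ⟨P, hP0, hP, hN⟩ := Nat.find_spec hex
  refine ⟨P, hP, fun hd => ?_⟩
  have hpos : P.natDegree ≠ 0 := by
    intro h0
    rw [Polynomial.eq_C_of_natDegree_eq_zero h0] at hP hP0
    rw [Polynomial.aeval_C] at hP
    apply hP0
    rw [(map_eq_zero_iff _ hinj).1 hP, Polynomial.C_0]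
  have hlt : (Polynomial.derivative P).natDegree < Nat.find hex := by
    rw [← hN]; exact Polynomial.natDegree_derivative_lt hpos
  refine Nat.find_min hex hlt ⟨_, ?_, hd, rfl⟩
  intro h0
  exact hpos (Polynomial.derivative_eq_zero.1 h0)

theorem tangent_dim_le {ι : Type} [Fintype ι] {S : Set (σ → ℂ)} (φ : (ι → ℂ) → (σ → ℂ))
    (hφ : ∀ s, PolyFn fun a => φ a s) (hS : S ⊆ zClosure (Set.range φ)) :
    ∃ D : (ι → ℂ) → ℂ, PolyFn D ∧ (∃ a, D a ≠ 0) ∧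
      ∀ a, D a ≠ 0 → Module.finrank ℂ (tanSub S (φ a)) ≤ Fintype.card ι := by
  choose Q hQ using hφ
  have hQ' : ∀ a, φ a = fun t => eval a (Q t) := fun a => funext fun t => hQ t a
  obtain ⟨B, hB, hBmax⟩ := (Set.toFinite {B : Set σ | AlgebraicIndepOn ℂ Q B}).exists_maximal
    ⟨∅, by
      show AlgebraicIndependent ℂ _
      rw [algebraicIndependent_empty_type_iff]
      exact (algebraMap ℂ (MvPolynomial ι ℂ)).injective⟩
  have hB : AlgebraicIndependent ℂ (fun i : B => Q i) := hB
  have hcard : Nat.card B ≤ Fintype.card ι := by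
    have h1 := hB.lift_cardinalMk_le_trdeg
    rw [MvPolynomial.trdeg_of_isDomain] at h1
    have := Fintype.ofFinite B
    simpa using h1
  have halg : ∀ i : σ, i ∉ B → IsAlgebraic (Algebra.adjoin ℂ (Q '' B)) (Q i) := by
    intro i hi
    by_contra htr
    have h1 : AlgebraicIndepOn ℂ Q (insert i B) := AlgebraicIndepOn.insert hB htr
    exact hi (hBmax h1 (Set.subset_insert i B) (Set.mem_insert i B))
  have hlift : ∀ a : Algebra.adjoin ℂ (Q '' B), ∃ P : MvPolynomial σ ℂ, aeval Q P = a ∧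
      ∀ l, l ∉ B → pderiv l P = 0 := by
    rintro ⟨a, ha⟩
    induction ha using Algebra.adjoin_induction with
    | mem x hx =>
      obtain ⟨b, hb, rfl⟩ := hx
      refine ⟨X b, by simp, fun l hl => ?_⟩
      rw [pderiv_X, Pi.single_eq_of_ne]
      rintro rfl
      exact hl hb
    | algebraMap c => exact ⟨C c, by simp [algebraMap_eq], fun l _ => by simp⟩
    | add x y _ _ hx hy =>
      obtain ⟨P, h1, h2⟩ := hx
      obtain ⟨P', h1', h2'⟩ := hy
      refine ⟨P + P', ?_, fun l hl => by rw [map_add, h2 l hl, h2' l hl, add_zero]⟩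
      rw [map_add, h1, h1']
    | mul x y _ _ hx hy =>
      obtain ⟨P, h1, h2⟩ := hx
      obtain ⟨P', h1', h2'⟩ := hy
      refine ⟨P * P', ?_, fun l hl => by rw [Derivation.leibniz, h2 l hl, h2' l hl]; simp⟩
      rw [map_mul, h1, h1']
  choose lf hlf1 hlf2 using hlift
  have hrel : ∀ i : σ, i ∉ B → ∃ P : MvPolynomial σ ℂ, aeval Q P = 0 ∧ aeval Q (pderiv i P) ≠ 0 ∧
      ∀ l, l ∉ B → l ≠ i → pderiv l P = 0 := by
    intro i hi
    obtain ⟨p, hp, hp'⟩ := exists_alg_rel (A := Algebra.adjoin ℂ (Q '' B)) Subtype.val_injective (Q i) (halg i hi)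
    refine ⟨∑ k ∈ Finset.range (p.natDegree + 1), lf (p.coeff k) * X i ^ k, ?_, ?_, ?_⟩
    · rw [← hp, Polynomial.aeval_eq_sum_range, map_sum]
      refine Finset.sum_congr rfl fun k _ => ?_
      rw [map_mul, hlf1, map_pow, aeval_X]; rfl
    · convert hp' using 1
      conv_rhs => rw [p.as_sum_range, map_sum, map_sum]
      rw [map_sum, map_sum]
      refine Finset.sum_congr rfl fun k _ => ?_
      rw [Derivation.leibniz, hlf2 _ i hi, Derivation.leibniz_pow, pderiv_X_self]
      rw [Polynomial.derivative_monomial, Polynomial.aeval_monomial]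
      simp
      have h3 : bind₁ Q (lf (p.coeff k)) = (p.coeff k : MvPolynomial ι ℂ) := hlf1 (p.coeff k)
      rw [h3]
      ring
    · intro l hl hli
      rw [map_sum]
      apply Finset.sum_eq_zero
      intro k _
      rw [Derivation.leibniz, hlf2 _ l hl, Derivation.leibniz_pow, pderiv_X_of_ne hli.symm]
      simp
  classical
  choose! R hR1 hR2 hR3 using hrel
  refine ⟨fun a => eval a (∏ i ∈ Finset.univ.filter (fun i => i ∉ B), aeval Q (pderiv i (R i))),
    PolyFn.eval_poly _, ?_, ?_⟩
  · by_contra! hcon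
    have : (∏ i ∈ Finset.univ.filter (fun i => i ∉ B), aeval Q (pderiv i (R i))) = 0 :=
      MvPolynomial.funext fun a => by rw [hcon, map_zero]
    rw [Finset.prod_eq_zero_iff] at this
    obtain ⟨i, hi, hi'⟩ := this
    exact hR2 i (by simpa using hi) hi'
  · intro a ha
    simp only [map_prod, Finset.prod_ne_zero_iff] at ha
    have := Fintype.ofFinite B
    refine le_trans ?_ hcard
    let res : tanSub S (φ a) →ₗ[ℂ] (B → ℂ) :=
      (LinearMap.funLeft ℂ ℂ (Subtype.val : B → σ)).comp (tanSub S (φ a)).subtype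
    have hres : Function.Injective res := by
      rw [injective_iff_map_eq_zero]
      rintro ⟨v, hv⟩ h0
      have hvB : ∀ b ∈ B, v b = 0 := fun b hb => congrFun h0 ⟨b, hb⟩
      apply Subtype.ext
      funext i
      by_cases hi : i ∈ B
      · exact hvB i hi
      · have h1 := hv (R i) (by
          intro y hy
          apply hS hy
          rintro _ ⟨a', rfl⟩
          rw [hQ', ← eval_aeval', hR1 i hi, map_zero])
        rw [Finset.sum_eq_single i] at h1
        · rcases mul_eq_zero.1 h1 with h2 | h2
          · exfalso
            apply ha i (by simpa using hi)
            rw [eval_aeval', ← hQ']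
            exact h2
          · exact h2
        · intro l _ hl
          by_cases hlB : l ∈ B
          · rw [hvB l hlB, mul_zero]
          · rw [hR3 i hi l hlB hl]; simp
        · simp
    have := LinearMap.finrank_le_finrank_of_injective hres
    simpa using this
end tangent

end

section
set_option linter.unusedSectionVars false

/-- product of powers of linear forms -/
def xP {n : ℕ} (lam : Fin n → ℕ) (u v : Fin n → ℂ) : Polynomial ℂ := ∏ i, lin (u i) (v i) ^ lam i

/-- the exponents lowered by one -/
def qP {n : ℕ} (lam : Fin n → ℕ) (u v : Fin n → ℂ) : Polynomial ℂ := xP (fun i => lam i - 1) u v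

theorem natDegree_xP {n : ℕ} (lam : Fin n → ℕ) (u v : Fin n → ℂ) :
    (xP lam u v).natDegree ≤ ∑ i, lam i := by
  unfold xP
  refine (Polynomial.natDegree_prod_le _ _).trans (Finset.sum_le_sum fun i _ => ?_)
  refine Polynomial.natDegree_pow_le.trans ?_
  have := natDegree_lin (u i) (v i)
  nlinarith

theorem sum_pred {r n : ℕ} {lam : Fin n → ℕ} (h : isPartitionOf r n lam) :
    ∑ i, (lam i - 1) + n = r := by
  have : ∑ i, lam i = ∑ i, (lam i - 1) + ∑ i : Fin n, 1 := by
    rw [← Finset.sum_add_distrib]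
    exact Finset.sum_congr rfl fun i _ => by have := h.1 i; omega
  rw [← h.2, this]; simp

theorem natDegree_qP {r n : ℕ} {lam : Fin n → ℕ} (h : isPartitionOf r n lam) (u v : Fin n → ℂ) :
    (qP lam u v).natDegree ≤ r - n := by
  refine (natDegree_xP _ u v).trans ?_
  have := sum_pred h
  omega

theorem xP_ne_zero {n : ℕ} (lam : Fin n → ℕ) {u v : Fin n → ℂ} (h : ∀ i, u i ≠ 0 ∨ v i ≠ 0) :
    xP lam u v ≠ 0 :=
  Finset.prod_ne_zero_iff.2 fun i _ => pow_ne_zero _ (lin_ne_zero (h i))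

theorem xP_eq_q_mul {n : ℕ} {lam : Fin n → ℕ} (h : ∀ i, 1 ≤ lam i) (u v : Fin n → ℂ) :
    xP lam u v = qP lam u v * ∏ i, lin (u i) (v i) := by
  unfold qP xP
  rw [← Finset.prod_mul_distrib]
  refine Finset.prod_congr rfl fun i _ => ?_
  rw [← pow_succ]; congr 1; have := h i; show lam i = lam i - 1 + 1; omega

theorem PolyFnP.xP {ι : Type} {n : ℕ} (lam : Fin n → ℕ) {u v : (ι → ℂ) → Fin n → ℂ}
    (hu : ∀ i, PolyFn fun a => u a i) (hv : ∀ i, PolyFn fun a => v a i) :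
    PolyFnP fun a => xP lam (u a) (v a) :=
  PolyFnP.prod _ fun i _ => (PolyFnP.lin (hu i) (hv i)).pow _

theorem PolyFnP.qP {ι : Type} {n : ℕ} (lam : Fin n → ℕ) {u v : (ι → ℂ) → Fin n → ℂ}
    (hu : ∀ i, PolyFn fun a => u a i) (hv : ∀ i, PolyFn fun a => v a i) :
    PolyFnP fun a => qP lam (u a) (v a) := PolyFnP.xP _ hu hv

theorem vec_mem_crl {r n : ℕ} {lam : Fin n → ℕ} (h : isPartitionOf r n lam) (t : ℂ) (u v : Fin n → ℂ) :
    vec r (Polynomial.C t * xP lam u v) ∈ crlCone r n lam := by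
  rw [mem_crlCone h.2]
  refine ⟨t, u, v, toP_vec ?_⟩
  refine (Polynomial.natDegree_C_mul_le _ _).trans ((natDegree_xP _ _ _).trans h.2.le)

theorem mem_crl_iff {r n : ℕ} {lam : Fin n → ℕ} (h : isPartitionOf r n lam) (a : Fin (r+1) → ℂ) :
    a ∈ crlCone r n lam ↔ ∃ (t : ℂ) (u v : Fin n → ℂ), a = vec r (Polynomial.C t * xP lam u v) := by
  constructor
  · intro ha
    obtain ⟨t, u, v, h1⟩ := (mem_crlCone h.2 a).1 ha
    refine ⟨t, u, v, ?_⟩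
    rw [← vec_toP r a, h1]; rfl
  · rintro ⟨t, u, v, rfl⟩
    exact vec_mem_crl h t u v

theorem xP_update {n : ℕ} (lam : Fin n → ℕ) (u v : Fin n → ℂ) (i : Fin n) (a b : ℂ) :
    xP lam (Function.update u i a) (Function.update v i b) =
      lin a b ^ lam i * ∏ l ∈ Finset.univ.erase i, lin (u l) (v l) ^ lam l := by
  unfold xP
  rw [← Finset.mul_prod_erase _ _ (Finset.mem_univ i)]
  congr 1
  · simp
  · refine Finset.prod_congr rfl fun l hl => ?_
    rw [Function.update_of_ne (Finset.ne_of_mem_erase hl), Function.update_of_ne (Finset.ne_of_mem_erase hl)]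

theorem dir_mem {r n : ℕ} {lam : Fin n → ℕ} (h : isPartitionOf r n lam) (t : ℂ) (u v : Fin n → ℂ)
    (i : Fin n) (a b : ℂ) :
    vec r (Polynomial.C t * ((lam i : Polynomial ℂ) * lin (u i) (v i) ^ (lam i - 1) * lin a b *
      ∏ l ∈ Finset.univ.erase i, lin (u l) (v l) ^ lam l)) ∈
      tanSub (crlCone r n lam) (vec r (Polynomial.C t * xP lam u v)) := by
  set W := ∏ l ∈ Finset.univ.erase i, lin (u l) (v l) ^ lam l with hW
  let M : Polynomial ℂ →+* Polynomial (Polynomial ℂ) := Polynomial.mapRingHom Polynomial.C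
  let E : Polynomial (Polynomial ℂ) := Polynomial.C Polynomial.X
  obtain ⟨K, hK⟩ := Polynomial.powAddExpansion (M (lin (u i) (v i))) (E * M (lin a b)) (lam i)
  let G : Polynomial (Polynomial ℂ) := M (Polynomial.C t * W) * (M (lin (u i) (v i)) + E * M (lin a b)) ^ lam i
  have hG : G = M (Polynomial.C t * xP lam u v) + E * M (Polynomial.C t *
      ((lam i : Polynomial ℂ) * lin (u i) (v i) ^ (lam i - 1) * lin a b * W)) +
        E ^ 2 * (M (Polynomial.C t * W) * K * M (lin a b) ^ 2) := by
    have hx : xP lam u v = lin (u i) (v i) ^ lam i * W := by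
      have := xP_update lam u v i (u i) (v i)
      rwa [Function.update_eq_self, Function.update_eq_self] at this
    rw [hx]
    show M _ * _ = _
    rw [hK]
    simp only [map_mul, map_pow, map_natCast]
    ring
  have hc : ∀ k : ℕ, G.coeff k = Polynomial.C ((Polynomial.C t * xP lam u v).coeff k) +
      Polynomial.X * Polynomial.C ((Polynomial.C t *
      ((lam i : Polynomial ℂ) * lin (u i) (v i) ^ (lam i - 1) * lin a b * W)).coeff k) +
      Polynomial.X ^ 2 * ((M (Polynomial.C t * W) * K * M (lin a b) ^ 2).coeff k) := by
    intro k
    rw [hG, Polynomial.coeff_add, Polynomial.coeff_add]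
    show _ + (Polynomial.C Polynomial.X * _).coeff k + ((Polynomial.C Polynomial.X) ^ 2 * _).coeff k = _
    rw [← Polynomial.C_pow, Polynomial.coeff_C_mul, Polynomial.coeff_C_mul]
    congr 2
    · exact Polynomial.coeff_map _ _
    · congr 1
      exact Polynomial.coeff_map _ _
  have key := curve_tangent (S := crlCone r n lam) (fun k : Fin (r+1) => G.coeff k) (by
    intro e
    have h1 : (fun k : Fin (r+1) => (G.coeff k).eval e) = vec r (Polynomial.C t * xP lam
        (Function.update u i (u i + e * a)) (Function.update v i (v i + e * b))) := by
      have h2 : G.map (Polynomial.evalRingHom e) = Polynomial.C t * xP lam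
        (Function.update u i (u i + e * a)) (Function.update v i (v i + e * b)) := by
        have hM : ∀ p, (M p).map (Polynomial.evalRingHom e) = p := by
          intro p
          show (p.map Polynomial.C).map _ = p
          rw [Polynomial.map_map]
          convert Polynomial.map_id
          ext x <;> simp
        rw [xP_update]
        simp only [G, E, Polynomial.map_mul, Polynomial.map_pow, Polynomial.map_add, hM, Polynomial.map_C]
        rw [← hW]
        have : lin (u i) (v i) + Polynomial.C (Polynomial.evalRingHom e Polynomial.X) * lin a b
            = lin (u i + e * a) (v i + e * b) := by
          simp only [lin, Polynomial.coe_evalRingHom, Polynomial.eval_X, Polynomial.C_add, Polynomial.C_mul]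
          ring
        rw [this]; ring
      funext k
      rw [vec_apply, ← h2, Polynomial.coeff_map]; rfl
    rw [h1]
    exact vec_mem_crl h _ _ _)
  simp only [hc] at key
  have e1 : ∀ (A B : ℂ) (Cc : Polynomial ℂ), (Polynomial.C A + Polynomial.X * Polynomial.C B +
      Polynomial.X ^ 2 * Cc).coeff 1 = B := by
    intro A B Cc
    simp [Polynomial.coeff_X_pow_mul', Polynomial.coeff_C]
  have e0 : ∀ (A B : ℂ) (Cc : Polynomial ℂ), (Polynomial.C A + Polynomial.X * Polynomial.C B +
      Polynomial.X ^ 2 * Cc).coeff 0 = A := by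
    intro A B Cc
    simp
  simp only [e1, e0] at key
  exact key

theorem lin_eval_root {u v : ℂ} (hv : v ≠ 0) : (lin u v).eval (-u/v) = 0 := by
  simp [lin]; field_simp; ring

theorem eval_lin (u v x : ℂ) : (lin u v).eval x = u + v * x := by simp [lin]

theorem generic_decomp {n : ℕ} (u v : Fin n → ℂ) (hn : 0 < n) (hv : ∀ i, v i ≠ 0)
    (hd : ∀ i l, i ≠ l → u i * v l ≠ u l * v i) (s : Polynomial ℂ) (hs : s.natDegree ≤ n) :
    ∃ a b : Fin n → ℂ, s = ∑ i, lin (a i) (b i) * ∏ l ∈ Finset.univ.erase i, lin (u l) (v l) := by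
  let rho : Fin n → ℂ := fun i => -u i / v i
  have hrho : Function.Injective rho := by
    intro i l hil
    by_contra hne
    apply hd i l hne
    simp only [rho] at hil
    have := hv i; have := hv l
    field_simp at hil
    linear_combination -hil
  let w : Fin n → Polynomial ℂ := fun i => ∏ l ∈ Finset.univ.erase i, lin (u l) (v l)
  have hw0 : ∀ i l, i ≠ l → (w i).eval (rho l) = 0 := by
    intro i l hil
    simp only [w, Polynomial.eval_prod]
    exact Finset.prod_eq_zero (i := l) (by simp [hil.symm]) (lin_eval_root (hv l))
  have hw1 : ∀ i, (w i).eval (rho i) ≠ 0 := by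
    intro i
    simp only [w, Polynomial.eval_prod]
    refine Finset.prod_ne_zero_iff.2 fun l hl => ?_
    rw [eval_lin]
    have hne := hd i l (Finset.ne_of_mem_erase hl).symm
    intro h0
    apply hne
    simp only [rho] at h0
    have := hv i
    field_simp at h0
    linear_combination -h0
  have hwd : ∀ i, (w i).natDegree ≤ n - 1 := by
    intro i
    refine (Polynomial.natDegree_prod_le _ _).trans ?_
    refine (Finset.sum_le_card_nsmul _ _ 1 fun l _ => natDegree_lin _ _).trans ?_
    simp
  let rad : Polynomial ℂ := ∏ l, lin (u l) (v l)
  have hradc : rad.coeff n ≠ 0 := by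
    have h1 : rad.coeff n = ∏ l, v l := by
      have h3 := Polynomial.coeff_prod_of_natDegree_le (s := Finset.univ) (f := fun l => lin (u l) (v l)) (n := 1) (fun l _ => natDegree_lin _ _)
      simp only [Finset.card_univ, Fintype.card_fin, mul_one] at h3
      simp only [rad]
      rw [h3]
      exact Finset.prod_congr rfl fun l _ => by simp [lin]
    rw [h1]
    exact Finset.prod_ne_zero_iff.2 fun l _ => hv l
  have hradd : rad.natDegree ≤ n := by
    refine (Polynomial.natDegree_prod_le _ _).trans ?_
    refine (Finset.sum_le_card_nsmul _ _ 1 fun l _ => natDegree_lin _ _).trans ?_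
    simp
  have hrade : ∀ i, rad.eval (rho i) = 0 := by
    intro i
    simp only [rad, Polynomial.eval_prod]
    exact Finset.prod_eq_zero (Finset.mem_univ i) (lin_eval_root (hv i))
  let c : Fin n → ℂ := fun i => s.eval (rho i) / (w i).eval (rho i)
  let s1 := s - ∑ i, Polynomial.C (c i) * w i
  let kap := s1.coeff n / rad.coeff n
  have hs1d : s1.natDegree ≤ n := by
    refine (Polynomial.natDegree_sub_le _ _).trans (max_le hs ?_)
    refine Polynomial.natDegree_sum_le_of_forall_le _ _ fun i _ => ?_
    refine (Polynomial.natDegree_C_mul_le _ _).trans ((hwd i).trans (by omega))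
  have hz : s1 - Polynomial.C kap * rad = 0 := by
    refine Polynomial.eq_zero_of_degree_lt_of_eval_index_eq_zero (s := Finset.univ) (v := rho) hrho.injOn ?_ ?_
    · rw [Polynomial.degree_lt_iff_coeff_zero]
      intro k hk
      simp only [Finset.card_univ, Fintype.card_fin] at hk
      rcases hk.eq_or_lt with h | h
      · subst h
        rw [Polynomial.coeff_sub, Polynomial.coeff_C_mul]
        simp only [kap]
        field_simp
        ring
      · rw [Polynomial.coeff_sub, Polynomial.coeff_C_mul, Polynomial.coeff_eq_zero_of_natDegree_lt (by omega),
          Polynomial.coeff_eq_zero_of_natDegree_lt (p := rad) (by omega)]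
        simp
    · intro i _
      simp only [s1, Polynomial.eval_sub, Polynomial.eval_mul, Polynomial.eval_C, hrade, Polynomial.eval_finsetSum]
      rw [Finset.sum_eq_single i]
      · simp only [c]
        rw [div_mul_cancel₀ _ (hw1 i)]; simp
      · intro l _ hl
        rw [hw0 l i hl, mul_zero]
      · simp
  let i0 : Fin n := ⟨0, hn⟩
  have hrw : rad = lin (u i0) (v i0) * w i0 := by
    simp only [rad, w]
    rw [Finset.mul_prod_erase _ (fun l => lin (u l) (v l)) (Finset.mem_univ i0)]
  refine ⟨fun i => c i + if i = i0 then kap * u i0 else 0, fun i => if i = i0 then kap * v i0 else 0, ?_⟩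
  have h5 : ∀ i, lin (c i + if i = i0 then kap * u i0 else 0) (if i = i0 then kap * v i0 else 0) * w i =
      Polynomial.C (c i) * w i + if i = i0 then Polynomial.C kap * rad else 0 := by
    intro i
    split_ifs with h
    · rw [h, hrw]; simp only [lin, Polynomial.C_add, Polynomial.C_mul]; ring
    · simp only [lin, Polynomial.C_0, add_zero, zero_mul]
  show s = ∑ i, _ * w i
  rw [Finset.sum_congr rfl fun i _ => h5 i, Finset.sum_add_distrib, Finset.sum_ite_eq' Finset.univ i0,
    if_pos (Finset.mem_univ _), ← sub_eq_zero, ← hz]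
  simp only [s1]
  ring

theorem qSub_le_tan_generic {r n : ℕ} {lam : Fin n → ℕ} (h : isPartitionOf r n lam) (hn : 0 < n)
    {t : ℂ} (ht : t ≠ 0) (u v : Fin n → ℂ) (hv : ∀ i, v i ≠ 0)
    (hd : ∀ i l, i ≠ l → u i * v l ≠ u l * v i) :
    qSub r n (qP lam u v) ≤ tanSub (crlCone r n lam) (vec r (Polynomial.C t * xP lam u v)) := by
  intro x hx
  obtain ⟨s, hs, rfl⟩ := mem_qSub.1 hx
  obtain ⟨a, b, hab⟩ := generic_decomp u v hn hv hd s hs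
  rw [hab, Finset.mul_sum, map_sum]
  refine Submodule.sum_mem _ fun i _ => ?_
  have h1 := dir_mem h t u v i (a i) (b i)
  have h2 : qP lam u v * (lin (a i) (b i) * ∏ l ∈ Finset.univ.erase i, lin (u l) (v l)) =
      (t * lam i)⁻¹ • (Polynomial.C t * ((lam i : Polynomial ℂ) * lin (u i) (v i) ^ (lam i - 1) * lin (a i) (b i) *
      ∏ l ∈ Finset.univ.erase i, lin (u l) (v l) ^ lam l)) := by
    have hl : (lam i : ℂ) ≠ 0 := by have := h.1 i; exact_mod_cast (by omega)
    have h3 : ∏ l ∈ Finset.univ.erase i, lin (u l) (v l) ^ lam l =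
        (∏ l ∈ Finset.univ.erase i, lin (u l) (v l) ^ (lam l - 1)) * ∏ l ∈ Finset.univ.erase i, lin (u l) (v l) := by
      rw [← Finset.prod_mul_distrib]
      refine Finset.prod_congr rfl fun l _ => ?_
      rw [← pow_succ]; congr 1; have := h.1 l; omega
    have h4 : qP lam u v = lin (u i) (v i) ^ (lam i - 1) * ∏ l ∈ Finset.univ.erase i, lin (u l) (v l) ^ (lam l - 1) := by
      rw [qP, xP, Finset.mul_prod_erase _ (fun l => lin (u l) (v l) ^ (lam l - 1)) (Finset.mem_univ i)]
    rw [h3, h4, Polynomial.smul_eq_C_mul]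
    have h5 : Polynomial.C (t * (lam i : ℂ))⁻¹ * (Polynomial.C t * (lam i : Polynomial ℂ)) = 1 := by
      rw [← Polynomial.C_eq_natCast, ← Polynomial.C_mul, ← Polynomial.C_mul, inv_mul_cancel₀ (mul_ne_zero ht hl), Polynomial.C_1]
    linear_combination (-(lin (u i) (v i) ^ (lam i - 1) * lin (a i) (b i) * (∏ l ∈ Finset.univ.erase i, lin (u l) (v l) ^ (lam l - 1)) * ∏ l ∈ Finset.univ.erase i, lin (u l) (v l))) * h5
  rw [h2, map_smul]
  exact Submodule.smul_mem _ _ h1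

theorem qSub_le_tan {r n : ℕ} {lam : Fin n → ℕ} (h : isPartitionOf r n lam) (hn : 0 < n)
    {t : ℂ} (ht : t ≠ 0) (u v : Fin n → ℂ) :
    qSub r n (qP lam u v) ≤ tanSub (crlCone r n lam) (vec r (Polynomial.C t * xP lam u v)) := by
  intro x hx
  obtain ⟨s, hs, rfl⟩ := mem_qSub.1 hx
  intro p hp
  let U : (Fin n ⊕ Fin n → ℂ) → Fin n → ℂ := fun a i => a (Sum.inl i)
  let V : (Fin n ⊕ Fin n → ℂ) → Fin n → ℂ := fun a i => a (Sum.inr i)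
  have hU : ∀ i, PolyFn fun a => U a i := fun i => PolyFn.coord _
  have hV : ∀ i, PolyFn fun a => V a i := fun i => PolyFn.coord _
  have hx := PolyFnP.xP lam hU hV
  have hq := PolyFnP.qP lam hU hV
  have key := PolyFn.cancel (f := fun a => ∑ i, eval (vec r (Polynomial.C t * xP lam (U a) (V a))) (pderiv i p) *
      vec r (qP lam (U a) (V a) * s) i)
    (g := fun a => (∏ i, V a i) * ∏ i, ∏ l ∈ Finset.univ.erase i, (U a i * V a l - U a l * V a i))
    (PolyFn.sum _ fun i _ => (PolyFn.comp (PolyFn.eval_poly _) fun k => ((PolyFnP.const _).mul hx) _).mul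
      ((hq.mul (PolyFnP.const _)) _))
    ((PolyFn.prod _ fun i _ => hV i).mul (PolyFn.prod _ fun i _ => PolyFn.prod _ fun l _ =>
      ((hU i).mul (hV l)).sub ((hU l).mul (hV i)))) (by
      intro a
      by_cases hg : (∏ i, V a i) * ∏ i, ∏ l ∈ Finset.univ.erase i, (U a i * V a l - U a l * V a i) = 0
      · exact Or.inr hg
      · left
        rw [mul_eq_zero, not_or, ← Ne, ← Ne, Finset.prod_ne_zero_iff, Finset.prod_ne_zero_iff] at hg
        have := qSub_le_tan_generic h hn ht (U a) (V a) (fun i => hg.1 i (Finset.mem_univ i)) (by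
          intro i l hil
          have := Finset.prod_ne_zero_iff.1 (hg.2 i (Finset.mem_univ i)) l (by simp [hil.symm])
          exact sub_ne_zero.1 this) (mem_qSub.2 ⟨s, hs, rfl⟩)
        exact this p hp)
    ⟨Sum.elim (fun i => (i : ℂ)) (fun _ => 1), by
      simp only [U, V, Sum.elim_inl, Sum.elim_inr, Finset.prod_const_one, one_mul, mul_one]
      refine Finset.prod_ne_zero_iff.2 fun i _ => Finset.prod_ne_zero_iff.2 fun l hl => ?_
      rw [sub_ne_zero]
      intro hil
      have : (i : ℕ) = l := by exact_mod_cast hil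
      exact Finset.ne_of_mem_erase hl (Fin.ext this.symm)⟩
  exact key (Sum.elim u v)

/-- At smooth points the tangent space is `q S_n`. -/
theorem tan_eq_qSub {r n : ℕ} {lam : Fin n → ℕ} (h : isPartitionOf r n lam) (hn : 0 < n)
    {t : ℂ} {u v : Fin n → ℂ} (hx : vec r (Polynomial.C t * xP lam u v) ≠ 0)
    (hd : Module.finrank ℂ (tanSub (crlCone r n lam) (vec r (Polynomial.C t * xP lam u v))) ≤ n + 1) :
    tanSub (crlCone r n lam) (vec r (Polynomial.C t * xP lam u v)) = qSub r n (qP lam u v) := by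
  have ht : t ≠ 0 := by
    rintro rfl; simp at hx
  have hq : qP lam u v ≠ 0 := by
    intro h0
    rw [xP_eq_q_mul h.1, h0] at hx
    simp at hx
  symm
  apply Submodule.eq_of_le_of_finrank_le (qSub_le_tan h hn ht u v)
  rw [finrank_qSub hq (natDegree_qP h u v)]
  · exact hd
  · have := sum_pred h; omega

theorem exists_smooth {r n : ℕ} {lam : Fin n → ℕ} (h : isPartitionOf r n lam) :
    ∃ D : (Option (Fin n) → ℂ) → ℂ, PolyFn D ∧ (∃ a, D a ≠ 0) ∧ ∀ a, D a ≠ 0 →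
      Module.finrank ℂ (tanSub (crlCone r n lam)
        (vec r (Polynomial.C (a none) * xP lam (fun i => - a (some i)) (fun _ => 1)))) ≤ n + 1 := by
  have := tangent_dim_le (S := crlCone r n lam) (ι := Option (Fin n))
    (fun a => vec r (Polynomial.C (a none) * xP lam (fun i => - a (some i)) (fun _ => 1)))
    (fun k => ((PolyFnP.C (PolyFn.coord none)).mul
      (PolyFnP.xP lam (fun i => (PolyFn.coord _).neg) (fun i => PolyFn.const _))) _) (by
    intro x hx p hp
    obtain ⟨t, u, v, rfl⟩ := (mem_crl_iff h x).1 hx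
    let U : (Fin n ⊕ Fin n → ℂ) → Fin n → ℂ := fun a i => a (Sum.inl i)
    let V : (Fin n ⊕ Fin n → ℂ) → Fin n → ℂ := fun a i => a (Sum.inr i)
    have hU : ∀ i, PolyFn fun a => U a i := fun i => PolyFn.coord _
    have hV : ∀ i, PolyFn fun a => V a i := fun i => PolyFn.coord _
    have key := PolyFn.cancel (f := fun a => eval (vec r (Polynomial.C t * xP lam (U a) (V a))) p)
      (g := fun a => ∏ i, V a i)
      (PolyFn.comp (PolyFn.eval_poly _) fun k => ((PolyFnP.const _).mul (PolyFnP.xP lam hU hV)) _)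
      (PolyFn.prod _ fun i _ => hV i) (by
        intro a
        by_cases hg : ∏ i, V a i = 0
        · exact Or.inr hg
        · left
          rw [← Ne, Finset.prod_ne_zero_iff] at hg
          apply hp
          refine ⟨fun o => o.elim (t * ∏ i, V a i ^ lam i) (fun i => - (U a i / V a i)), ?_⟩
          simp only [Option.elim_none, Option.elim_some, neg_neg]
          congr 1
          rw [Polynomial.C_mul, mul_assoc]
          congr 1
          rw [map_prod]
          unfold xP
          rw [← Finset.prod_mul_distrib]
          refine Finset.prod_congr rfl fun i _ => ?_
          rw [Polynomial.C_pow, ← mul_pow]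
          congr 1
          have := hg i (Finset.mem_univ i)
          simp only [lin, mul_add, ← mul_assoc, ← Polynomial.C_mul, mul_one]
          rw [mul_div_cancel₀ _ this])
      ⟨fun _ => 1, by simp [V]⟩
    exact key (Sum.elim u v))
  simpa using this

end

section
set_option linter.unusedSectionVars false

theorem pderiv_aeval' {ι κ : Type} [Fintype ι] [DecidableEq ι] (F : ι → MvPolynomial κ ℂ) (k : κ)
    (p : MvPolynomial ι ℂ) :
    pderiv k (aeval F p) = ∑ i, aeval F (pderiv i p) * pderiv k (F i) := by
  induction p using MvPolynomial.induction_on with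
  | C a => simp [algebraMap_eq]
  | add p q hp hq => simp only [map_add, hp, hq, add_mul, Finset.sum_add_distrib]
  | mul_X p i hp =>
    have h1 : ∀ l, aeval F (pderiv l (p * X i)) * pderiv k (F l) =
        (aeval F (pderiv l p) * pderiv k (F l)) * F i +
          (if l = i then aeval F p * pderiv k (F i) else 0) := by
      intro l
      rw [Derivation.leibniz, pderiv_X]
      split_ifs with hk
      · subst hk
        rw [Pi.single_eq_same, map_add, smul_eq_mul, smul_eq_mul, map_mul, map_mul, aeval_X, map_one]
        ring
      · rw [Pi.single_eq_of_ne (fun h => hk h.symm), map_add, smul_eq_mul, smul_eq_mul, map_mul, map_mul,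
          aeval_X, map_zero]
        ring
    rw [Finset.sum_congr rfl fun k _ => h1 k, Finset.sum_add_distrib, ← Finset.sum_mul, ← hp,
      Finset.sum_ite_eq' Finset.univ i, if_pos (Finset.mem_univ i), map_mul, aeval_X,
      pderiv_mul]

theorem totalDegree_pderiv' {ι : Type} (i : ι) (p : MvPolynomial ι ℂ) {N : ℕ}
    (h : p.totalDegree ≤ N + 1) : (pderiv i p).totalDegree ≤ N := by
  classical
  refine Finset.sup_le ?_
  intro m hm
  rw [mem_support_iff, coeff_pderiv] at hm
  have h1 : (m + Finsupp.single i 1) ∈ p.support := by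
    rw [mem_support_iff]; intro h0; exact hm (by rw [h0]; simp)
  have h2 := le_totalDegree h1
  rw [Finsupp.sum_add_index' (by simp) (by simp)] at h2
  simp at h2
  first | omega | (have : m.degree = m.sum fun _ e => e := rfl; omega)

theorem eq_C_of_pderiv {ι : Type} (p : MvPolynomial ι ℂ) (h : ∀ i, pderiv i p = 0) :
    p = C (coeff 0 p) := by
  classical
  ext m
  rw [coeff_C]
  split_ifs with h0
  · rw [h0]
  · obtain ⟨i, hi⟩ : ∃ i, m i ≠ 0 := by
      by_contra hc; push Not at hc
      exact h0 (by ext i; simp [hc i])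
    have h1 := congrArg (coeff (m - Finsupp.single i 1)) (h i)
    rw [coeff_pderiv, tsub_add_cancel_of_le (by simpa [Finsupp.single_le_iff] using Nat.one_le_iff_ne_zero.2 hi)] at h1
    rw [coeff_zero] at h1
    rcases mul_eq_zero.1 h1 with h2 | h2
    · exact h2
    · exfalso
      norm_cast at h2

theorem aeval_inj_of_jac {ι : Type} [Fintype ι] [DecidableEq ι] (F : ι → MvPolynomial ι ℂ)
    (hdet : (Matrix.of fun i k => pderiv k (F i)).det ≠ 0) (N : ℕ) :
    ∀ p : MvPolynomial ι ℂ, p.totalDegree ≤ N → aeval F p = 0 → p = 0 := by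
  have hconst : ∀ p : MvPolynomial ι ℂ, p = C (coeff 0 p) → aeval F p = 0 → p = 0 := by
    intro p h1 h2
    rw [h1, aeval_C, algebraMap_eq] at h2
    rw [h1]; exact h2
  induction N with
  | zero =>
    intro p hp h
    exact hconst p (totalDegree_eq_zero_iff_eq_C.1 (by omega)) h
  | succ N ih =>
    intro p hp h
    refine hconst p (eq_C_of_pderiv p fun i => ?_) h
    refine ih _ (totalDegree_pderiv' i p hp) ?_
    have h1 : Matrix.vecMul (fun i => aeval F (pderiv i p)) (Matrix.of fun i k => pderiv k (F i)) = 0 := by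
      funext k
      have := pderiv_aeval' F k p
      rw [h, map_zero] at this
      simpa [Matrix.vecMul, dotProduct] using this.symm
    exact congrFun (Matrix.eq_zero_of_vecMul_eq_zero hdet h1) i

theorem hasDerivAt_poly {ι : Type} [Fintype ι] [DecidableEq ι] (P : MvPolynomial ι ℂ) (a b : ι → ℂ) :
    HasDerivAt (fun e : ℂ => eval (a + e • b) P) (∑ i, eval a (pderiv i P) * b i) 0 := by
  have h := (aeval (fun i => Polynomial.C (a i) + Polynomial.C (b i) * Polynomial.X) P).hasDerivAt 0
  have h1 : (fun e : ℂ => eval (a + e • b) P) = fun e =>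
      (aeval (fun i => Polynomial.C (a i) + Polynomial.C (b i) * Polynomial.X) P).eval e := by
    funext e
    rw [aeval_curve]
    congr 2
    funext i
    show a i + e * b i = _
    rw [Polynomial.eval_add, Polynomial.eval_mul, Polynomial.eval_C, Polynomial.eval_C, Polynomial.eval_X, mul_comm]
  rw [h1]
  refine h.congr_deriv ?_
  rw [derivative_aeval, Polynomial.eval_finsetSum]
  refine Finset.sum_congr rfl fun i _ => ?_
  rw [Polynomial.eval_mul, aeval_curve]
  simp

theorem zChain_of_jac {σ ι : Type} [Fintype σ] [DecidableEq σ] [Fintype ι] [DecidableEq ι]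
    {S : Set (σ → ℂ)} (Φ : (ι → ℂ) → (σ → ℂ)) (hΦ : ∀ s, PolyFn fun a => Φ a s)
    (D : (ι → ℂ) → ℂ) (hD : PolyFn D) (hD0 : ∃ a, D a ≠ 0) (hS : ∀ a, D a ≠ 0 → Φ a ∈ S)
    (a0 : ι → ℂ)
    (hinj : ∀ b : ι → ℂ, (∀ s, HasDerivAt (fun e : ℂ => Φ (a0 + e • b) s) 0 0) → b = 0) :
    zChain (zClosure S) (Fintype.card ι) := by
  choose P hP using hΦ
  let J : (ι → ℂ) →ₗ[ℂ] (σ → ℂ) :=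
    { toFun := fun b s => ∑ i, eval a0 (pderiv i (P s)) * b i
      map_add' := by intro b c; funext s; simp [mul_add, Finset.sum_add_distrib]
      map_smul' := by
        intro c b; funext s; simp only [Pi.smul_apply, smul_eq_mul, RingHom.id_apply, Finset.mul_sum]
        exact Finset.sum_congr rfl fun i _ => by ring }
  have hJ : LinearMap.ker J = ⊥ := by
    rw [LinearMap.ker_eq_bot']
    intro b hb
    refine hinj b fun s => ?_
    have h1 := hasDerivAt_poly (P s) a0 b
    have h2 : (∑ i, eval a0 (pderiv i (P s)) * b i) = 0 := congrFun hb s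
    rw [h2] at h1
    have h3 : (fun e : ℂ => Φ (a0 + e • b) s) = fun e : ℂ => eval (a0 + e • b) (P s) := by
      funext e; exact hP s _
    rw [h3]; exact h1
  obtain ⟨A, hA⟩ := J.exists_leftInverse_of_injective hJ
  have hAsum : ∀ (x : σ → ℂ) i, A x i = ∑ s, A (Pi.single s 1) i * x s := by
    intro x i
    conv_lhs => rw [← Finset.univ_sum_single x]
    rw [map_sum, Finset.sum_apply]
    refine Finset.sum_congr rfl fun s _ => ?_
    have : (Pi.single s (x s) : σ → ℂ) = x s • Pi.single s 1 := by
      rw [← Pi.single_smul, smul_eq_mul, mul_one]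
    rw [this, map_smul, Pi.smul_apply, smul_eq_mul, mul_comm]
  let F : ι → MvPolynomial ι ℂ := fun i => ∑ s, C (A (Pi.single s 1) i) * P s
  have hF : ∀ a i, eval a (F i) = A (Φ a) i := by
    intro a i
    rw [hAsum]
    simp only [F, map_sum, map_mul, eval_C, hP]
  refine zChain_of_dominant (fun x => A x) (fun i => ?_) ?_
  · refine PolyFn.ext_eq (PolyFn.sum Finset.univ (F := fun s x => A (Pi.single s 1) i * x s)
      fun s _ => (PolyFn.const _).mul (PolyFn.coord s)) fun x => hAsum x i
  · intro p hp
    refine aeval_inj_of_jac F ?_ _ p le_rfl ?_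
    · intro h0
      have h1 := congrArg (eval a0) h0
      rw [RingHom.map_det, map_zero] at h1
      have h2 : (eval a0).mapMatrix (Matrix.of fun i k => pderiv k (F i)) = 1 := by
        ext i k
        have h3 := congrFun (LinearMap.congr_fun hA (Pi.single k 1)) i
        simp only [LinearMap.comp_apply, LinearMap.id_apply] at h3
        rw [hAsum] at h3
        rw [RingHom.mapMatrix_apply, Matrix.map_apply, Matrix.of_apply, Matrix.one_apply]
        simp only [F, map_sum, pderiv_C_mul, map_mul, eval_C]
        have h4 : ∀ s, J (Pi.single k 1) s = eval a0 (pderiv k (P s)) := by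
          intro s
          show ∑ i, eval a0 (pderiv i (P s)) * (Pi.single k 1 : ι → ℂ) i = _
          simp [Pi.single_apply]
        simp only [h4] at h3
        rw [h3, Pi.single_apply]
      rw [h2, Matrix.det_one] at h1
      exact one_ne_zero h1
    · apply MvPolynomial.funext
      intro a
      rw [map_zero]
      refine PolyFn.cancel (f := fun a => eval a (aeval F p)) (PolyFn.eval_poly _) hD (fun a => ?_) hD0 a
      by_cases h : D a = 0
      · exact Or.inr h
      · left
        rw [eval_aeval']
        have := hp _ (hS a h)
        rw [← this]
        congr 2
        funext i; exact hF a i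

end

section
set_option linter.unusedSectionVars false

/-- weight factor -/
def wF (d l : ℕ) : ℂ := ((d - l).factorial : ℂ) * (l.factorial : ℂ)
theorem wF_ne (d l : ℕ) : wF d l ≠ 0 := by
  unfold wF; exact mul_ne_zero (by exact_mod_cast Nat.factorial_ne_zero _) (by exact_mod_cast Nat.factorial_ne_zero _)

def exN (d : ℕ) (y : Fin (d+1) → ℂ) (l : ℕ) : ℂ := if h : l < d + 1 then y ⟨l, h⟩ else 0

theorem alph_X_pow' (d : ℕ) (y : Fin (d+1) → ℂ) (l : ℕ) (h : l ≤ d) :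
    alph d y (Polynomial.X ^ l) = wF d l * exN d y l := by
  have := alph_X_pow d y ⟨l, by omega⟩
  simp only at this
  rw [this, exN, dif_pos (by omega)]; rfl

def solveV (d e n : ℕ) (q : ℕ → ℂ) (c : ℕ → ℂ) (l : ℕ) : ℂ :=
  if h : e ≤ l ∧ l ≤ e + n then
    -(∑ i : Fin e, q i * wF d (l - e + i) * solveV d e n q c (l - e + i)) * (wF d l)⁻¹
  else c l
termination_by l
decreasing_by have := i.2; omega

/-- free coordinates -/
abbrev FreeC (d e n : ℕ) : Type := {l : Fin (d+1) // (l:ℕ) < e ∨ e + n < (l:ℕ)}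

theorem card_FreeC (d e n : ℕ) (h : e + n ≤ d) : Fintype.card (FreeC d e n) = d - n := by
  have h1 := Fintype.card_subtype_compl (fun l : Fin (d+1) => e ≤ (l:ℕ) ∧ (l:ℕ) ≤ e + n)
  have h2 : Fintype.card {l : Fin (d+1) // e ≤ (l:ℕ) ∧ (l:ℕ) ≤ e + n} = n + 1 := by
    rw [← Fintype.card_fin (n+1)]
    symm
    refine Fintype.card_congr
      { toFun := fun i => ⟨⟨e + i, by have := i.2; omega⟩, by have := i.2; simp; omega⟩
        invFun := fun l => ⟨(l.1 : ℕ) - e, by have := l.2; omega⟩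
        left_inv := fun i => by ext; simp
        right_inv := fun l => by ext; have := l.2; simp; omega }
  rw [h2, Fintype.card_fin] at h1
  rw [Fintype.card_congr (Equiv.subtypeEquivRight (q := fun l : Fin (d+1) => ¬ (e ≤ (l:ℕ) ∧ (l:ℕ) ≤ e + n)) fun l => by omega), h1]
  omega

theorem alph_mul_X_pow {d e n : ℕ} (he : e + n ≤ d) (y : Fin (d+1) → ℂ) (Q : Polynomial ℂ)
    (hm : Q.Monic) (hd : Q.natDegree = e) (b : ℕ) (hb : b ≤ n) :
    alph d y (Q * Polynomial.X ^ b) =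
      ∑ i : Fin e, Q.coeff i * wF d (b + i) * exN d y (b + i) + wF d (b + e) * exN d y (b + e) := by
  conv_lhs => rw [Q.as_sum_range_C_mul_X_pow, hd, Finset.sum_range_succ, add_mul, map_add, Finset.sum_mul, map_sum]
  congr 1
  · rw [Finset.sum_range]
    refine Finset.sum_congr rfl fun i _ => ?_
    rw [mul_assoc, ← pow_add, ← Polynomial.smul_eq_C_mul, map_smul, alph_X_pow' _ _ _ (by have := i.2; omega),
      add_comm b, smul_eq_mul]
    ring
  · rw [← hd, hm.coeff_natDegree, hd, Polynomial.C_1, one_mul, ← pow_add, alph_X_pow' _ _ _ (by omega), add_comm b]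

theorem exists_solve {ι : Type} (d e n : ℕ) (he : e + n ≤ d) (Q : (ι → ℂ) → Polynomial ℂ)
    (hQ : PolyFnP Q) (hm : ∀ ρ, (Q ρ).Monic) (hd : ∀ ρ, (Q ρ).natDegree = e) :
    ∃ φ : (ι ⊕ FreeC d e n → ℂ) → (Fin (d+1) → ℂ), (∀ s, PolyFn fun a => φ a s) ∧
      (∀ a, ∀ b ≤ n, alph d (φ a) (Q (fun i => a (Sum.inl i)) * Polynomial.X ^ b) = 0) ∧
      (∀ a (l : FreeC d e n), φ a l.1 = a (Sum.inr l)) ∧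
      ∀ a y, (∀ b ≤ n, alph d y (Q (fun i => a (Sum.inl i)) * Polynomial.X ^ b) = 0) →
        (∀ l : FreeC d e n, y l.1 = a (Sum.inr l)) → y = φ a := by
  let c : (ι ⊕ FreeC d e n → ℂ) → ℕ → ℂ := fun a l =>
    if h : l < d + 1 then if h' : l < e ∨ e + n < l then a (Sum.inr ⟨⟨l, h⟩, h'⟩) else 0 else 0
  let ψ : (ι ⊕ FreeC d e n → ℂ) → ℕ → ℂ := fun a =>
    solveV d e n (fun i => (Q (fun i => a (Sum.inl i))).coeff i) (c a)
  have hc : ∀ l, PolyFn fun a => c a l := by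
    intro l
    simp only [c]
    split_ifs
    · exact PolyFn.coord _
    · exact PolyFn.const _
    · exact PolyFn.const _
  have hψ : ∀ l, PolyFn fun a => ψ a l := by
    intro l
    induction l using Nat.strong_induction_on with
    | _ l ih =>
      by_cases h : e ≤ l ∧ l ≤ e + n
      · have : ∀ a, ψ a l = -(∑ i : Fin e, (Q (fun i => a (Sum.inl i))).coeff i * wF d (l - e + i) *
            ψ a (l - e + i)) * (wF d l)⁻¹ := by
          intro a
          simp only [ψ]
          conv_lhs => rw [solveV, dif_pos h]
        refine PolyFn.ext_eq ?_ this
        refine PolyFn.mul (PolyFn.neg (PolyFn.sum _ fun i _ => PolyFn.mul (PolyFn.mul ?_ (PolyFn.const _)) (ih _ ?_))) (PolyFn.const _)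
        · exact (hQ i).comp fun k => PolyFn.coord _
        · have := i.2; omega
      · refine PolyFn.ext_eq (hc l) fun a => ?_
        simp only [ψ]
        rw [solveV, dif_neg h]
  have hex : ∀ a l, l ≤ d → exN d (fun i => ψ a i) l = ψ a l := by
    intro a l hl
    rw [exN, dif_pos (by omega)]
  refine ⟨fun a l => ψ a l, fun s => hψ s, ?_, ?_, ?_⟩
  · intro a b hb
    rw [alph_mul_X_pow he _ _ (hm _) (hd _) b hb, hex a _ (by omega)]
    have h1 : ψ a (b + e) = -(∑ i : Fin e, (Q (fun i => a (Sum.inl i))).coeff i * wF d (b + i) *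
            ψ a (b + i)) * (wF d (b + e))⁻¹ := by
      simp only [ψ]
      conv_lhs => rw [solveV, dif_pos (by omega), Nat.add_sub_cancel]
    rw [h1, mul_comm (wF d (b+e)), mul_assoc, inv_mul_cancel₀ (wF_ne _ _), mul_one, add_neg_eq_zero]
    refine Finset.sum_congr rfl fun i _ => ?_
    rw [hex a _ (by have := i.2; omega)]
  · intro a l
    simp only [ψ]
    rw [solveV, dif_neg (by have := l.2; omega)]
    simp only [c]
    rw [dif_pos l.1.2, dif_pos l.2]
  · intro a y h1 h2
    have key : ∀ l, l ≤ d → exN d y l = ψ a l := by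
      intro l
      induction l using Nat.strong_induction_on with
      | _ l ih =>
        intro hl
        by_cases h : e ≤ l ∧ l ≤ e + n
        · have h3 := h1 (l - e) (by omega)
          rw [alph_mul_X_pow he _ _ (hm _) (hd _) _ (by omega), Nat.sub_add_cancel h.1] at h3
          have h4 : ψ a l = -(∑ i : Fin e, (Q (fun i => a (Sum.inl i))).coeff i * wF d (l - e + i) *
              ψ a (l - e + i)) * (wF d l)⁻¹ := by
            simp only [ψ]
            conv_lhs => rw [solveV, dif_pos h]
          rw [h4, eq_mul_inv_iff_mul_eq₀ (wF_ne _ _), mul_comm, eq_comm, neg_eq_iff_add_eq_zero, ← h3]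
          congr 1
          refine Finset.sum_congr rfl fun i _ => ?_
          rw [ih _ (by have := i.2; omega) (by have := i.2; omega)]
        · have h5 := h2 ⟨⟨l, by omega⟩, by simp only; omega⟩
          rw [exN, dif_pos (by omega), h5]
          simp only [ψ]
          rw [solveV, dif_neg h]
          simp only [c]
          rw [dif_pos (by omega), dif_pos (by omega)]
    funext l
    have := key l (by have := l.2; omega)
    rw [exN, dif_pos l.2] at this
    exact this

end

section
set_option linter.unusedSectionVars false

def ofFun (d : ℕ) (A : Polynomial ℂ →ₗ[ℂ] ℂ) : Fin (d+1) → ℂ := fun l => A (Polynomial.X ^ (l:ℕ)) * (wF d l)⁻¹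

theorem alph_ofFun (d : ℕ) (A : Polynomial ℂ →ₗ[ℂ] ℂ) (p : Polynomial ℂ) (hp : p.natDegree ≤ d) :
    alph d (ofFun d A) p = A p := by
  rw [p.as_sum_range' (d+1) (by omega), map_sum, map_sum]
  refine Finset.sum_congr rfl fun i hi => ?_
  rw [Finset.mem_range] at hi
  rw [← Polynomial.C_mul_X_pow_eq_monomial, ← Polynomial.smul_eq_C_mul, map_smul, map_smul,
    alph_X_pow' _ _ _ (by omega), exN, dif_pos hi, ofFun]
  congr 1
  field_simp [wF_ne d i]

/-- `Q / ℓ_i` -/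
def Rdiv {n : ℕ} (mu : Fin n → ℕ) (v : Fin n → ℂ) (i : Fin n) : Polynomial ℂ :=
  lin (-v i) 1 ^ (mu i - 1) * ∏ l ∈ Finset.univ.erase i, lin (-v l) 1 ^ mu l

theorem Rdiv_mul {n : ℕ} {mu : Fin n → ℕ} (hmu : ∀ i, 1 ≤ mu i) (v : Fin n → ℂ) (i : Fin n) :
    Rdiv mu v i * lin (-v i) 1 = xP mu (fun i => - v i) (fun _ => 1) := by
  unfold Rdiv xP
  rw [← Finset.mul_prod_erase _ (fun l => lin (-v l) 1 ^ mu l) (Finset.mem_univ i)]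
  have : lin (-v i) 1 ^ mu i = lin (-v i) 1 ^ (mu i - 1) * lin (-v i) 1 := by
    rw [← pow_succ]; congr 1; have := hmu i; omega
  rw [this]; ring

theorem taylor_lin (v : ℂ) : Polynomial.taylor v (lin (-v) 1) = Polynomial.X := by
  simp [lin]

theorem taylor_coeff_vanish (v : ℂ) (k : ℕ) (hk : 1 ≤ k) (p : Polynomial ℂ) :
    (Polynomial.taylor v (lin (-v) 1 ^ k * p)).coeff (k - 1) = 0 := by
  rw [Polynomial.taylor_mul, Polynomial.taylor_pow, taylor_lin, Polynomial.coeff_X_pow_mul', if_neg (by omega)]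

theorem exists_alpha0 {n : ℕ} {mu : Fin n → ℕ} (hmu : ∀ i, 1 ≤ mu i) {v : Fin n → ℂ}
    (hv : Function.Injective v) :
    ∃ A : Polynomial ℂ →ₗ[ℂ] ℂ, (∀ p, A (xP mu (fun i => - v i) (fun _ => 1) * p) = 0) ∧
      ∃ β : Fin n → ℂ, (∀ i, β i ≠ 0) ∧ ∀ i h, A (Rdiv mu v i * h) = β i * h.eval (v i) := by
  let A : Polynomial ℂ →ₗ[ℂ] ℂ := ∑ i, (Polynomial.lcoeff ℂ (mu i - 1)).comp (Polynomial.taylor (v i))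
  have hA : ∀ p, A p = ∑ i, (Polynomial.taylor (v i) p).coeff (mu i - 1) := by
    intro p; simp [A, LinearMap.sum_apply]
  refine ⟨A, ?_, fun i => ∏ l ∈ Finset.univ.erase i, (v i - v l) ^ mu l, ?_, ?_⟩
  · intro p
    rw [hA]
    refine Finset.sum_eq_zero fun i _ => ?_
    unfold xP
    rw [← Finset.mul_prod_erase _ (fun l => lin (-v l) 1 ^ mu l) (Finset.mem_univ i), mul_assoc]
    exact taylor_coeff_vanish _ _ (hmu i) _
  · intro i
    refine Finset.prod_ne_zero_iff.2 fun l hl => pow_ne_zero _ (sub_ne_zero.2 fun h => ?_)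
    exact (Finset.mem_erase.1 hl).1 (hv h).symm
  · intro i h
    rw [hA, Finset.sum_eq_single i]
    · unfold Rdiv
      rw [mul_assoc, Polynomial.taylor_mul, Polynomial.taylor_pow, taylor_lin, Polynomial.coeff_X_pow_mul', if_pos le_rfl,
        Nat.sub_self, Polynomial.taylor_coeff_zero, Polynomial.eval_mul, Polynomial.eval_prod]
      congr 1
      refine Finset.prod_congr rfl fun l _ => ?_
      rw [Polynomial.eval_pow, eval_lin]; ring
    · intro l _ hl
      unfold Rdiv
      rw [← Finset.mul_prod_erase _ (fun l => lin (-v l) 1 ^ mu l) (Finset.mem_erase.2 ⟨hl, Finset.mem_univ l⟩)]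
      have : lin (-v i) 1 ^ (mu i - 1) * (lin (-v l) 1 ^ mu l * ∏ x ∈ (Finset.univ.erase i).erase l, lin (-v x) 1 ^ mu x) * h
         = lin (-v l) 1 ^ mu l * (lin (-v i) 1 ^ (mu i - 1) * (∏ x ∈ (Finset.univ.erase i).erase l, lin (-v x) 1 ^ mu x) * h) := by ring
      rw [this]
      exact taylor_coeff_vanish _ _ (hmu l) _
    · simp

end

section
set_option linter.unusedSectionVars false

/-- coefficientwise derivative at 0 -/
def HasDerivP (f : ℂ → Polynomial ℂ) (f' : Polynomial ℂ) : Prop :=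
  ∀ k, HasDerivAt (fun e => (f e).coeff k) (f'.coeff k) 0

namespace HasDerivP
theorem const (p : Polynomial ℂ) : HasDerivP (fun _ => p) 0 := fun k => by
  simpa using hasDerivAt_const (0:ℂ) (p.coeff k)

theorem mul {f g : ℂ → Polynomial ℂ} {f' g' : Polynomial ℂ} (hf : HasDerivP f f') (hg : HasDerivP g g') :
    HasDerivP (fun e => f e * g e) (f' * g 0 + f 0 * g') := by
  intro k
  simp only [Polynomial.coeff_mul, Polynomial.coeff_add]
  rw [← Finset.sum_add_distrib]
  exact HasDerivAt.fun_sum fun x _ => (hf x.1).mul (hg x.2)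

theorem add {f g : ℂ → Polynomial ℂ} {f' g' : Polynomial ℂ} (hf : HasDerivP f f') (hg : HasDerivP g g') :
    HasDerivP (fun e => f e + g e) (f' + g') := by
  intro k
  simp only [Polynomial.coeff_add]
  exact (hf k).add (hg k)

theorem pow {f : ℂ → Polynomial ℂ} {f' : Polynomial ℂ} (hf : HasDerivP f f') (n : ℕ) :
    HasDerivP (fun e => f e ^ n) ((n : Polynomial ℂ) * f 0 ^ (n - 1) * f') := by
  induction n with
  | zero => simpa using const 1
  | succ n ih =>
    have := ih.mul hf
    simp only [← pow_succ] at this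
    convert this using 1
    rcases n with _ | n
    · simp
    · simp only [Nat.add_sub_cancel]; push_cast; ring

theorem prod {α : Type*} [DecidableEq α] (s : Finset α) {f : α → ℂ → Polynomial ℂ} {f' : α → Polynomial ℂ}
    (hf : ∀ i ∈ s, HasDerivP (f i) (f' i)) :
    HasDerivP (fun e => ∏ i ∈ s, f i e) (∑ i ∈ s, (∏ l ∈ s.erase i, f l 0) * f' i) := by
  induction s using Finset.induction_on with
  | empty => simpa using const 1
  | insert a s ha ih =>
    have := (hf a (Finset.mem_insert_self _ _)).mul (ih fun i hi => hf i (Finset.mem_insert_of_mem hi))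
    simp only [Finset.prod_insert ha]
    convert this using 1
    rw [Finset.sum_insert ha, Finset.erase_insert ha, mul_comm, Finset.mul_sum]
    congr 1
    refine Finset.sum_congr rfl fun i hi => ?_
    have hai : a ≠ i := fun h => ha (h ▸ hi)
    rw [Finset.erase_insert_of_ne hai, Finset.prod_insert (fun h => ha (Finset.mem_of_mem_erase h)), mul_assoc]

theorem lin {a b : ℂ} (c : ℂ) : HasDerivP (fun e => lin (a + e * b) c) (Polynomial.C b) := by
  intro k
  simp only [_root_.lin, Polynomial.coeff_add, Polynomial.coeff_C]
  split_ifs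
  · have h := ((hasDerivAt_id (0:ℂ)).mul_const b).const_add a |>.add_const ((Polynomial.C c * Polynomial.X).coeff k)
    simpa using h
  · simpa using hasDerivAt_const (0:ℂ) _

/-- derivative of the product of powers of linear factors -/
theorem xP {n : ℕ} (mu : Fin n → ℕ) (v w : Fin n → ℂ) :
    HasDerivP (fun e => xP mu (fun i => -(v i + e * w i)) (fun _ => 1))
      (∑ i, Polynomial.C (-w i * mu i) * Rdiv mu v i) := by
  have h := prod Finset.univ (f := fun i e => _root_.lin (-v i + e * (-w i)) 1 ^ mu i)
    (fun i _ => (lin (a := -v i) (b := -w i) 1).pow (mu i))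
  unfold _root_.xP
  convert h using 1
  · funext e
    refine Finset.prod_congr rfl fun i _ => ?_
    congr 2; ring
  · refine Finset.sum_congr rfl fun i _ => ?_
    unfold Rdiv
    simp only [zero_mul, add_zero, Polynomial.C_mul, map_natCast]
    ring
end HasDerivP

/-- explicit formula for alph -/
theorem alph_eq_sum (d : ℕ) (y : Fin (d+1) → ℂ) (p : Polynomial ℂ) (hp : p.natDegree ≤ d) :
    alph d y p = ∑ l : Fin (d+1), p.coeff l * (wF d l * y l) := by
  conv_lhs => rw [p.as_sum_range_C_mul_X_pow' (show p.natDegree < d + 1 by omega)]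
  rw [map_sum, Finset.sum_range]
  refine Finset.sum_congr rfl fun i _ => ?_
  rw [← Polynomial.smul_eq_C_mul, map_smul, alph_X_pow' _ _ _ (by have := i.2; omega), exN, dif_pos i.2, smul_eq_mul]

/-- differentiating `alph y(e) p(e) = 0` -/
theorem alph_deriv (d : ℕ) {y : ℂ → Fin (d+1) → ℂ} {p : ℂ → Polynomial ℂ} {p' : Polynomial ℂ}
    (hy : ∀ l, HasDerivAt (fun e => y e l) 0 0) (hp : HasDerivP p p') (hd : ∀ e, (p e).natDegree ≤ d)
    (hd' : p'.natDegree ≤ d) (h : ∀ e, alph d (y e) (p e) = 0) : alph d (y 0) p' = 0 := by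
  have h1 : HasDerivAt (fun e => ∑ l : Fin (d+1), (p e).coeff l * (wF d l * y e l))
      (∑ l : Fin (d+1), (p'.coeff l * (wF d l * y 0 l) + (p 0).coeff l * (wF d l * 0))) 0 :=
    HasDerivAt.fun_sum fun l _ => (hp l).mul ((hy l).const_mul _)
  have h2 : (fun e => ∑ l : Fin (d+1), (p e).coeff l * (wF d l * y e l)) = fun _ => 0 := by
    funext e; rw [← alph_eq_sum _ _ _ (hd e), h]
  rw [h2] at h1
  have h3 := h1.unique (hasDerivAt_const _ _)
  rw [alph_eq_sum _ _ _ hd']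
  refine Eq.trans ?_ h3
  simp

theorem PolyFn.mul_ne {ι : Type} {f g : (ι → ℂ) → ℂ} (hf : PolyFn f) (hg : PolyFn g)
    (h1 : ∃ a, f a ≠ 0) (h2 : ∃ a, g a ≠ 0) : ∃ a, f a * g a ≠ 0 := by
  by_contra hc
  push Not at hc
  obtain ⟨a, ha⟩ := h1
  exact ha (PolyFn.cancel hf hg (fun a => mul_eq_zero.1 (hc a)) h2 a)

theorem exists_minor {k N : ℕ} (M : Matrix (Fin k) (Fin N) ℂ)
    (h : ∀ c : Fin k → ℂ, Matrix.vecMul c M = 0 → c = 0) :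
    ∃ s : Fin k → Fin N, (M.submatrix id s).det ≠ 0 := by
  have hspan : Submodule.span ℂ (Set.range fun i => M.transpose i) = ⊤ := by
    by_contra hne
    obtain ⟨f, hf0, hf⟩ := Submodule.exists_le_ker_of_lt_top _ (lt_top_iff_ne_top.2 hne)
    apply hf0
    have hc := h (fun i => f (Pi.single i 1)) (by
      funext b
      have h1 : M.transpose b ∈ LinearMap.ker f := hf (Submodule.subset_span ⟨b, rfl⟩)
      rw [LinearMap.mem_ker] at h1
      rw [LinearMap.pi_apply_eq_sum_univ f (M.transpose b)] at h1
      simp only [Matrix.vecMul, dotProduct, Pi.zero_apply]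
      rw [← h1]
      refine Finset.sum_congr rfl fun i _ => ?_
      rw [smul_eq_mul, mul_comm, Matrix.transpose_apply]
      congr 2
      funext l; simp [Pi.single_apply, eq_comm])
    refine LinearMap.ext fun x => ?_
    rw [LinearMap.pi_apply_eq_sum_univ f x]
    simp only [LinearMap.zero_apply]
    refine Finset.sum_eq_zero fun i _ => ?_
    have := congrFun hc i
    simp only [Pi.zero_apply] at this
    have h2 : (fun j => if i = j then (1:ℂ) else 0) = Pi.single i 1 := by
      funext l; simp [Pi.single_apply, eq_comm]
    rw [h2, this, smul_zero]
  obtain ⟨κ, a, ha, hs, hli⟩ := exists_linearIndependent' ℂ (fun i => M.transpose i)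
  rw [hspan] at hs
  have : Finite κ := Finite.of_injective a ha
  have : Fintype κ := Fintype.ofFinite κ
  let b := Module.Basis.mk hli hs.ge
  have hcard : Fintype.card κ = k := by
    have := Module.finrank_eq_card_basis b
    rw [Module.finrank_fin_fun] at this
    exact this.symm
  let e : Fin k ≃ κ := (Fintype.equivFinOfCardEq hcard).symm
  refine ⟨fun i => a (e i), ?_⟩
  have hli2 : LinearIndependent ℂ (fun i => (M.submatrix id (fun i => a (e i))).transpose i) := by
    have := hli.comp e e.injective
    exact this
  have h3 := Matrix.linearIndependent_rows_iff_isUnit (A := (M.submatrix id (fun i => a (e i))).transpose) |>.1 hli2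
  rw [Matrix.isUnit_iff_isUnit_det, Matrix.det_transpose] at h3
  exact h3.ne_zero

theorem exists_rows {k N : ℕ} (L : Submodule ℂ (Fin N → ℂ)) (h : Module.finrank ℂ L = k) :
    ∃ M : Matrix (Fin k) (Fin N) ℂ, rowSpan M = L := by
  let b := Module.finBasisOfFinrankEq ℂ L h
  refine ⟨fun i => (b i : Fin N → ℂ), ?_⟩
  unfold rowSpan
  have h1 := congrArg (Submodule.map L.subtype) b.span_eq
  rw [Submodule.map_span, Submodule.map_top, Submodule.range_subtype, ← Set.range_comp] at h1
  exact h1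

end

section
set_option linter.unusedSectionVars false

def muI {n : ℕ} (lam : Fin n → ℕ) (I : Finset (Fin n)) (i : Fin n) : ℕ := if i ∈ I then lam i else lam i - 1

theorem xP_mu_eq {n : ℕ} {lam : Fin n → ℕ} (h : ∀ i, 1 ≤ lam i) (I : Finset (Fin n)) (u v : Fin n → ℂ) :
    xP (muI lam I) u v = qP lam u v * ∏ i ∈ I, lin (u i) (v i) := by
  unfold qP xP
  have : ∏ i ∈ I, lin (u i) (v i) = ∏ i, if i ∈ I then lin (u i) (v i) else 1 := by
    rw [Finset.prod_ite_mem, Finset.univ_inter]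
  rw [this, ← Finset.prod_mul_distrib]
  refine Finset.prod_congr rfl fun i _ => ?_
  unfold muI
  have := h i
  split_ifs
  · rw [← pow_succ]; congr 1; show lam i = lam i - 1 + 1; omega
  · rw [mul_one]

theorem xP_lam_eq {n : ℕ} {lam : Fin n → ℕ} (h : ∀ i, 1 ≤ lam i) (I : Finset (Fin n)) (u v : Fin n → ℂ) :
    xP lam u v = xP (muI lam I) u v * ∏ i ∈ Iᶜ, lin (u i) (v i) := by
  rw [xP_mu_eq h, xP_eq_q_mul h, mul_assoc, Finset.prod_mul_prod_compl]

theorem sum_muI {r n : ℕ} {lam : Fin n → ℕ} (h : isPartitionOf r n lam) (I : Finset (Fin n)) :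
    ∑ i, muI lam I i + Iᶜ.card = r := by
  have h1 : Iᶜ.card = ∑ i, if i ∈ I then 0 else 1 := by
    rw [Finset.sum_ite, Finset.sum_const_zero, zero_add, Finset.card_eq_sum_ones]
    refine Finset.sum_congr ?_ fun _ _ => rfl
    ext; simp
  rw [h1, ← Finset.sum_add_distrib, ← h.2]
  refine Finset.sum_congr rfl fun i _ => ?_
  unfold muI
  have := h.1 i
  split_ifs <;> omega

theorem natDegree_prod_lin {n : ℕ} (I : Finset (Fin n)) (u v : Fin n → ℂ) :
    (∏ i ∈ I, lin (u i) (v i)).natDegree ≤ I.card := by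
  refine (Polynomial.natDegree_prod_le _ _).trans ?_
  refine (Finset.sum_le_card_nsmul _ _ 1 fun l _ => natDegree_lin _ _).trans ?_
  simp

theorem lin_monic (v : ℂ) : (lin v 1).Monic := by
  have : lin v 1 = Polynomial.X + Polynomial.C v := by simp [lin, add_comm]
  rw [this]; exact Polynomial.monic_X_add_C v

theorem natDegree_lin_one (v : ℂ) : (lin v 1).natDegree = 1 := by
  have : lin v 1 = Polynomial.X + Polynomial.C v := by simp [lin, add_comm]
  rw [this]; exact Polynomial.natDegree_X_add_C v

theorem xP_monic {n : ℕ} (mu : Fin n → ℕ) (u : Fin n → ℂ) : (xP mu u (fun _ => 1)).Monic :=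
  Polynomial.monic_prod_of_monic _ _ fun i _ => (lin_monic _).pow _

theorem natDegree_xP_one {n : ℕ} (mu : Fin n → ℕ) (u : Fin n → ℂ) :
    (xP mu u (fun _ => 1)).natDegree = ∑ i, mu i := by
  unfold xP
  rw [Polynomial.natDegree_prod_of_monic _ _ fun i _ => (lin_monic _).pow _]
  refine Finset.sum_congr rfl fun i _ => ?_
  rw [(lin_monic _).natDegree_pow, natDegree_lin_one, mul_one]

theorem vec_ne_zero {N : ℕ} {p : Polynomial ℂ} (hp : p ≠ 0) (hd : p.natDegree ≤ N) : vec N p ≠ 0 := by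
  intro h
  exact hp (vec_inj hd (by simp) (by rw [h, map_zero]))

theorem mem_smooth {r n j k : ℕ} {lam : Fin n → ℕ} (h : isPartitionOf r n lam) (hn : 0 < n)
    (M : Matrix (Fin k) (Fin (r+1)) ℂ) (hM : Module.finrank ℂ (rowSpan M) = k)
    {t : ℂ} {u v : Fin n → ℂ} (hx : vec r (Polynomial.C t * xP lam u v) ≠ 0)
    (hd : Module.finrank ℂ (tanSub (crlCone r n lam) (vec r (Polynomial.C t * xP lam u v))) ≤ n + 1)
    (hxM : vec r (Polynomial.C t * xP lam u v) ∈ rowSpan M)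
    (hInt : j + 1 ≤ Module.finrank ℂ ↥(rowSpan M ⊓ qSub r n (qP lam u v))) :
    plucker M ∈ smoothCHCone r (crlCone r n lam) (n+1) k j := by
  have h1 := tan_eq_qSub h hn hx hd
  have hq : qP lam u v ≠ 0 := by
    intro h0
    apply hx
    rw [xP_eq_q_mul h.1, h0, zero_mul, mul_zero, map_zero]
  have hnr : r - n + n ≤ r := by
    have := sum_pred h; omega
  refine ⟨M, rfl, hM, _, hx, vec_mem_crl h _ _ _, ?_, hxM, ?_⟩
  · unfold zTangentDim
    rw [span_tan, h1, finrank_qSub hq (natDegree_qP h u v) hnr]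
  · rw [span_tan, h1]; exact hInt

theorem exists_smooth' {r n : ℕ} {lam : Fin n → ℕ} (h : isPartitionOf r n lam) :
    ∃ t : ℂ, t ≠ 0 ∧ ∃ D : (Fin n → ℂ) → ℂ, PolyFn D ∧ (∃ a, D a ≠ 0) ∧ ∀ a, D a ≠ 0 →
      Module.finrank ℂ (tanSub (crlCone r n lam)
        (vec r (Polynomial.C t * xP lam (fun i => - a i) (fun _ => 1)))) ≤ n + 1 := by
  obtain ⟨D, hD, hD0, hD1⟩ := exists_smooth h
  obtain ⟨a, ha⟩ := hD.mul_ne (PolyFn.coord none) hD0 ⟨fun _ => 1, one_ne_zero⟩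
  refine ⟨a none, right_ne_zero_of_mul ha, fun b => D (fun o => o.elim (a none) b), ?_, ⟨fun i => a (some i), ?_⟩, ?_⟩
  · refine hD.comp fun o => ?_
    cases o with
    | none => exact PolyFn.const _
    | some i => exact PolyFn.coord i
  · have : (fun o : Option (Fin n) => o.elim (a none) fun i => a (some i)) = a := by
      funext o; cases o <;> rfl
    simp only [this]
    exact left_ne_zero_of_mul ha
  · intro b hb
    have h2 := hD1 (fun o => o.elim (a none) b) hb
    simp only [Option.elim_none, Option.elim_some] at h2
    exact h2

/-- catalecticant matrix -/
def Hank (r m : ℕ) (a : Fin (r+m+1) → ℂ) : Matrix (Fin (m+1)) (Fin (r+1)) ℂ :=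
  Matrix.of fun p l => alph (r+m) a (Polynomial.X ^ (p:ℕ) * Polynomial.X ^ (l:ℕ))

theorem Hank_mulVec (r m : ℕ) (a : Fin (r+m+1) → ℂ) (b : Fin (r+1) → ℂ) (p : Fin (m+1)) :
    (Hank r m a).mulVec b p = alph (r+m) a (Polynomial.X ^ (p:ℕ) * toP r b) := by
  simp only [Matrix.mulVec, dotProduct, Hank, Matrix.of_apply, toP, LinearMap.coe_mk, AddHom.coe_mk, Finset.mul_sum, map_sum]
  refine Finset.sum_congr rfl fun l _ => ?_
  rw [← Polynomial.C_mul_X_pow_eq_monomial, mul_left_comm, ← Polynomial.smul_eq_C_mul, map_smul, smul_eq_mul, mul_comm]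

theorem apolarSub_eq_ker (r m : ℕ) (a : Fin (r+m+1) → ℂ) :
    apolarSub r m a = LinearMap.ker (Hank r m a).mulVecLin := by
  ext b
  rw [LinearMap.mem_ker]
  have h0 : b ∈ apolarSub r m a ↔ b ∈ apolarSet (r+m) r a := Iff.rfl
  rw [h0, mem_apolarSet, Matrix.mulVecLin_apply]
  constructor
  · intro h; funext p; rw [Hank_mulVec, h p (by have := p.2; omega)]; rfl
  · intro h c hc
    have := congrFun h ⟨c, by omega⟩
    rw [Hank_mulVec] at this
    exact this

theorem finrank_ker_of_minor {m N : ℕ} (H : Matrix (Fin m) (Fin N) ℂ) (s : Fin m → Fin N)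
    (hs : (H.submatrix id s).det ≠ 0) : Module.finrank ℂ (LinearMap.ker H.mulVecLin) + m = N := by
  have hsurj : LinearMap.range H.mulVecLin = ⊤ := by
    rw [LinearMap.range_eq_top]
    intro y
    refine ⟨∑ i, ((H.submatrix id s)⁻¹.mulVec y) i • Pi.single (s i) 1, ?_⟩
    rw [map_sum]
    have h1 : (H.submatrix id s).mulVec ((H.submatrix id s)⁻¹.mulVec y) = y := by
      rw [Matrix.mulVec_mulVec, Matrix.mul_nonsing_inv _ (isUnit_iff_ne_zero.2 hs), Matrix.one_mulVec]
    conv_rhs => rw [← h1]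
    funext p
    rw [Finset.sum_apply]
    simp only [map_smul, Pi.smul_apply, Matrix.mulVecLin_apply, Matrix.mulVec_single_one, smul_eq_mul]
    conv_rhs => rw [Matrix.mulVec, dotProduct]
    refine Finset.sum_congr rfl fun i _ => ?_
    rw [mul_comm]; rfl
  have := LinearMap.finrank_range_add_finrank_ker H.mulVecLin
  rw [hsurj, finrank_top, Module.finrank_fin_fun, Module.finrank_fin_fun] at this
  omega

/-- The base functional is nondegenerate -/
theorem Hank_nondeg {n m r : ℕ} (hmn : m ≤ n) {mu : Fin n → ℕ} (hmu : ∀ i, 1 ≤ mu i)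
    (hr : ∑ i, mu i ≤ r) (hsum : n + 1 ≤ ∑ i, mu i) {v : Fin n → ℂ} (hv : Function.Injective v)
    (A : Polynomial ℂ →ₗ[ℂ] ℂ) {β : Fin n → ℂ} (hβ : ∀ i, β i ≠ 0)
    (hA : ∀ i h, A (Rdiv mu v i * h) = β i * h.eval (v i)) (c : Polynomial ℂ) (hc : c.natDegree ≤ m)
    (h : ∀ b : Polynomial ℂ, b.natDegree ≤ r → A (c * b) = 0) : c = 0 := by
  have hRd : ∀ i, (Rdiv mu v i).natDegree ≤ r := by
    intro i
    have h1 := congrArg Polynomial.natDegree (Rdiv_mul hmu v i)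
    have h2 := natDegree_xP_one mu (fun i => - v i)
    by_cases h0 : Rdiv mu v i = 0
    · rw [h0]; simp
    rw [Polynomial.natDegree_mul h0 (lin_monic _).ne_zero, h2] at h1
    omega
  have hroot : ∀ i, c.eval (v i) = 0 := by
    intro i
    have h1 := h (Rdiv mu v i) (hRd i)
    rw [mul_comm, hA] at h1
    exact (mul_eq_zero.1 h1).resolve_left (hβ i)
  by_contra hc0
  have hdvd : (∏ i, lin (-v i) 1) ∣ c := by
    refine Finset.prod_dvd_of_coprime ?_ fun i _ => ?_
    · intro i _ l _ hil
      have : ∀ x, lin (-x) 1 = Polynomial.X - Polynomial.C x := by intro x; simp [lin]; ring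
      simp only [Function.onFun, this]
      exact Polynomial.isCoprime_X_sub_C_of_isUnit_sub (isUnit_iff_ne_zero.2 (sub_ne_zero.2 fun h => hil (hv h)))
    · have : lin (-v i) 1 = Polynomial.X - Polynomial.C (v i) := by simp [lin]; ring
      rw [this, Polynomial.dvd_iff_isRoot]; exact hroot i
  obtain ⟨g, rfl⟩ := hdvd
  obtain ⟨i, hi⟩ : ∃ i, 2 ≤ mu i := by
    by_contra hcon
    push Not at hcon
    have : ∑ i, mu i ≤ ∑ _i : Fin n, 1 := Finset.sum_le_sum fun i _ => by have := hcon i; omega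
    simp at this; omega
  -- b = Q / ℓ_i^2
  let b := lin (-v i) 1 ^ (mu i - 2) * ∏ l ∈ Finset.univ.erase i, lin (-v l) 1 ^ mu l
  have hb : b * lin (-v i) 1 = Rdiv mu v i := by
    simp only [b, Rdiv]
    have : lin (-v i) 1 ^ (mu i - 1) = lin (-v i) 1 ^ (mu i - 2) * lin (-v i) 1 := by
      rw [← pow_succ]; congr 1; omega
    rw [this]; ring
  have hg0 : g ≠ 0 := right_ne_zero_of_mul hc0
  have hmon : (∏ i, lin (-v i) 1).Monic := Polynomial.monic_prod_of_monic _ _ fun i _ => lin_monic _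
  have hdegp : (∏ i, lin (-v i) 1).natDegree = n := by
    rw [Polynomial.natDegree_prod_of_monic _ _ fun i _ => lin_monic _]
    simp [natDegree_lin_one]
  have hg : g.natDegree = 0 := by
    rw [hmon.natDegree_mul' hg0, hdegp] at hc
    omega
  rw [Polynomial.eq_C_of_natDegree_eq_zero hg] at h hg0
  have hbd : b.natDegree ≤ r := by
    refine le_trans ?_ (hRd i)
    rw [← hb]
    by_cases hb0 : b = 0
    · rw [hb0]; simp
    · rw [Polynomial.natDegree_mul hb0 (lin_monic _).ne_zero]; omega
  have h2 := h b hbd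
  have h3 : (∏ i, lin (-v i) 1) * Polynomial.C (g.coeff 0) * b = Rdiv mu v i *
      (Polynomial.C (g.coeff 0) * ∏ l ∈ Finset.univ.erase i, lin (-v l) 1) := by
    rw [← hb, ← Finset.mul_prod_erase _ (fun l => lin (-v l) 1) (Finset.mem_univ i)]
    ring
  rw [h3, hA, Polynomial.eval_mul, Polynomial.eval_C, Polynomial.eval_prod] at h2
  refine absurd h2 (mul_ne_zero (hβ i) (mul_ne_zero (fun h => hg0 (by rw [h]; simp)) ?_))
  refine Finset.prod_ne_zero_iff.2 fun l hl => ?_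
  rw [eval_lin]
  intro h0
  have : v i = v l := by linear_combination h0
  exact (Finset.mem_erase.1 hl).1 (hv this).symm

theorem Hank_minor {r m : ℕ} (a : Fin (r+m+1) → ℂ)
    (h : ∀ c : Polynomial ℂ, c.natDegree ≤ m →
      (∀ b : Polynomial ℂ, b.natDegree ≤ r → alph (r+m) a (c * b) = 0) → c = 0) :
    ∃ s : Fin (m+1) → Fin (r+1), ((Hank r m a).submatrix id s).det ≠ 0 := by
  refine exists_minor _ fun c hc => ?_
  have h1 := h (toP m c) (natDegree_toP m c) (fun b hb => by
    rw [b.as_sum_range_C_mul_X_pow' (show b.natDegree < r + 1 by omega), Finset.mul_sum, map_sum]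
    refine Finset.sum_eq_zero fun l hl => ?_
    have h2 := congrFun hc ⟨l, Finset.mem_range.1 hl⟩
    simp only [Matrix.vecMul, dotProduct, Hank, Matrix.of_apply, Pi.zero_apply] at h2
    rw [mul_left_comm, ← Polynomial.smul_eq_C_mul, map_smul]
    convert smul_zero _
    rw [← h2]
    simp only [toP, LinearMap.coe_mk, AddHom.coe_mk, Finset.sum_mul, map_sum]
    refine Finset.sum_congr rfl fun p _ => ?_
    rw [← Polynomial.C_mul_X_pow_eq_monomial, mul_assoc, ← Polynomial.smul_eq_C_mul, map_smul, smul_eq_mul])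
  exact toP_injective m (by rw [h1, map_zero])

end

section
set_option linter.unusedSectionVars false

theorem eval_erase_ne {n : ℕ} {v : Fin n → ℂ} (hv : Function.Injective v) (i : Fin n) (s : Finset (Fin n)) (hs : i ∉ s) :
    (∏ l ∈ s, lin (-v l) 1).eval (v i) ≠ 0 := by
  rw [Polynomial.eval_prod]
  refine Finset.prod_ne_zero_iff.2 fun l hl => ?_
  rw [eval_lin]
  intro h0
  have : v i = v l := by linear_combination h0
  rw [hv this] at hs
  exact hs hl

theorem eval_mem_zero {n : ℕ} (v : Fin n → ℂ) (i : Fin n) (s : Finset (Fin n)) (hs : i ∈ s) :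
    (∏ l ∈ s, lin (-v l) 1).eval (v i) = 0 := by
  rw [Polynomial.eval_prod]
  refine Finset.prod_eq_zero hs ?_
  rw [eval_lin]; ring

theorem natDegree_Rdiv {n : ℕ} {mu : Fin n → ℕ} (hmu : ∀ i, 1 ≤ mu i) (v : Fin n → ℂ) (i : Fin n) :
    (Rdiv mu v i).natDegree + 1 = ∑ i, mu i := by
  have h1 := congrArg Polynomial.natDegree (Rdiv_mul hmu v i)
  have h2 := natDegree_xP_one mu (fun i => - v i)
  have h0 : Rdiv mu v i ≠ 0 := by
    intro h0
    have := Rdiv_mul hmu v i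
    rw [h0, zero_mul] at this
    exact (xP_monic mu (fun i => - v i)).ne_zero this.symm
  rw [Polynomial.natDegree_mul h0 (lin_monic _).ne_zero, h2, natDegree_lin_one] at h1
  exact h1

theorem alph_mul_le {d : ℕ} (y : Fin (d+1) → ℂ) (Q : Polynomial ℂ) (n : ℕ)
    (h : ∀ b ≤ n, alph d y (Q * Polynomial.X ^ b) = 0) (p : Polynomial ℂ) (hp : p.natDegree ≤ n) :
    alph d y (Q * p) = 0 := by
  rw [p.as_sum_range_C_mul_X_pow' (show p.natDegree < n + 1 by omega), Finset.mul_sum, map_sum]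
  refine Finset.sum_eq_zero fun l hl => ?_
  rw [mul_left_comm, ← Polynomial.smul_eq_C_mul, map_smul, h l (by simpa [Nat.lt_succ_iff] using hl), smul_zero]

/-- vector of degree `≤ r` polynomials in `apolarSub` -/
theorem vec_mem_apolarSub {r m : ℕ} (a : Fin (r+m+1) → ℂ) {p : Polynomial ℂ} (hp : p.natDegree ≤ r) :
    vec r p ∈ apolarSub r m a ↔ ∀ c : Polynomial ℂ, c.natDegree ≤ m → alph (r+m) a (c * p) = 0 := by
  have h0 : vec r p ∈ apolarSub r m a ↔ vec r p ∈ apolarSet (r+m) r a := Iff.rfl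
  rw [h0, mem_apolarSet', toP_vec hp]

/-- if `α` kills `Q·S_n`, the apolar space meets things correctly -/
theorem mem_of_kill {r n j m k : ℕ} {lam : Fin n → ℕ} (h : isPartitionOf r n lam) (hn0 : 0 < n)
    (hn : n = m + j) (hk : k + m = r) {I : Finset (Fin n)} (hI : I.card = m)
    (y : Fin (r+m+1) → ℂ) (v : Fin n → ℂ) {t : ℂ} (ht : t ≠ 0)
    (hd : Module.finrank ℂ (tanSub (crlCone r n lam) (vec r (Polynomial.C t * xP lam (fun i => - v i) (fun _ => 1)))) ≤ n + 1)
    (hkill : ∀ b ≤ n, alph (r+m) y (xP (muI lam I) (fun i => - v i) (fun _ => 1) * Polynomial.X ^ b) = 0)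
    (hmin : ∃ s, ((Hank r m y).submatrix id s).det ≠ 0) :
    y ∈ apolarPull (r+m) r k (zClosure (smoothCHCone r (crlCone r n lam) (n+1) k j)) := by
  have hIc : Iᶜ.card = j := by rw [Finset.card_compl, hI, Fintype.card_fin]; omega
  obtain ⟨s, hs⟩ := hmin
  have hfr := finrank_ker_of_minor _ s hs
  rw [← apolarSub_eq_ker] at hfr
  have hfr' : Module.finrank ℂ (apolarSub r m y) = k := by omega
  obtain ⟨M, hM⟩ := exists_rows _ hfr'
  refine ⟨M, by rw [span_apolarSet, hM], by rw [hM, hfr'], subset_zClosure _ ?_⟩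
  have hxd := natDegree_xP lam (fun i => - v i) (fun _ => 1)
  rw [h.2] at hxd
  have hctd : (Polynomial.C t * xP lam (fun i => - v i) (fun _ => 1)).natDegree ≤ r :=
    (Polynomial.natDegree_C_mul_le _ _).trans hxd
  have hct0 : Polynomial.C t * xP lam (fun i => - v i) (fun _ => 1) ≠ 0 :=
    mul_ne_zero (by simpa using ht) (xP_monic _ _).ne_zero
  have hsum := sum_muI h I
  refine mem_smooth h hn0 M (by rw [hM, hfr']) (vec_ne_zero hct0 hctd) hd ?_ ?_
  · rw [hM, vec_mem_apolarSub _ hctd]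
    intro c hc
    rw [xP_lam_eq h.1 I, show c * (Polynomial.C t * (xP (muI lam I) (fun i => - v i) (fun _ => 1) *
      ∏ i ∈ Iᶜ, lin (- v i) 1)) = xP (muI lam I) (fun i => - v i) (fun _ => 1) *
        (Polynomial.C t * (c * ∏ i ∈ Iᶜ, lin (- v i) 1)) by ring]
    refine alph_mul_le _ _ n hkill _ ((Polynomial.natDegree_C_mul_le _ _).trans (Polynomial.natDegree_mul_le.trans ?_))
    have := natDegree_prod_lin Iᶜ (fun i => - v i) (fun _ => 1)
    omega
  · have hle : qSub r j (xP (muI lam I) (fun i => - v i) (fun _ => 1)) ≤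
        rowSpan M ⊓ qSub r n (qP lam (fun i => - v i) (fun _ => 1)) := by
      intro x hx
      obtain ⟨p, hp, rfl⟩ := mem_qSub.1 hx
      refine ⟨?_, ?_⟩
      · rw [hM, SetLike.mem_coe, vec_mem_apolarSub]
        · intro c hc
          rw [mul_left_comm]
          exact alph_mul_le _ _ n hkill _ (Polynomial.natDegree_mul_le.trans (by omega))
        · refine Polynomial.natDegree_mul_le.trans ?_
          rw [natDegree_xP_one]; omega
      · rw [SetLike.mem_coe, mem_qSub]
        refine ⟨(∏ i ∈ I, lin (- v i) 1) * p, ?_, ?_⟩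
        · refine Polynomial.natDegree_mul_le.trans ?_
          have := natDegree_prod_lin I (fun i => - v i) (fun _ => 1)
          omega
        · rw [← mul_assoc, xP_mu_eq h.1]
    have := Submodule.finrank_mono hle
    rwa [finrank_qSub (e := r - j) (xP_monic _ _).ne_zero (by rw [natDegree_xP_one]; omega) (by omega)] at this

theorem PolyFnP.alph {ι : Type} {d : ℕ} {y : (ι → ℂ) → Fin (d+1) → ℂ} (hy : ∀ s, PolyFn fun a => y a s)
    (l : ℕ) (hl : l ≤ d) : PolyFn fun a => alph d (y a) (Polynomial.X ^ l) := by
  have : ∀ a, _root_.alph d (y a) (Polynomial.X ^ l) = wF d l * exN d (y a) l := fun a => alph_X_pow' d (y a) l hl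
  simp only [this]
  unfold exN
  simp only [Nat.lt_succ_of_le hl, dif_pos]
  exact (PolyFn.const _).mul (hy _)

theorem pull_lower {r n j m k : ℕ} {lam : Fin n → ℕ} (h : isPartitionOf r n lam) (hn0 : 0 < n)
    (hn : n = m + j) (hk : k + m = r) (hjr : j + n + 1 ≤ r) {I : Finset (Fin n)} (hI : I.card = m)
    (hmu : ∀ i, 1 ≤ muI lam I i) :
    zChain (zClosure (apolarPull (r+m) r k (zClosure (smoothCHCone r (crlCone r n lam) (n+1) k j)))) (r+m) := by
  set mu := muI lam I with hmudef
  have hIc : Iᶜ.card = j := by rw [Finset.card_compl, hI, Fintype.card_fin]; omega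
  have hsum := sum_muI h I
  rw [hIc, ← hmudef] at hsum
  have he : (r - j) + n ≤ r + m := by omega
  obtain ⟨φ, hφ, hφ1, hφ2, hφ3⟩ := exists_solve (ι := Fin n) (r+m) (r-j) n he
    (fun ρ => xP mu (fun i => - ρ i) (fun _ => 1))
    (PolyFnP.xP mu (fun i => (PolyFn.coord i).neg) (fun i => PolyFn.const _))
    (fun ρ => xP_monic _ _) (fun ρ => by rw [natDegree_xP_one]; omega)
  let v0 : Fin n → ℂ := fun i => ((i : ℕ) : ℂ)
  have hv0 : Function.Injective v0 := by
    intro a b hab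
    simp only [v0, Nat.cast_inj] at hab
    exact Fin.ext hab
  obtain ⟨A, hA, β, hβ, hAR⟩ := exists_alpha0 hmu hv0
  let a0 : Fin n ⊕ FreeC (r+m) (r-j) n → ℂ := Sum.elim v0 (fun l => ofFun (r+m) A l.1)
  have hφ0 : φ a0 = ofFun (r+m) A := by
    symm
    refine hφ3 a0 _ (fun b hb => ?_) (fun l => rfl)
    rw [alph_ofFun]
    · exact hA _
    · refine Polynomial.natDegree_mul_le.trans ?_
      rw [natDegree_xP_one, Polynomial.natDegree_X_pow]; omega
  obtain ⟨s, hs⟩ : ∃ s, ((Hank r m (φ a0)).submatrix id s).det ≠ 0 := by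
    rw [hφ0]
    refine Hank_minor _ fun c hc hb => ?_
    refine Hank_nondeg (show m ≤ n by omega) hmu (show _ ≤ r by omega) (by omega) hv0 A hβ hAR c hc fun b hbd => ?_
    rw [← hb b hbd, alph_ofFun]
    exact Polynomial.natDegree_mul_le.trans (by omega)
  obtain ⟨t, ht, D, hD, hD0, hD1⟩ := exists_smooth' h
  have hHank : PolyFn fun a => ((Hank r m (φ a)).submatrix id s).det := by
    refine PolyFn.det fun p l => ?_
    simp only [Matrix.submatrix_apply, Hank, Matrix.of_apply, ← pow_add]
    refine PolyFnP.alph hφ _ ?_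
    have := (s l).2; have := p.2
    simp only [id]; omega
  have hDc : PolyFn fun a : Fin n ⊕ FreeC (r+m) (r-j) n → ℂ => D (fun i => a (Sum.inl i)) :=
    hD.comp fun i => PolyFn.coord _
  have hcard : Fintype.card (Fin n ⊕ FreeC (r+m) (r-j) n) = r + m := by
    rw [Fintype.card_sum, Fintype.card_fin, card_FreeC _ _ _ he]; omega
  classical
  suffices goal : zChain (zClosure (apolarPull (r+m) r k (zClosure (smoothCHCone r (crlCone r n lam) (n+1) k j))))
      (Fintype.card (Fin n ⊕ FreeC (r+m) (r-j) n)) by rwa [hcard] at goal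
  clear hcard
  obtain ⟨a1, ha1⟩ := hD0
  refine zChain_of_jac φ hφ _ (hDc.mul hHank) (hDc.mul_ne hHank ⟨Sum.elim a1 0, by simpa using ha1⟩ ⟨a0, hs⟩) ?_ a0 ?_
  · intro a ha
    exact mem_of_kill h hn0 hn hk hI (φ a) (fun i => a (Sum.inl i)) ht (hD1 _ (left_ne_zero_of_mul ha)) (hφ1 a)
      ⟨s, right_ne_zero_of_mul ha⟩
  · intro b hb
    have hfree : ∀ l, b (Sum.inr l) = 0 := by
      intro l
      have h1 := hb l.1
      simp only [hφ2, Pi.add_apply, Pi.smul_apply, smul_eq_mul] at h1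
      have h2 : HasDerivAt (fun e : ℂ => a0 (Sum.inr l) + e * b (Sum.inr l)) (b (Sum.inr l)) 0 := by
        simpa using ((hasDerivAt_id (0:ℂ)).mul_const (b (Sum.inr l))).const_add (a0 (Sum.inr l))
      exact h2.unique h1
    have hv : ∀ i, b (Sum.inl i) = 0 := by
      intro i
      have hp := (HasDerivP.xP mu v0 (fun i => b (Sum.inl i))).mul (HasDerivP.const (∏ l ∈ Finset.univ.erase i, lin (- v0 l) 1))
      have hhd : (∏ l ∈ Finset.univ.erase i, lin (- v0 l) 1).natDegree ≤ n - 1 := by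
        have := natDegree_prod_lin (Finset.univ.erase i) (fun l => - v0 l) (fun _ => 1)
        rwa [Finset.card_erase_of_mem (Finset.mem_univ i), Finset.card_univ, Fintype.card_fin] at this
      have h1 := alph_deriv (r+m) (y := fun e => φ (a0 + e • b)) hb hp ?_ ?_ ?_
      · simp only [zero_smul, add_zero, mul_zero] at h1
        rw [hφ0, alph_ofFun, Finset.sum_mul, map_sum, Finset.sum_eq_single i] at h1
        · rw [mul_assoc, ← Polynomial.smul_eq_C_mul, map_smul, hAR, smul_eq_mul] at h1
          have hne := eval_erase_ne hv0 i (Finset.univ.erase i) (by simp)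
          have hmu0 : (mu i : ℂ) ≠ 0 := by
            have := hmu i
            exact_mod_cast (by omega : mu i ≠ 0)
          have := (mul_eq_zero.1 h1).resolve_right (mul_ne_zero (hβ i) hne)
          have := (mul_eq_zero.1 this).resolve_right hmu0
          exact neg_eq_zero.1 this
        · intro l _ hl
          rw [mul_assoc, ← Polynomial.smul_eq_C_mul, map_smul, hAR, eval_mem_zero v0 l _ (by simp [hl]), mul_zero, smul_zero]
        · simp
        · refine Polynomial.natDegree_mul_le.trans ?_
          have : (∑ x, Polynomial.C (-b (Sum.inl x) * ↑(mu x)) * Rdiv mu v0 x).natDegree ≤ r - j := by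
            refine Polynomial.natDegree_sum_le_of_forall_le _ _ fun l _ => ?_
            refine (Polynomial.natDegree_C_mul_le _ _).trans ?_
            have := natDegree_Rdiv hmu v0 l
            omega
          omega
      · intro e
        refine Polynomial.natDegree_mul_le.trans ?_
        rw [natDegree_xP_one]; omega
      · rw [mul_zero, add_zero]
        refine Polynomial.natDegree_mul_le.trans ?_
        have : (∑ x, Polynomial.C (-b (Sum.inl x) * ↑(mu x)) * Rdiv mu v0 x).natDegree ≤ r - j := by
          refine Polynomial.natDegree_sum_le_of_forall_le _ _ fun l _ => ?_
          refine (Polynomial.natDegree_C_mul_le _ _).trans ?_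
          have := natDegree_Rdiv hmu v0 l
          omega
        omega
      · intro e
        have := alph_mul_le _ _ n (hφ1 (a0 + e • b)) _ (hhd.trans (Nat.sub_le _ _))
        exact this
    funext x
    rcases x with i | l
    · exact hv i
    · exact hfree l

end

section
set_option linter.unusedSectionVars false

theorem linInd_of_minor {k N : ℕ} (M : Matrix (Fin k) (Fin N) ℂ) (s : Fin k → Fin N) (h : plucker M s ≠ 0) :
    LinearIndependent ℂ (fun i => M i) := by
  have h1 := Matrix.linearIndependent_rows_of_det_ne_zero h
  exact LinearIndependent.of_comp (LinearMap.funLeft ℂ ℂ s) h1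

theorem exists_minor_of_linInd {k N : ℕ} (M : Matrix (Fin k) (Fin N) ℂ) (h : LinearIndependent ℂ (fun i => M i)) :
    ∃ s, plucker M s ≠ 0 := by
  refine exists_minor M fun c hc => ?_
  rw [Fintype.linearIndependent_iff] at h
  funext i
  refine h c ?_ i
  funext l
  have := congrFun hc l
  simpa [Matrix.vecMul, dotProduct] using this

theorem finrank_rowSpan_of_linInd {k N : ℕ} (M : Matrix (Fin k) (Fin N) ℂ) (h : LinearIndependent ℂ (fun i => M i)) :
    Module.finrank ℂ (rowSpan M) = k := by
  unfold rowSpan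
  rw [finrank_span_eq_card h, Fintype.card_fin]

theorem linInd_of_finrank {k N : ℕ} (M : Matrix (Fin k) (Fin N) ℂ) (h : Module.finrank ℂ (rowSpan M) = k) :
    LinearIndependent ℂ (fun i => M i) := by
  rw [linearIndependent_iff_card_eq_finrank_span, Fintype.card_fin]
  exact h.symm

theorem plucker_comp {k N : ℕ} (T : (Fin N → ℂ) →ₗ[ℂ] (Fin k → ℂ)) :
    ∃ c : (Fin k → Fin N) → ℂ, ∀ M : Matrix (Fin k) (Fin N) ℂ,
      Matrix.det (Matrix.of fun i => T (M i)) = ∑ s, c s * plucker M s := by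
  refine ⟨fun s => ∏ l, T (Pi.single (s l) 1) l, fun M => ?_⟩
  rw [← Matrix.det_transpose]
  have h1 : (Matrix.of fun i => T (M i)).transpose = fun l => ∑ p : Fin N, T (Pi.single p 1) l • M.transpose p := by
    funext l i
    simp only [Matrix.transpose_apply, Matrix.of_apply, Finset.sum_apply, Pi.smul_apply, smul_eq_mul]
    have : M i = ∑ p, M i p • (Pi.single p (1:ℂ) : Fin N → ℂ) := by
      conv_lhs => rw [pi_eq_sum_univ (M i)]
      refine Finset.sum_congr rfl fun p _ => ?_
      congr 1; funext q; simp [Pi.single_apply, eq_comm]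
    conv_lhs => rw [this]
    rw [map_sum, Finset.sum_apply]
    refine Finset.sum_congr rfl fun p _ => ?_
    rw [map_smul, Pi.smul_apply, smul_eq_mul, mul_comm]
  rw [h1]
  have h2 := (Matrix.detRowAlternating (R := ℂ) (n := Fin k)).toMultilinearMap.map_sum
    (g := fun l (p : Fin N) => T (Pi.single p 1) l • M.transpose p)
  refine h2.trans (Finset.sum_congr rfl fun s _ => ?_)
  refine ((Matrix.detRowAlternating (R := ℂ) (n := Fin k)).toMultilinearMap.map_smul_univ _ _).trans ?_
  rw [smul_eq_mul]
  congr 1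
  show Matrix.det (fun l => M.transpose (s l)) = _
  unfold plucker
  rw [← Matrix.det_transpose]
  rfl

theorem hasDerivAt_plucker {k N : ℕ} {M : ℂ → Matrix (Fin k) (Fin N) ℂ} {M' : Matrix (Fin k) (Fin N) ℂ}
    (hM : ∀ i l, HasDerivAt (fun e => M e i l) (M' i l) 0) (s : Fin k → Fin N) :
    HasDerivAt (fun e => plucker (M e) s) (∑ i, plucker ((M 0).updateRow i (M' i)) s) 0 := by
  have hd : ∀ B : Matrix (Fin k) (Fin N) ℂ, plucker B s = ∑ σ : Equiv.Perm (Fin k), ((Equiv.Perm.sign σ : ℤ) : ℂ) * ∏ i, B i (s (σ i)) := by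
    intro B
    unfold plucker
    rw [← Matrix.det_transpose, Matrix.det_apply']
    rfl
  simp only [hd]
  have h1 : HasDerivAt (fun e => ∑ σ : Equiv.Perm (Fin k), ((Equiv.Perm.sign σ : ℤ) : ℂ) * ∏ i, M e i (s (σ i)))
    (∑ σ : Equiv.Perm (Fin k), ((Equiv.Perm.sign σ : ℤ) : ℂ) *
      ∑ i, (∏ l ∈ Finset.univ.erase i, M 0 l (s (σ l))) • M' i (s (σ i))) 0 := by
    refine HasDerivAt.fun_sum fun σ _ => HasDerivAt.const_mul _ ?_
    exact HasDerivAt.fun_finsetProd fun i _ => hM i _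
  refine h1.congr_deriv ?_
  rw [Finset.sum_comm]
  refine Finset.sum_congr rfl fun σ _ => ?_
  rw [Finset.mul_sum]
  refine Finset.sum_congr rfl fun i _ => ?_
  congr 1
  rw [← Finset.mul_prod_erase _ _ (Finset.mem_univ i), Matrix.updateRow_self, smul_eq_mul, mul_comm]
  congr 1
  refine Finset.prod_congr rfl fun l hl => ?_
  rw [Matrix.updateRow_ne (Finset.mem_erase.1 hl).1]

theorem plucker_deriv_mem {k N : ℕ} {M0 M' : Matrix (Fin k) (Fin N) ℂ} (hM0 : LinearIndependent ℂ (fun i => M0 i))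
    (h : ∀ s, ∑ i, plucker (M0.updateRow i (M' i)) s = 0) (i0 : Fin k) : M' i0 ∈ rowSpan M0 := by
  by_contra hn
  unfold rowSpan at hn
  let f := (Module.Basis.span hM0).constr ℂ (fun i => if i = i0 then (0 : Fin k → ℂ) else Pi.single i 1)
  obtain ⟨T, hT, hT1⟩ := LinearMap.exists_extend_of_notMem f hn (Pi.single i0 (1:ℂ))
  have hT0 : ∀ i, T (M0 i) = if i = i0 then (0 : Fin k → ℂ) else Pi.single i 1 := by
    intro i
    have h1 := LinearMap.congr_fun hT (Module.Basis.span hM0 i)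
    simp only [f, Module.Basis.constr_basis, LinearMap.comp_apply, Submodule.subtype_apply] at h1
    rw [← h1, Module.Basis.span_apply]
  obtain ⟨c, hc⟩ := plucker_comp T
  have h1 : ∑ i, Matrix.det (Matrix.of fun l => T ((M0.updateRow i (M' i)) l)) = 0 := by
    simp only [hc]
    rw [Finset.sum_comm]
    refine Finset.sum_eq_zero fun s _ => ?_
    rw [← Finset.mul_sum, h, mul_zero]
  rw [Finset.sum_eq_single i0] at h1
  · have h2 : (Matrix.of fun l => T ((M0.updateRow i0 (M' i0)) l)) = 1 := by
      funext l
      show T ((M0.updateRow i0 (M' i0)) l) = _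
      by_cases hl : l = i0
      · subst hl
        rw [Matrix.updateRow_self, hT1]
        funext p; rw [Matrix.one_apply, Pi.single_apply]; simp [eq_comm]
      · rw [Matrix.updateRow_ne hl, hT0, if_neg hl]
        funext p; rw [Matrix.one_apply, Pi.single_apply]; simp [eq_comm]
    rw [h2, Matrix.det_one] at h1
    exact one_ne_zero h1
  · intro i _ hi
    refine Matrix.det_eq_zero_of_row_eq_zero i0 fun l => ?_
    rw [Matrix.of_apply, Matrix.updateRow_ne (Ne.symm hi), hT0, if_pos rfl]; rfl
  · simp

theorem plucker_deriv_scalar {k N : ℕ} {M0 M' : Matrix (Fin k) (Fin N) ℂ} (hM0 : LinearIndependent ℂ (fun i => M0 i))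
    (h : ∀ s, ∑ i, plucker (M0.updateRow i (M' i)) s = 0) (i0 : Fin k) (c : ℂ) (h1 : M' i0 = c • M0 i0)
    (h2 : ∀ i, i ≠ i0 → M' i = 0) : c = 0 := by
  obtain ⟨s, hs⟩ := exists_minor_of_linInd M0 hM0
  have h3 := h s
  rw [Finset.sum_eq_single i0] at h3
  · have : plucker (M0.updateRow i0 (M' i0)) s = c * plucker M0 s := by
      unfold plucker
      have : (M0.updateRow i0 (M' i0)).submatrix id s = (M0.submatrix id s).updateRow i0 (c • (M0.submatrix id s) i0) := by
        ext a b
        by_cases ha : a = i0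
        · subst ha; simp [h1]
        · simp [Matrix.updateRow_ne ha]
      rw [this, Matrix.det_updateRow_smul, Matrix.updateRow_eq_self]
    rw [this] at h3
    exact (mul_eq_zero.1 h3).resolve_right hs
  · intro i _ hi
    refine Matrix.det_eq_zero_of_row_eq_zero i fun l => ?_
    simp [h2 i hi]
  · simp

end

section
set_option linter.unusedSectionVars false

theorem Rdiv_mul1 {n : ℕ} {mu : Fin n → ℕ} (v : Fin n → ℂ) (i : Fin n) (hmu : 1 ≤ mu i) :
    Rdiv mu v i * lin (-v i) 1 = xP mu (fun i => - v i) (fun _ => 1) := by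
  unfold Rdiv xP
  rw [← Finset.mul_prod_erase _ (fun l => lin (-v l) 1 ^ mu l) (Finset.mem_univ i)]
  have : lin (-v i) 1 ^ mu i = lin (-v i) 1 ^ (mu i - 1) * lin (-v i) 1 := by
    rw [← pow_succ]; congr 1; omega
  rw [this]; ring

theorem Rdiv_lam_mem {n : ℕ} {lam : Fin n → ℕ} (hlam : ∀ i, 1 ≤ lam i) {I : Finset (Fin n)}
    (hmu : ∀ i, 1 ≤ muI lam I i) (v : Fin n → ℂ) (i : Fin n) (hi : i ∈ I) :
    Rdiv lam v i = Rdiv (muI lam I) v i * ∏ l ∈ Iᶜ, lin (-v l) 1 := by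
  apply mul_right_cancel₀ (lin_monic (-v i)).ne_zero
  rw [Rdiv_mul1 v i (hlam i), mul_right_comm, Rdiv_mul1 v i (hmu i), xP_lam_eq hlam I]

theorem Rdiv_lam_notMem {n : ℕ} {lam : Fin n → ℕ} (hlam : ∀ i, 1 ≤ lam i) {I : Finset (Fin n)}
    (hmu : ∀ i, 1 ≤ muI lam I i) (v : Fin n → ℂ) (i : Fin n) (hi : i ∉ I) :
    Rdiv lam v i = xP (muI lam I) (fun i => - v i) (fun _ => 1) * ∏ l ∈ Iᶜ.erase i, lin (-v l) 1 := by
  apply mul_right_cancel₀ (lin_monic (-v i)).ne_zero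
  rw [Rdiv_mul1 v i (hlam i), mul_assoc, Finset.prod_erase_mul _ _ (by simpa using hi), xP_lam_eq hlam I]

theorem Rdiv_pred_notMem {n : ℕ} {lam : Fin n → ℕ} (hlam : ∀ i, 1 ≤ lam i) {I : Finset (Fin n)}
    (hmu : ∀ i, 1 ≤ muI lam I i) (v : Fin n → ℂ) (i : Fin n) (hi : i ∉ I) :
    Rdiv (fun i => lam i - 1) v i * ∏ l ∈ I, lin (-v l) 1 = Rdiv (muI lam I) v i := by
  have h1 : 1 ≤ lam i - 1 := by have := hmu i; simpa [muI, hi] using this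
  apply mul_right_cancel₀ (lin_monic (-v i)).ne_zero
  rw [Rdiv_mul1 v i (hmu i), mul_right_comm, Rdiv_mul1 v i h1, xP_mu_eq hlam]
  rfl

theorem qP_mul_erase {n : ℕ} {lam : Fin n → ℕ} (hlam : ∀ i, 1 ≤ lam i) {I : Finset (Fin n)}
    (hmu : ∀ i, 1 ≤ muI lam I i) (v : Fin n → ℂ) (i : Fin n) (hi : i ∈ I) :
    qP lam (fun i => - v i) (fun _ => 1) * ∏ l ∈ I.erase i, lin (-v l) 1 = Rdiv (muI lam I) v i := by
  apply mul_right_cancel₀ (lin_monic (-v i)).ne_zero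
  rw [Rdiv_mul1 v i (hmu i), mul_assoc, Finset.prod_erase_mul _ _ hi, xP_mu_eq hlam]

theorem core1 {n : ℕ} {lam : Fin n → ℕ} (hlam : ∀ i, 1 ≤ lam i) {I : Finset (Fin n)}
    (hmu : ∀ i, 1 ≤ muI lam I i) {v : Fin n → ℂ} (hv : Function.Injective v) {A : Polynomial ℂ →ₗ[ℂ] ℂ} {β : Fin n → ℂ} (hβ : ∀ i, β i ≠ 0)
    (hA : ∀ p, A (xP (muI lam I) (fun i => - v i) (fun _ => 1) * p) = 0)
    (hAR : ∀ i h, A (Rdiv (muI lam I) v i * h) = β i * h.eval (v i))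
    {m : ℕ} (hI : I.card = m) (b : Fin n → ℂ)
    (h : ∀ c : Polynomial ℂ, c.natDegree ≤ m → A (c * ∑ i, Polynomial.C (- b i * lam i) * Rdiv lam v i) = 0)
    (i : Fin n) (hi : i ∈ I) : b i = 0 := by
  have h1 := h (∏ l ∈ I.erase i, lin (-v l) 1) ((natDegree_prod_lin _ _ _).trans (by
    rw [Finset.card_erase_of_mem hi]; omega))
  rw [Finset.mul_sum, map_sum, Finset.sum_eq_single i] at h1
  · rw [mul_left_comm, ← Polynomial.smul_eq_C_mul, map_smul, Rdiv_lam_mem hlam hmu v i hi, mul_left_comm, hAR,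
      Polynomial.eval_mul, smul_eq_mul] at h1
    have e1 := eval_erase_ne hv i (I.erase i) (by simp)
    have e2 := eval_erase_ne hv i Iᶜ (by simpa using hi)
    have e3 := (mul_eq_zero.1 h1).resolve_right (mul_ne_zero (hβ i) (mul_ne_zero e1 e2))
    have e4 : (lam i : ℂ) ≠ 0 := by have := hlam i; exact_mod_cast (by omega : lam i ≠ 0)
    exact neg_eq_zero.1 ((mul_eq_zero.1 e3).resolve_right e4)
  · intro l _ hl
    rw [mul_left_comm, ← Polynomial.smul_eq_C_mul, map_smul]
    by_cases hlI : l ∈ I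
    · rw [Rdiv_lam_mem hlam hmu v l hlI, mul_left_comm, hAR, Polynomial.eval_mul,
        eval_mem_zero v l _ (by simp [hl, hlI]), zero_mul, mul_zero, smul_zero]
    · rw [Rdiv_lam_notMem hlam hmu v l hlI, mul_left_comm, hA, smul_zero]
  · simp

theorem core2 {n : ℕ} {lam : Fin n → ℕ} (hlam : ∀ i, 1 ≤ lam i) {I : Finset (Fin n)}
    (hmu : ∀ i, 1 ≤ muI lam I i) {v : Fin n → ℂ} (hv : Function.Injective v) {A : Polynomial ℂ →ₗ[ℂ] ℂ} {β : Fin n → ℂ} (hβ : ∀ i, β i ≠ 0)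
    (hA : ∀ p, A (xP (muI lam I) (fun i => - v i) (fun _ => 1) * p) = 0)
    (hAR : ∀ i h, A (Rdiv (muI lam I) v i * h) = β i * h.eval (v i))
    {j : ℕ} (hIc : Iᶜ.card = j) (b : Fin n → ℂ) (hb : ∀ i ∈ I, b i = 0)
    (h : ∀ t < j, ∃ P, A ((∏ l ∈ I, lin (-v l) 1) *
      ((∑ i, Polynomial.C (- b i * ((lam i - 1 : ℕ) : ℂ)) * Rdiv (fun i => lam i - 1) v i) *
        ((∏ l ∈ I, lin (-v l) 1) * Polynomial.X ^ t) + qP lam (fun i => - v i) (fun _ => 1) * P)) = 0)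
    (i : Fin n) (hi : i ∉ I) : b i = 0 := by
  have h1 : ∀ t < j, A ((∑ l, Polynomial.C (- b l * ((lam l - 1 : ℕ) : ℂ)) * Rdiv (fun i => lam i - 1) v l) *
      (∏ l ∈ I, lin (-v l) 1) * ((∏ l ∈ I, lin (-v l) 1) * Polynomial.X ^ t)) = 0 := by
    intro t ht
    obtain ⟨P, hP⟩ := h t ht
    rw [mul_add, map_add] at hP
    have h2 : A ((∏ l ∈ I, lin (-v l) 1) * (qP lam (fun i => - v i) (fun _ => 1) * P)) = 0 := by
      rw [← hA P, xP_mu_eq hlam]; congr 1; ring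
    rw [h2, add_zero] at hP
    rw [← hP]; congr 1; ring
  have hj : 1 ≤ j := by
    rw [← hIc]; exact Finset.card_pos.2 ⟨i, by simpa using hi⟩
  let g := ∏ l ∈ Iᶜ.erase i, lin (-v l) 1
  have hg : g.natDegree < j := by
    refine (natDegree_prod_lin _ _ _).trans_lt ?_
    rw [Finset.card_erase_of_mem (by simpa using hi)]; omega
  have h2 : A ((∑ l, Polynomial.C (- b l * ((lam l - 1 : ℕ) : ℂ)) * Rdiv (fun i => lam i - 1) v l) *
      (∏ l ∈ I, lin (-v l) 1) * ((∏ l ∈ I, lin (-v l) 1) * g)) = 0 := by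
    rw [g.as_sum_range_C_mul_X_pow' hg, Finset.mul_sum, Finset.mul_sum, map_sum]
    refine Finset.sum_eq_zero fun t ht => ?_
    rw [mul_left_comm (∏ l ∈ I, lin (-v l) 1), mul_left_comm _ (Polynomial.C _), ← Polynomial.smul_eq_C_mul, map_smul,
      h1 t (Finset.mem_range.1 ht), smul_zero]
  rw [Finset.sum_mul, Finset.sum_mul, map_sum, Finset.sum_eq_single i] at h2
  · rw [mul_assoc (Polynomial.C _), mul_assoc (Polynomial.C _), Rdiv_pred_notMem hlam hmu v i hi, ← Polynomial.smul_eq_C_mul, map_smul, hAR,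
      Polynomial.eval_mul, smul_eq_mul] at h2
    have e1 := eval_erase_ne hv i I hi
    have e2 := eval_erase_ne hv i (Iᶜ.erase i) (by simp)
    have e3 := (mul_eq_zero.1 h2).resolve_right (mul_ne_zero (hβ i) (mul_ne_zero e1 e2))
    have e4 : ((lam i - 1 : ℕ) : ℂ) ≠ 0 := by
      have := hmu i
      simp only [muI, hi, if_false] at this
      exact_mod_cast (by omega : lam i - 1 ≠ 0)
    exact neg_eq_zero.1 ((mul_eq_zero.1 e3).resolve_right e4)
  · intro l _ hl
    by_cases hlI : l ∈ I
    · rw [hb l hlI]; simp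
    · rw [mul_assoc (Polynomial.C _), mul_assoc (Polynomial.C _), Rdiv_pred_notMem hlam hmu v l hlI, ← Polynomial.smul_eq_C_mul, map_smul, hAR,
        Polynomial.eval_mul, eval_mem_zero v l (Iᶜ.erase i) (by simp [hl, hlI]), mul_zero, mul_zero, smul_zero]
  · simp

theorem core3 {n : ℕ} {lam : Fin n → ℕ} (hlam : ∀ i, 1 ≤ lam i) {I : Finset (Fin n)}
    (hmu : ∀ i, 1 ≤ muI lam I i) {v : Fin n → ℂ} (hv : Function.Injective v) {A : Polynomial ℂ →ₗ[ℂ] ℂ} {β : Fin n → ℂ} (hβ : ∀ i, β i ≠ 0)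
    (hA : ∀ p, A (xP (muI lam I) (fun i => - v i) (fun _ => 1) * p) = 0)
    (hAR : ∀ i h, A (Rdiv (muI lam I) v i * h) = β i * h.eval (v i))
    {m : ℕ} (hI : I.card = m) (P : Polynomial ℂ) (hP : P.degree < m)
    (h : ∀ c : Polynomial ℂ, c.natDegree ≤ m → A (c * (qP lam (fun i => - v i) (fun _ => 1) * P)) = 0) : P = 0 := by
  have hroot : ∀ i ∈ I, P.eval (v i) = 0 := by
    intro i hi
    have h1 := h (∏ l ∈ I.erase i, lin (-v l) 1) ((natDegree_prod_lin _ _ _).trans (by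
      rw [Finset.card_erase_of_mem hi]; omega))
    rw [← mul_assoc, mul_comm (∏ l ∈ I.erase i, lin (-v l) 1), qP_mul_erase hlam hmu v i hi, hAR] at h1
    exact (mul_eq_zero.1 h1).resolve_left (hβ i)
  exact Polynomial.eq_zero_of_degree_lt_of_eval_index_eq_zero I (v := v) hv.injOn (by rw [hI]; exact hP) hroot

end

section
set_option linter.unusedSectionVars false

def chRow (r : ℕ) {j c : ℕ} (x q : Polynomial ℂ) (w : Fin j → Polynomial ℂ) (g : Fin c → Fin (r+1) → ℂ) :
    Option (Fin j) ⊕ Fin c → (Fin (r+1) → ℂ)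
  | Sum.inl none => vec r x
  | Sum.inl (some i) => vec r (q * w i)
  | Sum.inr l => g l

def chMat (r : ℕ) {j c k : ℕ} (ε : Fin k ≃ Option (Fin j) ⊕ Fin c) (x q : Polynomial ℂ) (w : Fin j → Polynomial ℂ)
    (g : Fin c → Fin (r+1) → ℂ) : Matrix (Fin k) (Fin (r+1)) ℂ := Matrix.of fun i => chRow r x q w g (ε i)

theorem chMat_apply (r : ℕ) {j c k : ℕ} (ε : Fin k ≃ Option (Fin j) ⊕ Fin c) (x q : Polynomial ℂ) (w : Fin j → Polynomial ℂ)
    (g : Fin c → Fin (r+1) → ℂ) (i : Fin k) : chMat r ε x q w g i = chRow r x q w g (ε i) := rfl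

theorem chMat_symm (r : ℕ) {j c k : ℕ} (ε : Fin k ≃ Option (Fin j) ⊕ Fin c) (x q : Polynomial ℂ) (w : Fin j → Polynomial ℂ)
    (g : Fin c → Fin (r+1) → ℂ) (i : Option (Fin j) ⊕ Fin c) : chMat r ε x q w g (ε.symm i) = chRow r x q w g i := by
  rw [chMat_apply, Equiv.apply_symm_apply]

theorem chMat_linInd {r j c k : ℕ} {ε : Fin k ≃ Option (Fin j) ⊕ Fin c} {x q : Polynomial ℂ} {w : Fin j → Polynomial ℂ}
    {g : Fin c → Fin (r+1) → ℂ} : LinearIndependent ℂ (fun i => chMat r ε x q w g i) ↔ LinearIndependent ℂ (chRow r x q w g) := by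
  have : (fun i => chMat r ε x q w g i) = chRow r x q w g ∘ ε := rfl
  rw [this]
  exact linearIndependent_equiv ε

theorem chMat_rowSpan {r j c k : ℕ} {ε : Fin k ≃ Option (Fin j) ⊕ Fin c} {x q : Polynomial ℂ} {w : Fin j → Polynomial ℂ}
    {g : Fin c → Fin (r+1) → ℂ} : rowSpan (chMat r ε x q w g) = Submodule.span ℂ (Set.range (chRow r x q w g)) := by
  unfold rowSpan
  congr 1
  exact ε.surjective.range_comp (chRow r x q w g)

theorem chMat_polyFn {ι : Type} (r : ℕ) {j c k : ℕ} (ε : Fin k ≃ Option (Fin j) ⊕ Fin c) {x q : (ι → ℂ) → Polynomial ℂ}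
    {w : (ι → ℂ) → Fin j → Polynomial ℂ} {g : (ι → ℂ) → Fin c → Fin (r+1) → ℂ} (hx : PolyFnP x) (hq : PolyFnP q)
    (hw : ∀ i, PolyFnP fun a => w a i) (hg : ∀ i l, PolyFn fun a => g a i l) (i : Fin k) (l : Fin (r+1)) :
    PolyFn fun a => chMat r ε (x a) (q a) (w a) (g a) i l := by
  simp only [chMat_apply]
  rcases ε i with (_ | t) | t
  · exact hx l
  · exact (hq.mul (hw t)) l
  · exact hg t l

theorem plucker_polyFn {ι : Type} {k N : ℕ} {M : (ι → ℂ) → Matrix (Fin k) (Fin N) ℂ} (hM : ∀ i l, PolyFn fun a => M a i l)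
    (s : Fin k → Fin N) : PolyFn fun a => plucker (M a) s :=
  PolyFn.det fun i l => hM i (s l)

theorem chMat_deriv (r : ℕ) {j c k : ℕ} (ε : Fin k ≃ Option (Fin j) ⊕ Fin c) {x q : ℂ → Polynomial ℂ}
    {w : ℂ → Fin j → Polynomial ℂ} {g : ℂ → Fin c → Fin (r+1) → ℂ} {x' q' : Polynomial ℂ}
    {w' : Fin j → Polynomial ℂ} {g' : Fin c → Fin (r+1) → ℂ} (hx : HasDerivP x x') (hq : HasDerivP q q')
    (hw : ∀ i, HasDerivP (fun a => w a i) (w' i)) (hg : ∀ i l, HasDerivAt (fun a => g a i l) (g' i l) 0) (i : Fin k) (l : Fin (r+1)) :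
    HasDerivAt (fun a => chMat r ε (x a) (q a) (w a) (g a) i l)
      ((chMat r ε x' 1 (fun i => q' * w 0 i + q 0 * w' i) g') i l) 0 := by
  simp only [chMat_apply]
  rcases ε i with (_ | t) | t
  · exact hx l
  · have := (hq.mul (hw t)) l
    simp only [chRow, one_mul]
    exact this
  · exact hg t l

theorem chMat_mem_smooth {r n j c k : ℕ} {lam : Fin n → ℕ} (h : isPartitionOf r n lam) (hn : 0 < n)
    (ε : Fin k ≃ Option (Fin j) ⊕ Fin c) {t t' : ℂ} (ht : t ≠ 0) (ht' : t' ≠ 0) {u v : Fin n → ℂ}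
    (w : Fin j → Polynomial ℂ) (hw : ∀ i, (w i).natDegree ≤ n)
    (g : Fin c → Fin (r+1) → ℂ)
    (hd : Module.finrank ℂ (tanSub (crlCone r n lam) (vec r (Polynomial.C t * xP lam u v))) ≤ n + 1)
    (hM : LinearIndependent ℂ (fun i => chMat r ε (Polynomial.C t' * xP lam u v) (qP lam u v) w g i)) :
    plucker (chMat r ε (Polynomial.C t' * xP lam u v) (qP lam u v) w g) ∈ smoothCHCone r (crlCone r n lam) (n+1) k j := by
  have hspan := chMat_rowSpan (r := r) (ε := ε) (x := Polynomial.C t' * xP lam u v) (q := qP lam u v) (w := w) (g := g)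
  have hM' := chMat_linInd.1 hM
  have hx : vec r (Polynomial.C t * xP lam u v) = (t * t'⁻¹) • vec r (Polynomial.C t' * xP lam u v) := by
    rw [← Polynomial.smul_eq_C_mul, ← Polynomial.smul_eq_C_mul, map_smul, map_smul, smul_smul]
    congr 1; field_simp
  have hrow : ∀ i, chRow r (Polynomial.C t' * xP lam u v) (qP lam u v) w g i ∈
      Submodule.span ℂ (Set.range (chRow r (Polynomial.C t' * xP lam u v) (qP lam u v) w g)) :=
    fun i => Submodule.subset_span ⟨i, rfl⟩
  refine mem_smooth h hn _ (finrank_rowSpan_of_linInd _ hM) (t := t) (u := u) (v := v) ?_ hd ?_ ?_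
  · rw [hx]
    exact smul_ne_zero (mul_ne_zero ht (inv_ne_zero ht')) (hM'.ne_zero (Sum.inl none))
  · rw [hspan, hx]
    exact Submodule.smul_mem _ _ (hrow (Sum.inl none))
  · rw [hspan]
    have hmem : ∀ o : Option (Fin j), chRow r (Polynomial.C t' * xP lam u v) (qP lam u v) w g (Sum.inl o) ∈
        Submodule.span ℂ (Set.range (chRow r (Polynomial.C t' * xP lam u v) (qP lam u v) w g)) ⊓ qSub r n (qP lam u v) := by
      intro o
      refine ⟨hrow _, ?_⟩
      rw [SetLike.mem_coe, mem_qSub]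
      cases o with
      | none =>
        refine ⟨Polynomial.C t' * ∏ i, lin (u i) (v i), ?_, ?_⟩
        · refine (Polynomial.natDegree_C_mul_le _ _).trans ?_
          simpa using natDegree_prod_lin Finset.univ u v
        · show vec r _ = vec r _
          rw [xP_eq_q_mul h.1]; congr 1; ring
      | some i => exact ⟨w i, hw i, rfl⟩
    have hli : LinearIndependent ℂ (fun o => (⟨_, hmem o⟩ : ↥(Submodule.span ℂ (Set.range (chRow r (Polynomial.C t' * xP lam u v) (qP lam u v) w g)) ⊓ qSub r n (qP lam u v)))) := by
      refine LinearIndependent.of_comp (Submodule.subtype _) ?_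
      exact hM'.comp Sum.inl Sum.inl_injective
    have := hli.fintype_card_le_finrank
    simpa using this

theorem extend_family {V ι : Type} [AddCommGroup V] [Module ℂ V] [Fintype ι] (L : Submodule ℂ V) [FiniteDimensional ℂ L] {k c : ℕ}
    (hL : Module.finrank ℂ L = k) (f : ι → V) (hf : LinearIndependent ℂ f) (hfL : ∀ i, f i ∈ L) (hc : Fintype.card ι + c = k) :
    ∃ g : Fin c → V, (∀ l, g l ∈ L) ∧ LinearIndependent ℂ (Sum.elim f g) := by
  let f' : ι → L := fun i => ⟨f i, hfL i⟩
  have hf' : LinearIndependent ℂ f' := LinearIndependent.of_comp L.subtype hf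
  obtain ⟨C, hC⟩ := Submodule.exists_isCompl (Submodule.span ℂ (Set.range f'))
  have h1 := Submodule.finrank_add_eq_of_isCompl hC
  rw [finrank_span_eq_card hf', hL] at h1
  let b := Module.finBasisOfFinrankEq ℂ C (show Module.finrank ℂ C = c by omega)
  have hb : LinearIndependent ℂ (fun i => (b i : L)) := b.linearIndependent.map' C.subtype (by simp)
  refine ⟨fun i => ((b i : L) : V), fun l => (b l : L).2, ?_⟩
  have h2 := hf'.sum_type hb (hC.disjoint.mono_right (Submodule.span_le.2 (by rintro _ ⟨i, rfl⟩; exact (b i).2)))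
  have h3 := h2.map' L.subtype (by simp)
  have e : Sum.elim f (fun i => ((b i : L) : V)) = L.subtype ∘ Sum.elim f' (fun i => (b i : L)) := by
    funext x
    rcases x with i | i <;> rfl
  rw [e]
  exact h3

def Wp {m : ℕ} (c : Fin m → ℂ) : Polynomial ℂ := ∑ b, Polynomial.C (c b) * Polynomial.X ^ (b:ℕ)

theorem Wp_degree {m : ℕ} (c : Fin m → ℂ) : (Wp c).degree < m := by
  unfold Wp
  refine (Polynomial.degree_sum_le _ _).trans_lt ?_
  rw [Finset.sup_lt_iff (by exact_mod_cast WithBot.bot_lt_coe m)]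
  intro b _
  exact (Polynomial.degree_C_mul_X_pow_le _ _).trans_lt (by exact_mod_cast b.2)

theorem Wp_natDegree {m n : ℕ} (hm : m ≤ n) (c : Fin m → ℂ) : (Wp c).natDegree ≤ n := by
  rw [Polynomial.natDegree_le_iff_degree_le]
  exact (Wp_degree c).le.trans (by exact_mod_cast hm)

theorem Wp_eq_zero {m : ℕ} {c : Fin m → ℂ} (h : Wp c = 0) : c = 0 := by
  funext b
  have := congrArg (fun p => p.coeff (b:ℕ)) h
  simpa [Wp, Polynomial.coeff_X_pow, Fin.val_inj] using this

theorem PolyFnP.Wp {ι : Type} {m : ℕ} {c : (ι → ℂ) → Fin m → ℂ} (hc : ∀ b, PolyFn fun a => c a b) :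
    PolyFnP fun a => Wp (c a) :=
  PolyFnP.sum _ fun b _ => (PolyFnP.C (hc b)).mul (PolyFnP.const _)

theorem HasDerivP.C (a b : ℂ) : HasDerivP (fun e => Polynomial.C (a + e * b)) (Polynomial.C b) := by
  have := HasDerivP.lin (a := a) (b := b) 0
  simpa [_root_.lin] using this

theorem HasDerivP.Wp {m : ℕ} (a c : Fin m → ℂ) : HasDerivP (fun e => Wp (fun b => a b + e * c b)) (Wp c) := by
  intro k
  simp only [_root_.Wp, Polynomial.finsetSum_coeff, Polynomial.coeff_C_mul]
  refine HasDerivAt.fun_sum fun b _ => ?_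
  have h := (((hasDerivAt_id (0:ℂ)).mul_const (c b)).const_add (a b)).mul_const (((Polynomial.X : Polynomial ℂ) ^ (b:ℕ)).coeff k)
  simpa using h

end

section
set_option linter.unusedSectionVars false

abbrev PT (n j m c : ℕ) : Type := Option (Fin n ⊕ (Fin j × Fin m) ⊕ (Fin c × Fin (m+1)))

theorem card_PT {n j m c k : ℕ} (hn : n = m + j) (hk : 1 + j + c = k) : Fintype.card (PT n j m c) = k * (m+1) := by
  subst hn hk
  simp only [PT, Fintype.card_option, Fintype.card_sum, Fintype.card_prod, Fintype.card_fin]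
  ring

def famM (r : ℕ) {n j m c k : ℕ} (lam : Fin n → ℕ) (p : Polynomial ℂ) (g0 : Fin c → Fin (r+1) → ℂ)
    (s : Fin (m+1) → Fin (r+1)) (ε : Fin k ≃ Option (Fin j) ⊕ Fin c) (a : PT n j m c → ℂ) : Matrix (Fin k) (Fin (r+1)) ℂ :=
  chMat r ε (Polynomial.C (a none) * xP lam (fun i => - a (some (Sum.inl i))) (fun _ => 1))
    (qP lam (fun i => - a (some (Sum.inl i))) (fun _ => 1))
    (fun i => p * Polynomial.X ^ (i:ℕ) + Wp (fun b => a (some (Sum.inr (Sum.inl (i, b))))))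
    (fun l => g0 l + ∑ b, a (some (Sum.inr (Sum.inr (l, b)))) • Pi.single (s b) (1:ℂ))

theorem famM_polyFn (r : ℕ) {n j m c k : ℕ} (lam : Fin n → ℕ) (p : Polynomial ℂ) (g0 : Fin c → Fin (r+1) → ℂ)
    (s : Fin (m+1) → Fin (r+1)) (ε : Fin k ≃ Option (Fin j) ⊕ Fin c) (i : Fin k) (l : Fin (r+1)) :
    PolyFn fun a : PT n j m c → ℂ => famM r lam p g0 s ε a i l := by
  refine chMat_polyFn r ε ?_ ?_ ?_ ?_ i l
  · exact (PolyFnP.C (PolyFn.coord _)).mul (PolyFnP.xP lam (fun i => (PolyFn.coord _).neg) fun i => PolyFn.const _)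
  · exact PolyFnP.qP lam (fun i => (PolyFn.coord _).neg) fun i => PolyFn.const _
  · intro i
    exact (PolyFnP.const _).add (PolyFnP.Wp fun b => PolyFn.coord _)
  · intro i l
    simp only [Pi.add_apply, Finset.sum_apply, Pi.smul_apply, smul_eq_mul]
    exact (PolyFn.const _).add (PolyFn.sum _ fun b _ => (PolyFn.coord _).mul (PolyFn.const _))

/-- independence of the first rows -/
theorem base_linInd {r j : ℕ} {Q g : Polynomial ℂ} (hQ : Q ≠ 0) (hg : g.Monic) (hgd : g.natDegree = j) (hr : Q.natDegree + j ≤ r) :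
    LinearIndependent ℂ (fun o : Option (Fin j) => vec r (Q * o.elim g fun i => Polynomial.X ^ (i:ℕ))) := by
  rw [Fintype.linearIndependent_iff]
  intro c hc
  have h1 : vec r (Q * ∑ o, c o • (o.elim g fun i : Fin j => Polynomial.X ^ (i:ℕ))) = 0 := by
    rw [Finset.mul_sum, map_sum, ← hc]
    refine Finset.sum_congr rfl fun o _ => ?_
    rw [mul_smul_comm, map_smul]
  have hdeg : (∑ o, c o • (o.elim g fun i : Fin j => (Polynomial.X : Polynomial ℂ) ^ (i:ℕ))).natDegree ≤ j := by
    refine Polynomial.natDegree_sum_le_of_forall_le _ _ fun o _ => (Polynomial.natDegree_smul_le _ _).trans ?_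
    cases o with
    | none => exact hgd.le
    | some i => simp
  have h2 : Q * ∑ o, c o • (o.elim g fun i : Fin j => Polynomial.X ^ (i:ℕ)) = 0 := by
    refine vec_inj (N := r) (Polynomial.natDegree_mul_le.trans (by omega)) (by simp) (by rw [h1, map_zero])
  have h3 := (mul_eq_zero.1 h2).resolve_left hQ
  rw [Fintype.sum_option] at h3
  simp only [Option.elim_none, Option.elim_some] at h3
  have hnone : c none = 0 := by
    have := congrArg (fun p => p.coeff j) h3
    have hgj : g.coeff j = 1 := by rw [← hgd]; exact hg
    simp only [Polynomial.coeff_add, Polynomial.coeff_smul, hgj, Polynomial.finsetSum_coeff, Polynomial.coeff_X_pow,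
      Polynomial.coeff_zero, smul_eq_mul, mul_one] at this
    rw [Finset.sum_eq_zero, add_zero] at this
    · exact this
    · intro i _
      rw [if_neg (by have := i.2; omega), mul_zero]
  rw [hnone, zero_smul, zero_add] at h3
  intro o
  cases o with
  | none => exact hnone
  | some i =>
    have := congrArg (fun p => p.coeff (i:ℕ)) h3
    simpa [Polynomial.coeff_X_pow, Fin.val_inj] using this

theorem chMat_congr (r : ℕ) {j c k : ℕ} (ε : Fin k ≃ Option (Fin j) ⊕ Fin c) {x x2 q : Polynomial ℂ}
    {w w2 : Fin j → Polynomial ℂ} (hx : x = x2) (hw : ∀ i, w i = w2 i) (g : Fin c → Fin (r+1) → ℂ) (i : Fin k) (l : Fin (r+1)) :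
    chMat r ε x q w g i l = chMat r ε x2 q w2 g i l := by
  obtain rfl : w = w2 := funext hw
  rw [hx]

theorem ch_lower {r n j m k : ℕ} {lam : Fin n → ℕ} (h : isPartitionOf r n lam) (hn0 : 0 < n)
    (hn : n = m + j) (hk : k + m = r) (hjr : j + n + 1 ≤ r) {I : Finset (Fin n)} (hI : I.card = m)
    (hmu : ∀ i, 1 ≤ muI lam I i) :
    zChain (zClosure (smoothCHCone r (crlCone r n lam) (n+1) k j)) (k * (m+1)) := by
  have hIc : Iᶜ.card = j := by rw [Finset.card_compl, hI, Fintype.card_fin]; omega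
  have hsum := sum_muI h I
  rw [hIc] at hsum
  obtain ⟨c, hc⟩ : ∃ c, 1 + j + c = k := ⟨k - 1 - j, by omega⟩
  have ε : Fin k ≃ Option (Fin j) ⊕ Fin c := Fintype.equivOfCardEq (by simp; omega)
  let v0 : Fin n → ℂ := fun i => ((i : ℕ) : ℂ)
  have hv0 : Function.Injective v0 := by
    intro a b hab
    simp only [v0, Nat.cast_inj] at hab
    exact Fin.ext hab
  obtain ⟨A, hA, β, hβ, hAR⟩ := exists_alpha0 hmu hv0
  let α := ofFun (r+m) A
  obtain ⟨s, hs⟩ : ∃ s, ((Hank r m α).submatrix id s).det ≠ 0 := by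
    refine Hank_minor _ fun c hc hb => ?_
    refine Hank_nondeg (show m ≤ n by omega) hmu (show _ ≤ r by omega) (by omega) hv0 A hβ hAR c hc fun b hbd => ?_
    rw [← hb b hbd, alph_ofFun]
    exact Polynomial.natDegree_mul_le.trans (by omega)
  have hfr := finrank_ker_of_minor _ s hs
  rw [← apolarSub_eq_ker] at hfr
  have hfr' : Module.finrank ℂ (apolarSub r m α) = k := by omega
  -- test for membership
  have hmem : ∀ p : Polynomial ℂ, p.natDegree ≤ r → (vec r p ∈ apolarSub r m α ↔
      ∀ c : Polynomial ℂ, c.natDegree ≤ m → A (c * p) = 0) := by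
    intro p hp
    rw [vec_mem_apolarSub α hp]
    refine forall₂_congr fun c hc => ?_
    rw [alph_ofFun]
    exact Polynomial.natDegree_mul_le.trans (by omega)
  set Q := xP (muI lam I) (fun i => - v0 i) (fun _ => 1) with hQ
  set pI := ∏ l ∈ I, lin (- v0 l) 1 with hpI
  set pJ := ∏ l ∈ Iᶜ, lin (- v0 l) 1 with hpJ
  set q0 := qP lam (fun i => - v0 i) (fun _ => 1) with hq0
  have hQd : Q.natDegree + j = r := by rw [hQ, natDegree_xP_one]; exact hsum
  have hpJm : pJ.Monic := Polynomial.monic_prod_of_monic _ _ fun i _ => lin_monic _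
  have hpJd : pJ.natDegree = j := by
    rw [hpJ, Polynomial.natDegree_prod_of_monic _ _ fun i _ => lin_monic _]
    simp only [natDegree_lin_one]
    simpa using hIc
  have hpId : pI.natDegree ≤ m := (natDegree_prod_lin _ _ _).trans hI.le
  have hbase := base_linInd (xP_monic (muI lam I) (fun i => - v0 i)).ne_zero hpJm hpJd hQd.le
  have hbmem : ∀ o : Option (Fin j), vec r (Q * o.elim pJ fun i => Polynomial.X ^ (i:ℕ)) ∈ apolarSub r m α := by
    intro o
    rw [hmem]
    · intro c _
      rw [mul_left_comm]; exact hA _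
    · refine Polynomial.natDegree_mul_le.trans ?_
      cases o with
      | none => simp only [Option.elim_none]; omega
      | some i => have := i.2; simp only [Option.elim_some, Polynomial.natDegree_X_pow]; omega
  obtain ⟨g0, hg0, hg0li⟩ := extend_family (apolarSub r m α) hfr' _ hbase hbmem (c := c) (by simp; omega)
  let a0 : PT n j m c → ℂ := fun o => match o with
    | none => 1
    | some (Sum.inl i) => v0 i
    | some (Sum.inr _) => 0
  have hfam0 : famM r lam pI g0 s ε a0 = Matrix.of fun i => Sum.elim (fun o : Option (Fin j) => vec r (Q * o.elim pJ fun i => Polynomial.X ^ (i:ℕ))) g0 (ε i) := by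
    funext i
    show chRow _ _ _ _ _ (ε i) = Sum.elim _ _ (ε i)
    rcases ε i with (_ | t) | t
    · show vec r _ = vec r _
      congr 1
      show Polynomial.C 1 * xP lam (fun i => - v0 i) (fun _ => 1) = Q * pJ
      rw [map_one, one_mul, xP_lam_eq h.1 I]
    · show vec r _ = vec r _
      congr 1
      show q0 * (pI * Polynomial.X ^ (t:ℕ) + Wp fun b => 0) = Q * Polynomial.X ^ (t:ℕ)
      have : Wp (fun _ : Fin m => (0:ℂ)) = 0 := by simp [Wp]
      rw [this, add_zero, ← mul_assoc, hQ, xP_mu_eq h.1]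
    · show g0 t + ∑ b, (0:ℂ) • _ = g0 t
      simp
  have hli0 : LinearIndependent ℂ (fun i => famM r lam pI g0 s ε a0 i) := by
    rw [hfam0]
    exact (linearIndependent_equiv ε).2 hg0li
  have hspan0 : rowSpan (famM r lam pI g0 s ε a0) = apolarSub r m α := by
    refine Submodule.eq_of_le_of_finrank_eq ?_ (by rw [hfr', finrank_rowSpan_of_linInd _ hli0])
    unfold rowSpan
    rw [Submodule.span_le]
    rintro _ ⟨i, rfl⟩
    rw [hfam0]
    show Sum.elim _ _ (ε i) ∈ apolarSub r m α
    rcases ε i with o | t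
    · exact hbmem o
    · exact hg0 t
  obtain ⟨s1, hs1⟩ := exists_minor_of_linInd _ hli0
  obtain ⟨t, ht, D, hD, ⟨a1, ha1⟩, hD1⟩ := exists_smooth' h
  have hpl : ∀ s2, PolyFn fun a : PT n j m c → ℂ => plucker (famM r lam pI g0 s ε a) s2 :=
    fun s2 => plucker_polyFn (famM_polyFn r lam pI g0 s ε) s2
  have hDc : PolyFn fun a : PT n j m c → ℂ => D (fun i => a (some (Sum.inl i))) := hD.comp fun i => PolyFn.coord _
  have hDc0 : ∃ a : PT n j m c → ℂ, D (fun i => a (some (Sum.inl i))) ≠ 0 :=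
    ⟨fun o => match o with
      | some (Sum.inl i) => a1 i
      | _ => 0, ha1⟩
  have hprod1 := (PolyFn.coord (none : PT n j m c)).mul_ne hDc ⟨fun _ => 1, one_ne_zero⟩ hDc0
  have hprod := ((PolyFn.coord (none : PT n j m c)).mul hDc).mul_ne (hpl s1) hprod1 ⟨a0, hs1⟩
  have hcard := card_PT (n := n) (j := j) (m := m) (c := c) hn hc
  suffices goal : zChain (zClosure (smoothCHCone r (crlCone r n lam) (n+1) k j)) (Fintype.card (PT n j m c)) by
    rwa [hcard] at goal
  clear hcard
  refine zChain_of_jac (fun a => plucker (famM r lam pI g0 s ε a)) hpl _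
    (((PolyFn.coord (none : PT n j m c)).mul hDc).mul (hpl s1)) hprod ?_ a0 ?_
  · intro a ha
    have ha2 := left_ne_zero_of_mul ha
    refine chMat_mem_smooth h hn0 ε ht (left_ne_zero_of_mul ha2) _ ?_ _ (hD1 _ (right_ne_zero_of_mul ha2))
      (linInd_of_minor _ s1 (right_ne_zero_of_mul ha))
    intro i
    refine (Polynomial.natDegree_add_le _ _).trans (max_le ?_ (Wp_natDegree (by omega) _))
    refine Polynomial.natDegree_mul_le.trans ?_
    have := i.2
    rw [Polynomial.natDegree_X_pow]; omega
  · intro b hb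
    let bv : Fin n → ℂ := fun i => b (some (Sum.inl i))
    let x' := ∑ i, Polynomial.C (-bv i * lam i) * Rdiv lam v0 i
    let q' := ∑ i, Polynomial.C (-bv i * ((lam i - 1 : ℕ) : ℂ)) * Rdiv (fun i => lam i - 1) v0 i
    let w' : Fin j → Polynomial ℂ := fun i => Wp (fun t => b (some (Sum.inr (Sum.inl (i, t)))))
    let g' : Fin c → Fin (r+1) → ℂ := fun l => ∑ t, b (some (Sum.inr (Sum.inr (l, t)))) • Pi.single (s t) (1:ℂ)
    let X' := Polynomial.C (b none) * xP lam (fun i => - v0 i) (fun _ => 1) + x'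
    let M' := chMat r ε X' 1 (fun i => q' * (pI * Polynomial.X ^ (i:ℕ)) + q0 * w' i) g'
    have hder : ∀ i l, HasDerivAt (fun e : ℂ => famM r lam pI g0 s ε (a0 + e • b) i l) (M' i l) 0 := by
      intro i l
      have h1 := chMat_deriv r ε
        (x := fun e => Polynomial.C (1 + e * b none) * xP lam (fun i => -(v0 i + e * bv i)) (fun _ => 1))
        (q := fun e => qP lam (fun i => -(v0 i + e * bv i)) (fun _ => 1))
        (w := fun e i => pI * Polynomial.X ^ (i:ℕ) + Wp (fun t => 0 + e * b (some (Sum.inr (Sum.inl (i, t))))))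
        (g := fun e l => g0 l + ∑ t, (0 + e * b (some (Sum.inr (Sum.inr (l, t))))) • Pi.single (s t) (1:ℂ))
        (g' := g')
        ((HasDerivP.C 1 (b none)).mul (HasDerivP.xP lam v0 bv)) (HasDerivP.xP (fun i => lam i - 1) v0 bv)
        (fun i => (HasDerivP.const (pI * Polynomial.X ^ (i:ℕ))).add (HasDerivP.Wp _ _)) ?_ i l
      · refine HasDerivAt.congr_deriv h1 ?_
        refine chMat_congr r ε ?_ ?_ g' i l
        · simp only [zero_mul, add_zero, map_one, one_mul]; rfl
        · intro i
          have : Wp (fun _ : Fin m => (0:ℂ)) = 0 := by simp [Wp]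
          simp only [zero_mul, add_zero, zero_add, this]; rfl
      · intro i l
        simp only [Pi.add_apply, Finset.sum_apply, Pi.smul_apply, smul_eq_mul, g']
        refine HasDerivAt.const_add _ (HasDerivAt.fun_sum fun t _ => ?_)
        have h := (((hasDerivAt_id (0:ℂ)).mul_const (b (some (Sum.inr (Sum.inr (i, t)))))).const_add 0).mul_const ((Pi.single (s t) (1:ℂ) : Fin (r+1) → ℂ) l)
        simpa using h
    have hsum0 : ∀ s2, ∑ i, plucker ((famM r lam pI g0 s ε a0).updateRow i (M' i)) s2 = 0 := by
      intro s2
      have h1 := hasDerivAt_plucker hder s2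
      have h2 := h1.unique (hb s2)
      simpa using h2
    have hrow : ∀ i, chRow r X' 1 (fun i => q' * (pI * Polynomial.X ^ (i:ℕ)) + q0 * w' i) g' i ∈ apolarSub r m α := fun i => by
      rw [← hspan0, ← chMat_symm r ε]; exact plucker_deriv_mem hli0 hsum0 _
    -- degrees
    have hxd := natDegree_xP lam (fun i => - v0 i) (fun _ => 1)
    rw [h.2] at hxd
    have hRd : ∀ i, (Rdiv lam v0 i).natDegree ≤ r := by
      intro i
      have := natDegree_Rdiv h.1 v0 i
      have := h.2
      omega
    have hx'd : x'.natDegree ≤ r := Polynomial.natDegree_sum_le_of_forall_le _ _ fun i _ =>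
      (Polynomial.natDegree_C_mul_le _ _).trans (hRd i)
    have hbI : ∀ i ∈ I, bv i = 0 := by
      have h1 := hrow (Sum.inl none)
      have h2 : vec r x' ∈ apolarSub r m α := by
        have h3 : vec r (xP lam (fun i => - v0 i) (fun _ => 1)) ∈ apolarSub r m α := by
          have := hbmem none
          rwa [Option.elim_none, hQ, ← xP_lam_eq h.1 I] at this
        have h4 : vec r x' = vec r X' - b none • vec r (xP lam (fun i => - v0 i) (fun _ => 1)) := by
          rw [← map_smul, ← map_sub, Polynomial.smul_eq_C_mul]; congr 1; simp [X']
        rw [h4]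
        exact Submodule.sub_mem _ h1 (Submodule.smul_mem _ _ h3)
      exact core1 h.1 hmu hv0 hβ hA hAR hI bv ((hmem _ hx'd).1 h2)
    have hqd := natDegree_qP h (fun i => - v0 i) (fun _ => 1)
    have hRpd : ∀ i, (Rdiv (fun i => lam i - 1) v0 i).natDegree ≤ r - n := by
      intro i
      have h1 := sum_pred h
      by_cases hi : 1 ≤ lam i - 1
      · have h3 : Rdiv (fun i => lam i - 1) v0 i ≠ 0 := by
          intro h0
          have := Rdiv_mul1 (mu := fun i => lam i - 1) v0 i hi
          rw [h0, zero_mul] at this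
          exact (xP_monic _ _).ne_zero this.symm
        have h2 := congrArg Polynomial.natDegree (Rdiv_mul1 (mu := fun i => lam i - 1) v0 i hi)
        rw [Polynomial.natDegree_mul h3 (lin_monic _).ne_zero, natDegree_xP_one] at h2
        omega
      · have : Rdiv (fun i => lam i - 1) v0 i = xP (fun i => lam i - 1) (fun i => - v0 i) (fun _ => 1) := by
          unfold Rdiv xP
          rw [← Finset.mul_prod_erase _ (fun l => lin (-v0 l) 1 ^ (lam l - 1)) (Finset.mem_univ i)]
          congr 2
          show lam i - 1 - 1 = lam i - 1
          omega
        rw [this]; exact hqd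
    have hq'd : q'.natDegree ≤ r - n := Polynomial.natDegree_sum_le_of_forall_le _ _ fun i _ =>
      (Polynomial.natDegree_C_mul_le _ _).trans (hRpd i)
    have hnr : n ≤ r := by omega
    have hbIc : ∀ i, i ∉ I → bv i = 0 := by
      refine core2 h.1 hmu hv0 hβ hA hAR hIc bv hbI fun t htj => ⟨w' ⟨t, htj⟩, ?_⟩
      have h1 := hrow (Sum.inl (some ⟨t, htj⟩))
      have h2 := (hmem (1 * (q' * (pI * Polynomial.X ^ t) + q0 * w' ⟨t, htj⟩)) ?_).1 h1 pI hpId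
      · rw [one_mul] at h2
        exact h2
      · rw [one_mul]
        refine (Polynomial.natDegree_add_le _ _).trans (max_le ?_ ?_)
        · refine Polynomial.natDegree_mul_le.trans ?_
          have : (pI * Polynomial.X ^ t).natDegree ≤ m + t := Polynomial.natDegree_mul_le.trans (by
            rw [Polynomial.natDegree_X_pow]; omega)
          omega
        · refine Polynomial.natDegree_mul_le.trans ?_
          have : (w' ⟨t, htj⟩).natDegree ≤ n := Wp_natDegree (by omega) _
          have hqd' : q0.natDegree ≤ r - n := hqd
          omega
    have hbv : ∀ i, bv i = 0 := fun i => if hi : i ∈ I then hbI i hi else hbIc i hi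
    have hq'0 : q' = 0 := by simp [q', hbv]
    have hx'0 : x' = 0 := by simp [x', hbv]
    have hw' : ∀ i, w' i = 0 := by
      intro i
      have h1 := hrow (Sum.inl (some i))
      have h2 : vec r (q0 * w' i) ∈ apolarSub r m α := by
        have : vec r (1 * (q' * (pI * Polynomial.X ^ (i:ℕ)) + q0 * w' i)) ∈ apolarSub r m α := h1
        rwa [hq'0, zero_mul, zero_add, one_mul] at this
      refine core3 h.1 hmu hv0 hβ hA hAR hI (w' i) (Wp_degree _) ((hmem _ ?_).1 h2)
      refine Polynomial.natDegree_mul_le.trans ?_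
      have : (w' i).natDegree ≤ n := Wp_natDegree (by omega) _
      omega
    have hbw : ∀ i t, b (some (Sum.inr (Sum.inl (i, t)))) = 0 := fun i t => congrFun (Wp_eq_zero (hw' i)) t
    have hbg : ∀ l t, b (some (Sum.inr (Sum.inr (l, t)))) = 0 := by
      intro l t
      have h1 := hrow (Sum.inr l)
      have h2 : g' l ∈ apolarSub r m α := h1
      rw [apolarSub_eq_ker, LinearMap.mem_ker, Matrix.mulVecLin_apply] at h2
      have h3 : ((Hank r m α).submatrix id s).mulVec (fun t => b (some (Sum.inr (Sum.inr (l, t))))) = 0 := by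
        rw [← h2]
        funext p
        have : (Hank r m α).mulVec (g' l) = ∑ t, b (some (Sum.inr (Sum.inr (l, t)))) • (Hank r m α).mulVec (Pi.single (s t) (1:ℂ)) := by
          simp only [← Matrix.mulVecLin_apply, g', map_sum, map_smul]
        rw [this, Finset.sum_apply]
        simp only [Matrix.mulVec_single_one, Pi.smul_apply, smul_eq_mul]
        conv_lhs => rw [Matrix.mulVec, dotProduct]
        refine Finset.sum_congr rfl fun i _ => ?_
        rw [mul_comm]; rfl
      exact congrFun (Matrix.eq_zero_of_mulVec_eq_zero hs h3) t
    have hb0 : b none = 0 := by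
      refine plucker_deriv_scalar hli0 hsum0 (ε.symm (Sum.inl none)) (b none) ?_ ?_
      · show chMat r ε _ _ _ _ _ = b none • chMat r ε _ _ _ _ _
        rw [chMat_symm, chMat_symm]
        show vec r X' = b none • vec r (Polynomial.C 1 * xP lam (fun i => - v0 i) (fun _ => 1))
        rw [← map_smul, Polynomial.smul_eq_C_mul]
        congr 1
        simp [X', hx'0]
      · intro i hi
        obtain ⟨i, rfl⟩ := ε.symm.surjective i
        show chMat r ε _ _ _ _ _ = 0
        rw [chMat_symm]
        rcases i with (_ | i) | l
        · exact absurd rfl hi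
        · show vec r _ = 0
          simp only [hq'0, hw', zero_mul, mul_zero, add_zero, map_zero]
        · show g' l = 0
          simp [g', hbg]
    funext x
    rcases x with _ | i | ⟨i, t⟩ | ⟨l, t⟩
    · exact hb0
    · exact hbv i
    · exact hbw i t
    · exact hbg l t

end

section
set_option linter.unusedSectionVars false

theorem plucker_mul {k N : ℕ} (A : Matrix (Fin k) (Fin k) ℂ) (M : Matrix (Fin k) (Fin N) ℂ) :
    plucker (A * M) = A.det • plucker M := by
  funext s
  show ((A * M).submatrix id s).det = A.det * (M.submatrix id s).det
  rw [← Matrix.det_mul]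
  rfl

theorem exists_mul_of_rows {k N : ℕ} {M' M : Matrix (Fin k) (Fin N) ℂ} (h : ∀ i, M' i ∈ rowSpan M) :
    ∃ A : Matrix (Fin k) (Fin k) ℂ, M' = A * M := by
  have h1 : ∀ i, ∃ c : Fin k → ℂ, ∑ l, c l • M l = M' i := fun i =>
    (Submodule.mem_span_range_iff_exists_fun ℂ).1 (h i)
  choose A hA using h1
  refine ⟨Matrix.of A, ?_⟩
  funext i l
  rw [← hA i, Finset.sum_apply, Matrix.mul_apply]
  rfl

/-- row scaling: if `M'` is independent and in the row span of `M` then `plucker M` is a multiple. -/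
theorem plucker_scale {k N : ℕ} {M' M : Matrix (Fin k) (Fin N) ℂ} (h : ∀ i, M' i ∈ rowSpan M)
    (hM' : LinearIndependent ℂ (fun i => M' i)) : ∃ c : ℂ, plucker M = c • plucker M' := by
  obtain ⟨A, rfl⟩ := exists_mul_of_rows h
  obtain ⟨s, hs⟩ := exists_minor_of_linInd _ hM'
  rw [plucker_mul] at hs ⊢
  have hA : A.det ≠ 0 := fun h0 => hs (by rw [h0, zero_smul]; rfl)
  exact ⟨A.det⁻¹, by rw [smul_smul, inv_mul_cancel₀ hA, one_smul]⟩

theorem linInd_of_degree {ι : Type} [Fintype ι] {r : ℕ} (f : ι → Fin (r+1) → ℂ) (D : ι → ℕ) (hD : Function.Injective D)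
    (h : ∀ i, (toP r (f i)).degree = (D i : WithBot ℕ)) : LinearIndependent ℂ f := by
  rw [Fintype.linearIndependent_iff]
  intro g hg i
  by_contra hi
  have h1 := Polynomial.degree_sum_eq_of_disjoint (fun i => g i • toP r (f i)) Finset.univ (by
    rintro a ⟨_, ha⟩ b ⟨_, hb⟩ hab
    have hga : g a ≠ 0 := fun h0 => ha (by simp [h0])
    have hgb : g b ≠ 0 := fun h0 => hb (by simp [h0])
    show ¬ _ = _
    simp only [Function.comp_apply]
    rw [Polynomial.degree_smul_of_smul_regular _ (IsSMulRegular.of_ne_zero hga),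
      Polynomial.degree_smul_of_smul_regular _ (IsSMulRegular.of_ne_zero hgb), h, h]
    intro h2
    exact hab (hD (by exact_mod_cast h2)))
  have h2 : ∑ i, g i • toP r (f i) = 0 := by
    simp only [← map_smul, ← map_sum]
    rw [hg, map_zero]
  rw [h2, Polynomial.degree_zero] at h1
  have h3 := Finset.le_sup (f := fun i => (g i • toP r (f i)).degree) (Finset.mem_univ i)
  rw [← h1, Polynomial.degree_smul_of_smul_regular _ (IsSMulRegular.of_ne_zero hi), h] at h3
  simp at h3

theorem exists_comb {ι : Type} [Fintype ι] [DecidableEq ι] (B : Matrix ι ι ℂ) (hB : B.det ≠ 0) (t : ι) :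
    ∃ c : ι → ℂ, ∀ l, ∑ o, c o * B o l = if t = l then 1 else 0 := by
  refine ⟨fun o => B⁻¹ t o, fun l => ?_⟩
  have := congrFun (congrFun (Matrix.nonsing_inv_mul B (isUnit_iff_ne_zero.2 hB)) t) l
  rw [Matrix.mul_apply, Matrix.one_apply] at this
  exact this

theorem Wp_coeff {m : ℕ} (c : Fin m → ℂ) (t : ℕ) : (Wp c).coeff t = if h : t < m then c ⟨t, h⟩ else 0 := by
  unfold Wp
  simp only [Polynomial.finsetSum_coeff, Polynomial.coeff_C_mul, Polynomial.coeff_X_pow]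
  split_ifs with h
  · rw [Finset.sum_eq_single ⟨t, h⟩]
    · simp
    · intro b _ hb
      rw [if_neg (fun h0 => hb (Fin.ext h0.symm)), mul_zero]
    · simp
  · refine Finset.sum_eq_zero fun b _ => ?_
    rw [if_neg (by have := b.2; omega), mul_zero]

theorem lin_scale {u v : ℂ} (hv : v ≠ 0) : lin u v = Polynomial.C v * lin (u / v) 1 := by
  unfold lin
  rw [mul_add, ← Polynomial.C_mul, mul_div_cancel₀ _ hv]
  simp

theorem xP_scale {n : ℕ} (lam : Fin n → ℕ) {u v : Fin n → ℂ} (hv : ∀ i, v i ≠ 0) :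
    ∃ κ : ℂ, κ ≠ 0 ∧ xP lam u v = Polynomial.C κ * xP lam (fun i => u i / v i) (fun _ => 1) := by
  refine ⟨∏ i, v i ^ lam i, Finset.prod_ne_zero_iff.2 fun i _ => pow_ne_zero _ (hv i), ?_⟩
  unfold xP
  rw [map_prod, ← Finset.prod_mul_distrib]
  refine Finset.prod_congr rfl fun i _ => ?_
  rw [lin_scale (hv i), mul_pow, Polynomial.C_pow]

def cD1 (m j : ℕ) : Option (Fin j) → ℕ
  | none => m + j
  | some i => m + i

def cD2 (m r : ℕ) {j c : ℕ} : Option (Fin j) ⊕ Fin c → ℕ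
  | Sum.inl none => r
  | Sum.inl (some i) => r - j + i
  | Sum.inr l => m + 1 + l

theorem cD2_inj {m r j c : ℕ} (hj : j ≤ r) (hr : m + 1 + c + j ≤ r) : Function.Injective (cD2 m r : Option (Fin j) ⊕ Fin c → ℕ) := by
  rintro ((_ | a) | a) ((_ | b) | b) hab
  all_goals simp only [cD2] at hab
  · rfl
  · exfalso; have := b.2; omega
  · exfalso; have := b.2; omega
  · exfalso; have := a.2; omega
  · congr 2; exact Fin.ext (by omega)
  · exfalso; have := a.2; have := b.2; omega
  · exfalso; have := a.2; omega
  · exfalso; have := a.2; have := b.2; omega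
  · congr 1; exact Fin.ext (by omega)

/-- the normal form family -/
def stdM (r : ℕ) {n j m c k : ℕ} (lam : Fin n → ℕ) (ε : Fin k ≃ Option (Fin j) ⊕ Fin c) (hr : m + 1 + c ≤ r) (a : PT n j m c → ℂ) :
    Matrix (Fin k) (Fin (r+1)) ℂ :=
  famM r lam (Polynomial.X ^ m) (fun l => Pi.single ⟨m + 1 + l, by omega⟩ 1) (fun b => ⟨b, by omega⟩) ε a

/-- the key normalisation -/
theorem norm_form {r n j m c k : ℕ} {lam : Fin n → ℕ} (h : isPartitionOf r n lam)
    (hn : n = m + j) (hc : 1 + j + c = k) (hk : k + m = r) (hr : m + 1 + c ≤ r) (hnr : n ≤ r)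
    (ε : Fin k ≃ Option (Fin j) ⊕ Fin c) (u v : Fin n → ℂ) (w : Fin j → Polynomial ℂ) (hw : ∀ i, (w i).natDegree ≤ n)
    (g : Fin c → Fin (r+1) → ℂ) (hv : ∀ i, v i ≠ 0)
    (h1 : (Matrix.of fun o o' : Option (Fin j) => (o.elim (∏ i, lin (u i) (v i)) w).coeff (cD1 m j o')).det ≠ 0)
    (h2 : (Matrix.of fun o o' : Option (Fin j) ⊕ Fin c => (toP r (chRow r (xP lam u v) (qP lam u v) w g o)).coeff (cD2 m r o')).det ≠ 0) (τ : ℂ) :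
    ∃ a : PT n j m c → ℂ, (∀ i, a (some (Sum.inl i)) = - (u i / v i)) ∧
      τ • plucker (chMat r ε (xP lam u v) (qP lam u v) w g) = plucker (stdM r lam ε hr a) := by
  obtain ⟨κ, hκ, hx⟩ := xP_scale lam (u := u) hv
  obtain ⟨κ', hκ', hq⟩ := xP_scale (fun i => lam i - 1) (u := u) hv
  set L := rowSpan (chMat r ε (xP lam u v) (qP lam u v) w g) with hL
  have hLm : ∀ o, chRow r (xP lam u v) (qP lam u v) w g o ∈ L := by
    intro o
    rw [hL, chMat_rowSpan]
    exact Submodule.subset_span ⟨o, rfl⟩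
  set ρ : Fin n → ℂ := fun i => u i / v i with hρ
  -- the middle rows
  have hmid : ∀ i : Fin j, ∃ cf : Fin m → ℂ, vec r (qP lam ρ (fun _ => 1) * (Polynomial.X ^ m * Polynomial.X ^ (i:ℕ) + Wp cf)) ∈ L := by
    intro i
    obtain ⟨e, he⟩ := exists_comb _ h1 (some i)
    set p := ∑ o, e o • (o.elim (∏ i, lin (u i) (v i)) w : Polynomial ℂ) with hp
    have hpd : p.natDegree ≤ n := by
      refine Polynomial.natDegree_sum_le_of_forall_le _ _ fun o _ => (Polynomial.natDegree_smul_le _ _).trans ?_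
      cases o with
      | none => simpa using natDegree_prod_lin Finset.univ u v
      | some i => exact hw i
    have hpc : ∀ o', p.coeff (cD1 m j o') = if some i = o' then 1 else 0 := by
      intro o'
      rw [hp, Polynomial.finsetSum_coeff, ← he o']
      refine Finset.sum_congr rfl fun o _ => ?_
      rw [Polynomial.coeff_smul, smul_eq_mul]; rfl
    refine ⟨fun b => p.coeff b, ?_⟩
    have hpe : Polynomial.X ^ m * Polynomial.X ^ (i:ℕ) + Wp (fun b : Fin m => p.coeff b) = p := by
      ext t
      rw [Polynomial.coeff_add, ← pow_add, Polynomial.coeff_X_pow, Wp_coeff]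
      by_cases ht : t < m
      · rw [dif_pos ht, if_neg (by omega), zero_add]
      rw [dif_neg ht, add_zero]
      by_cases ht2 : t = n
      · have := hpc none
        rw [show cD1 m j none = t from (ht2.trans hn).symm] at this
        rw [this, if_neg (by have := i.2; omega), if_neg (by simp)]
      by_cases ht3 : n < t
      · rw [Polynomial.coeff_eq_zero_of_natDegree_lt (by omega), if_neg (by have := i.2; omega)]
      have := hpc (some ⟨t - m, by omega⟩)
      rw [show cD1 m j (some ⟨t - m, by omega⟩) = t from by simp only [cD1]; omega] at this
      rw [this]
      refine if_congr ?_ rfl rfl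
      simp only [Option.some.injEq, Fin.ext_iff]
      omega
    rw [hpe]
    have : vec r (qP lam ρ (fun _ => 1) * p) = κ'⁻¹ • ∑ o, e o • chRow r (xP lam u v) (qP lam u v) w g (Sum.inl o) := by
      have hqq : qP lam ρ (fun _ => 1) = Polynomial.C κ'⁻¹ * qP lam u v := by
        unfold qP
        rw [hq, ← mul_assoc, ← Polynomial.C_mul, inv_mul_cancel₀ hκ', map_one, one_mul]
      rw [hqq, mul_assoc, ← Polynomial.smul_eq_C_mul, map_smul, hp, Finset.mul_sum, map_sum]
      congr 1
      refine Finset.sum_congr rfl fun o _ => ?_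
      rw [mul_smul_comm, map_smul]
      cases o with
      | none => show _ = _ • vec r (xP lam u v); rw [xP_eq_q_mul h.1]; rfl
      | some i => rfl
    rw [this]
    exact Submodule.smul_mem _ _ (Submodule.sum_mem _ fun o _ => Submodule.smul_mem _ _ (hLm _))
  choose cf hcf using hmid
  have hlast : ∀ l : Fin c, ∃ cg : Fin (m+1) → ℂ, ((Pi.single ⟨m + 1 + l, by omega⟩ 1 : Fin (r+1) → ℂ) + ∑ b : Fin (m+1), cg b • Pi.single (⟨b, by omega⟩ : Fin (r+1)) (1:ℂ)) ∈ L := by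
    intro l
    obtain ⟨e, he⟩ := exists_comb _ h2 (Sum.inr l)
    set y := ∑ o, e o • chRow r (xP lam u v) (qP lam u v) w g o with hy
    have hyc : ∀ o' : Option (Fin j) ⊕ Fin c, (toP r y).coeff (cD2 m r o') = if Sum.inr l = o' then 1 else 0 := by
      intro o'
      rw [hy, map_sum, Polynomial.finsetSum_coeff, ← he o']
      refine Finset.sum_congr rfl fun o _ => ?_
      rw [map_smul, Polynomial.coeff_smul, smul_eq_mul]; rfl
    refine ⟨fun b => y ⟨b, by omega⟩, ?_⟩
    have hye : ((Pi.single ⟨m + 1 + l, by omega⟩ 1 : Fin (r+1) → ℂ) + ∑ b : Fin (m+1), y ⟨b, by omega⟩ • Pi.single (⟨b, by omega⟩ : Fin (r+1)) (1:ℂ)) = y := by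
      funext t
      obtain ⟨t, ht⟩ := t
      simp only [Pi.add_apply, Finset.sum_apply, Pi.smul_apply, smul_eq_mul, Pi.single_apply, Fin.mk.injEq]
      have key : ∀ o' : Option (Fin j) ⊕ Fin c, cD2 m r o' = t → y ⟨t, ht⟩ = if Sum.inr l = o' then 1 else 0 := by
        intro o' ho
        rw [← hyc o', ho, coeff_toP, dif_pos ht]
      by_cases ht1 : t < m + 1
      · rw [if_neg (by omega), zero_add, Finset.sum_eq_single ⟨t, ht1⟩]
        · simp
        · intro b _ hb
          rw [if_neg (fun h0 => hb (Fin.ext h0.symm)), mul_zero]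
        · simp
      · rw [Finset.sum_eq_zero (fun b _ => by rw [if_neg (by have := b.2; omega), mul_zero]), add_zero]
        by_cases ht2 : t < m + 1 + c
        · rw [key (Sum.inr ⟨t - (m+1), by omega⟩) (by simp only [cD2]; omega)]
          refine if_congr ?_ rfl rfl
          simp only [Sum.inr.injEq, Fin.ext_iff]
          omega
        · rw [if_neg (by have := l.2; omega)]
          by_cases ht3 : t = r
          · rw [key (Sum.inl none) (by simp only [cD2]; omega)]; simp
          · rw [key (Sum.inl (some ⟨t - (r - j), by omega⟩)) (by simp only [cD2]; omega)]; simp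
    rw [hye]
    exact Submodule.sum_mem _ fun o _ => Submodule.smul_mem _ _ (hLm _)
  choose cg hcg using hlast
  let A : ℂ → PT n j m c → ℂ := fun σ o => match o with
    | none => σ
    | some (Sum.inl i) => - ρ i
    | some (Sum.inr (Sum.inl (i, b))) => cf i b
    | some (Sum.inr (Sum.inr (l, b))) => cg l b
  have hrow : ∀ σ, stdM r lam ε hr (A σ) = chMat r ε (Polynomial.C σ * xP lam ρ (fun _ => 1)) (qP lam ρ (fun _ => 1))
      (fun i => Polynomial.X ^ m * Polynomial.X ^ (i:ℕ) + Wp (cf i))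
      (fun l => (Pi.single ⟨m + 1 + l, by omega⟩ 1 : Fin (r+1) → ℂ) + ∑ b : Fin (m+1), cg l b • Pi.single (⟨b, by omega⟩ : Fin (r+1)) (1:ℂ)) := by
    intro σ
    unfold stdM famM
    simp only [A, neg_neg]
  have hmemL : ∀ i, stdM r lam ε hr (A 1) i ∈ L := by
    intro i
    rw [hrow, chMat_apply]
    rcases ε i with (_ | t) | t
    · show vec r _ ∈ L
      have h3 := hLm (Sum.inl none)
      have h4 : vec r (Polynomial.C 1 * xP lam ρ (fun _ => 1)) = κ⁻¹ • vec r (xP lam u v) := by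
        rw [hx, ← Polynomial.smul_eq_C_mul, ← Polynomial.smul_eq_C_mul, map_smul, map_smul, smul_smul, inv_mul_cancel₀ hκ]
      rw [h4]
      exact Submodule.smul_mem _ _ h3
    · exact hcf t
    · exact hcg t
  have hqd : (qP lam ρ (fun _ => 1)).natDegree = r - n := by
    have := sum_pred h
    unfold qP
    rw [natDegree_xP_one]; omega
  have hli : LinearIndependent ℂ (fun i => stdM r lam ε hr (A 1) i) := by
    rw [hrow, chMat_linInd]
    refine linInd_of_degree _ (cD2 m r) ?_ ?_
    · exact cD2_inj (by omega) (by omega)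
    · have hmon : ∀ (p : Polynomial ℂ) (D : ℕ), p.Monic → p.natDegree = D → D ≤ r → (toP r (vec r p)).degree = (D : WithBot ℕ) := by
        intro p D hp hD hr
        rw [toP_vec (by omega), Polynomial.degree_eq_natDegree hp.ne_zero, hD]
      rintro ((_ | i) | l)
      · refine hmon _ r ?_ ?_ le_rfl
        · rw [map_one, one_mul]; exact xP_monic _ _
        · rw [map_one, one_mul, natDegree_xP_one, h.2]
      · have hm2 : (Polynomial.X ^ m * Polynomial.X ^ (i:ℕ) + Wp (cf i)).degree = ((m + i : ℕ) : WithBot ℕ) ∧ (Polynomial.X ^ m * Polynomial.X ^ (i:ℕ) + Wp (cf i)).Monic := by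
          have hlt : (Wp (cf i)).degree < (Polynomial.X ^ (m + (i:ℕ)) : Polynomial ℂ).degree := by
            rw [Polynomial.degree_X_pow]
            exact (Wp_degree _).trans_le (by exact_mod_cast Nat.le_add_right m i)
          rw [← pow_add]
          exact ⟨by rw [Polynomial.degree_add_eq_left_of_degree_lt hlt, Polynomial.degree_X_pow],
            (Polynomial.monic_X_pow _).add_of_left hlt⟩
        refine hmon _ _ ((xP_monic _ _).mul hm2.2) ?_ ?_
        · refine (Polynomial.Monic.natDegree_mul (xP_monic _ _) hm2.2).trans ?_
          have : (xP (fun i => lam i - 1) ρ (fun _ => 1)).natDegree = r - n := hqd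
          rw [Polynomial.natDegree_eq_of_degree_eq_some hm2.1, this]
          simp only [cD2]; omega
        · have := i.2; simp only [cD2]; omega
      · show (toP r (_ + _)).degree = ((m + 1 + l : ℕ) : WithBot ℕ)
        refine Polynomial.degree_eq_of_le_of_coeff_ne_zero ?_ ?_
        · rw [Polynomial.degree_le_iff_coeff_zero]
          intro t ht
          have ht' : m + 1 + (l:ℕ) < t := by exact_mod_cast ht
          rw [coeff_toP]
          split_ifs with htr
          · simp only [Pi.add_apply, Finset.sum_apply, Pi.smul_apply, smul_eq_mul, Pi.single_apply, Fin.mk.injEq]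
            rw [if_neg (by omega), zero_add]
            exact Finset.sum_eq_zero (fun b _ => by rw [if_neg (by have := b.2; omega), mul_zero])
          · rfl
        · rw [coeff_toP, dif_pos (by omega)]
          simp only [Pi.add_apply, Finset.sum_apply, Pi.smul_apply, smul_eq_mul, Pi.single_apply, Fin.mk.injEq]
          rw [if_pos trivial, Finset.sum_eq_zero (fun b _ => by rw [if_neg (by have := b.2; omega), mul_zero])]
          simp
  obtain ⟨σ, hσ⟩ := plucker_scale hmemL hli
  refine ⟨A (τ * σ), fun i => rfl, ?_⟩
  rw [hσ, smul_smul]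
  have hA : stdM r lam ε hr (A (τ * σ)) = Matrix.diagonal (fun i => if ε i = Sum.inl none then τ * σ else 1) * stdM r lam ε hr (A 1) := by
    funext i l
    rw [Matrix.diagonal_mul, hrow, hrow, chMat_apply, chMat_apply]
    rcases ε i with (_ | t) | t
    · simp only [chRow, if_true, map_one, one_mul, ← Polynomial.smul_eq_C_mul, map_smul, Pi.smul_apply, smul_eq_mul]
    · simp [chRow]
    · simp [chRow]
  rw [hA, plucker_mul, Matrix.det_diagonal]
  congr 1
  rw [← ε.symm.prod_comp, Fintype.prod_sum_type, Fintype.prod_option]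
  simp

end

section
set_option linter.unusedSectionVars false

abbrev PZ (n j m c : ℕ) (Z : Finset (Fin n)) : Type := {o : PT n j m c // ∀ i ∈ Z, o ≠ some (Sum.inl i)}

open Classical in
def extZ {n j m c : ℕ} (Z : Finset (Fin n)) (a : PZ n j m c Z → ℂ) (o : PT n j m c) : ℂ :=
  if h : ∀ i ∈ Z, o ≠ some (Sum.inl i) then a ⟨o, h⟩ else 0

open Classical in
theorem extZ_restrict {n j m c : ℕ} (Z : Finset (Fin n)) (a : PT n j m c → ℂ) (ha : ∀ i ∈ Z, a (some (Sum.inl i)) = 0) :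
    extZ Z (fun o => a o.1) = a := by
  funext o
  unfold extZ
  split_ifs with h
  · rfl
  · push Not at h
    obtain ⟨i, hi, rfl⟩ := h
    exact (ha i hi).symm

open Classical in
theorem extZ_polyFn {n j m c : ℕ} (Z : Finset (Fin n)) (o : PT n j m c) : PolyFn fun a => extZ Z a o := by
  unfold extZ
  split_ifs with h
  · exact PolyFn.coord _
  · exact PolyFn.const _

abbrev FT (n j c r : ℕ) : Type := Unit ⊕ ((Fin n ⊕ Fin n) ⊕ ((Fin j × Fin (n+1)) ⊕ (Fin c × Fin (r+1))))

theorem ch_closure {r n j m c k : ℕ} {lam : Fin n → ℕ} (h : isPartitionOf r n lam)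
    (hn : n = m + j) (hc : 1 + j + c = k) (hk : k + m = r) (hr : m + 1 + c ≤ r) (hnr : n ≤ r)
    (ε : Fin k ≃ Option (Fin j) ⊕ Fin c) (Z : Finset (Fin n)) (u v : Fin n → ℂ) (hZ : ∀ i ∈ Z, u i = 0)
    (w : Fin j → Polynomial ℂ) (hw : ∀ i, (w i).natDegree ≤ n)
    (g : Fin c → Fin (r+1) → ℂ) (τ : ℂ) :
    τ • plucker (chMat r ε (xP lam u v) (qP lam u v) w g) ∈
      zClosure (Set.range fun a : PZ n j m c Z → ℂ => plucker (stdM r lam ε hr (extZ Z a))) := by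
  intro P hP
  let U : (FT n j c r → ℂ) → Fin n → ℂ := fun a i => if i ∈ Z then 0 else a (Sum.inr (Sum.inl (Sum.inl i)))
  let V : (FT n j c r → ℂ) → Fin n → ℂ := fun a i => a (Sum.inr (Sum.inl (Sum.inr i)))
  let W : (FT n j c r → ℂ) → Fin j → Polynomial ℂ := fun a i => Wp fun b => a (Sum.inr (Sum.inr (Sum.inl (i, b))))
  let G : (FT n j c r → ℂ) → Fin c → Fin (r+1) → ℂ := fun a i b => a (Sum.inr (Sum.inr (Sum.inr (i, b))))
  have hU : ∀ i, PolyFn fun a => U a i := by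
    intro i
    simp only [U]
    split_ifs
    · exact PolyFn.const _
    · exact PolyFn.coord _
  have hV : ∀ i, PolyFn fun a => V a i := fun i => PolyFn.coord _
  have hW : ∀ i, PolyFnP fun a => W a i := fun i => PolyFnP.Wp fun b => PolyFn.coord _
  have hG : ∀ i l, PolyFn fun a => G a i l := fun i l => PolyFn.coord _
  have hWd : ∀ a i, (W a i).natDegree ≤ n := by
    intro a i
    have := Wp_degree (fun b => a (Sum.inr (Sum.inr (Sum.inl (i, b)))) : Fin (n+1) → ℂ)
    by_cases h0 : W a i = 0
    · rw [h0]; simp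
    · have := (Polynomial.natDegree_lt_iff_degree_lt h0).2 this
      omega
  let N : (FT n j c r → ℂ) → Matrix (Fin k) (Fin (r+1)) ℂ := fun a => chMat r ε (xP lam (U a) (V a)) (qP lam (U a) (V a)) (W a) (G a)
  have hN : ∀ i l, PolyFn fun a => N a i l := chMat_polyFn r ε (PolyFnP.xP lam hU hV) (PolyFnP.qP lam hU hV) hW hG
  let f : (FT n j c r → ℂ) → ℂ := fun a => eval (a (Sum.inl ()) • plucker (N a)) P
  have hf : PolyFn f := (PolyFn.eval_poly P).comp (φ := fun a => a (Sum.inl ()) • plucker (N a)) fun s => by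
    simp only [Pi.smul_apply, smul_eq_mul]
    exact (PolyFn.coord _).mul (plucker_polyFn hN s)
  let D1 : (FT n j c r → ℂ) → ℂ := fun a => (Matrix.of fun o o' : Option (Fin j) => (o.elim (∏ i, lin (U a i) (V a i)) (W a)).coeff (cD1 m j o')).det
  let D2 : (FT n j c r → ℂ) → ℂ := fun a => (Matrix.of fun o o' : Option (Fin j) ⊕ Fin c => (toP r (chRow r (xP lam (U a) (V a)) (qP lam (U a) (V a)) (W a) (G a) o)).coeff (cD2 m r o')).det
  let D0 : (FT n j c r → ℂ) → ℂ := fun a => ∏ i, V a i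
  have hD1 : PolyFn D1 := by
    refine PolyFn.det fun o o' => ?_
    cases o with
    | none => exact PolyFnP.prod (F := fun i a => lin (U a i) (V a i)) Finset.univ (fun i _ => PolyFnP.lin (hU i) (hV i)) (cD1 m j o')
    | some i => exact hW i _
  have hrw : ∀ (a : FT n j c r → ℂ) o, chRow r (xP lam (U a) (V a)) (qP lam (U a) (V a)) (W a) (G a) o = N a (ε.symm o) := by
    intro a o
    exact (chMat_symm r ε _ _ _ _ o).symm
  have hD2 : PolyFn D2 := by
    refine PolyFn.det fun o o' => ?_
    simp only [Matrix.of_apply, coeff_toP, hrw]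
    split_ifs
    · exact hN _ _
    · exact PolyFn.const _
  have hD0 : PolyFn D0 := PolyFn.prod _ fun i _ => hV i
  have hD := (hD0.mul hD1).mul hD2
  have main : ∀ a, f a = 0 := by
    refine hf.cancel hD ?_ ?_
    · intro a
      by_cases hDa : D0 a * D1 a * D2 a = 0
      · exact Or.inr hDa
      left
      have h2 := right_ne_zero_of_mul hDa
      have h01 := left_ne_zero_of_mul hDa
      have h1 := right_ne_zero_of_mul h01
      have h0 := left_ne_zero_of_mul h01
      have hv : ∀ i, V a i ≠ 0 := fun i => Finset.prod_ne_zero_iff.1 h0 i (Finset.mem_univ i)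
      obtain ⟨b, hb, hb2⟩ := norm_form h hn hc hk hr hnr ε (U a) (V a) (W a) (hWd a) (G a) hv h1 h2 (a (Sum.inl ()))
      show eval (a (Sum.inl ()) • plucker (N a)) P = 0
      have : a (Sum.inl ()) • plucker (N a) = plucker (stdM r lam ε hr b) := hb2
      rw [this]
      refine hP _ ⟨fun o => b o.1, ?_⟩
      show plucker (stdM r lam ε hr (extZ Z _)) = _
      rw [extZ_restrict]
      intro i hi
      rw [hb]
      simp [U, hi]
    · let a0 : FT n j c r → ℂ := fun o => match o with
        | Sum.inl _ => 0
        | Sum.inr (Sum.inl (Sum.inl _)) => 0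
        | Sum.inr (Sum.inl (Sum.inr _)) => 1
        | Sum.inr (Sum.inr (Sum.inl (i, b))) => if m + (i:ℕ) = b then 1 else 0
        | Sum.inr (Sum.inr (Sum.inr (l, b))) => if m + 1 + (l:ℕ) = b then 1 else 0
      have hlin : ∀ i, lin (U a0 i) (V a0 i) = Polynomial.X := by
        intro i
        have : U a0 i = 0 := by simp only [U]; split_ifs <;> rfl
        rw [this]
        show lin 0 1 = _
        simp [lin]
      have hw0 : ∀ i, W a0 i = Polynomial.X ^ (m + (i:ℕ)) := by
        intro i
        ext t
        simp only [W, Wp_coeff, Polynomial.coeff_X_pow, a0]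
        have := i.2
        split_ifs <;> first | rfl | (exfalso; omega)
      have hq0 : qP lam (U a0) (V a0) = Polynomial.X ^ (r - n) := by
        unfold qP xP
        simp only [hlin]
        rw [Finset.prod_pow_eq_pow_sum]
        congr 1
        have := sum_pred h; omega
      have hx0 : xP lam (U a0) (V a0) = Polynomial.X ^ r := by
        unfold xP
        simp only [hlin]
        rw [Finset.prod_pow_eq_pow_sum, h.2]
      have e1 : D1 a0 = 1 := by
        have : (Matrix.of fun o o' : Option (Fin j) => (o.elim (∏ i, lin (U a0 i) (V a0 i)) (W a0)).coeff (cD1 m j o')) = 1 := by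
          funext o o'
          rw [Matrix.of_apply, Matrix.one_apply]
          simp only [hlin]
          rcases o with _ | o <;> rcases o' with _ | o' <;>
            simp only [Option.elim_none, Option.elim_some, hw0, Finset.prod_const, Finset.card_univ, Fintype.card_fin, Polynomial.coeff_X_pow, cD1]
          · rw [if_pos hn.symm]; simp
          · rw [if_neg (by have := o'.2; omega)]; simp
          · rw [if_neg (by have := o.2; omega)]; simp
          · refine if_congr ?_ rfl rfl
            simp only [Option.some.injEq, Fin.ext_iff]; omega
        simp only [D1, this, Matrix.det_one]
      have e2 : D2 a0 = 1 := by
        have : (Matrix.of fun o o' : Option (Fin j) ⊕ Fin c => (toP r (chRow r (xP lam (U a0) (V a0)) (qP lam (U a0) (V a0)) (W a0) (G a0) o)).coeff (cD2 m r o')) = 1 := by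
          funext o o'
          rw [Matrix.of_apply, Matrix.one_apply, coeff_toP]
          have hlt : cD2 m r o' < r + 1 := by
            rcases o' with (_ | o') | o'
            · simp only [cD2]; omega
            · have := o'.2; simp only [cD2]; omega
            · have := o'.2; simp only [cD2]; omega
          rw [dif_pos hlt]
          have key : ∀ X : ℕ, X = cD2 m r o → ((if cD2 m r o' = X then 1 else 0) : ℂ) = if o = o' then 1 else 0 := by
            rintro X rfl
            exact if_congr ⟨fun h0 => (cD2_inj (by omega) (by omega) h0).symm, fun h0 => by rw [h0]⟩ rfl rfl
          rcases o with (_ | o) | o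
          · show (xP lam (U a0) (V a0)).coeff (cD2 m r o') = _
            rw [hx0, Polynomial.coeff_X_pow]
            exact key _ rfl
          · show (qP lam (U a0) (V a0) * W a0 o).coeff (cD2 m r o') = _
            rw [hq0, hw0, ← pow_add, Polynomial.coeff_X_pow]
            refine key _ ?_
            simp only [cD2]; omega
          · rw [← key _ rfl]
            show (if m + 1 + (o:ℕ) = cD2 m r o' then (1:ℂ) else 0) = _
            exact if_congr eq_comm rfl rfl
        simp only [D2, this, Matrix.det_one]
      have e0 : D0 a0 = 1 := by simp [D0, V, a0]
      exact ⟨a0, by rw [e0, e1, e2]; norm_num⟩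
  let a : FT n j c r → ℂ := fun o => match o with
    | Sum.inl _ => τ
    | Sum.inr (Sum.inl (Sum.inl i)) => u i
    | Sum.inr (Sum.inl (Sum.inr i)) => v i
    | Sum.inr (Sum.inr (Sum.inl (i, b))) => (w i).coeff b
    | Sum.inr (Sum.inr (Sum.inr (l, b))) => g l b
  have hUa : U a = u := by
    funext i
    simp only [U]
    split_ifs with hi
    · exact (hZ i hi).symm
    · rfl
  have hWa : W a = w := by
    funext i
    ext t
    simp only [W, Wp_coeff, a]
    split_ifs with ht
    · rfl
    · rw [Polynomial.coeff_eq_zero_of_natDegree_lt]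
      have := hw i; omega
  have := main a
  simp only [f, N, hUa, hWa] at this
  exact this

theorem card_PZ {n j m c k : ℕ} (hn : n = m + j) (hk : 1 + j + c = k) (Z : Finset (Fin n)) :
    Fintype.card (PZ n j m c Z) + Z.card = k * (m+1) := by
  classical
  rw [← card_PT hn hk]
  have h1 := Fintype.card_subtype_compl (fun o : PT n j m c => ∃ i ∈ Z, o = some (Sum.inl i))
  have h2 : Fintype.card {o : PT n j m c // ∃ i ∈ Z, o = some (Sum.inl i)} = Z.card := by
    rw [Fintype.card_subtype, ← Finset.card_image_of_injective Z (f := fun i => (some (Sum.inl i) : PT n j m c)) (by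
      intro a b hab; simpa using hab)]
    congr 1
    ext o
    simp only [Finset.mem_filter, Finset.mem_univ, true_and, Finset.mem_image, eq_comm]
  have h3 : Fintype.card (PZ n j m c Z) = Fintype.card {o : PT n j m c // ¬ ∃ i ∈ Z, o = some (Sum.inl i)} := by
    refine Fintype.card_congr (Equiv.subtypeEquivRight fun o => ?_)
    push Not
    rfl
  have h4 := Fintype.card_subtype_le (fun o : PT n j m c => ∃ i ∈ Z, o = some (Sum.inl i))
  omega

end

section
set_option linter.unusedSectionVars false

/-- `L` meets the appropriate osculating data of the point with linear forms `u, v`. -/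
def goodFor (r n j : ℕ) (lam : Fin n → ℕ) (L : Submodule ℂ (Fin (r+1) → ℂ)) (u v : Fin n → ℂ) : Prop :=
  (∀ i, u i ≠ 0 ∨ v i ≠ 0) ∧ vec r (xP lam u v) ∈ L ∧ j + 1 ≤ Module.finrank ℂ ↥(L ⊓ qSub r n (qP lam u v))

theorem ch_data {r n j k : ℕ} {lam : Fin n → ℕ} (h : isPartitionOf r n lam) (hn0 : 0 < n) {p : (Fin k → Fin (r+1)) → ℂ}
    (hp : p ∈ smoothCHCone r (crlCone r n lam) (n+1) k j) :
    ∃ M : Matrix (Fin k) (Fin (r+1)) ℂ, p = plucker M ∧ Module.finrank ℂ (rowSpan M) = k ∧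
      ∃ u v, goodFor r n j lam (rowSpan M) u v := by
  obtain ⟨M, hpM, hM, x, hx0, hxS, hdim, hxL, hj⟩ := hp
  obtain ⟨t, u, v, rfl⟩ := (mem_crl_iff h x).1 hxS
  unfold zTangentDim at hdim
  rw [span_tan] at hj hdim
  rw [tan_eq_qSub h hn0 hx0 hdim.le] at hj
  have ht : t ≠ 0 := by
    rintro rfl; apply hx0; simp
  refine ⟨M, hpM, hM, u, v, ?_, ?_, hj⟩
  · intro i
    by_contra! hcon
    apply hx0
    have : xP lam u v = 0 := by
      refine Finset.prod_eq_zero (Finset.mem_univ i) ?_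
      rw [hcon.1, hcon.2]
      have : lin 0 0 = 0 := by simp [lin]
      rw [this, zero_pow (by have := h.1 i; omega)]
    rw [this, mul_zero, map_zero]
  · rw [← Polynomial.smul_eq_C_mul, map_smul] at hxL
    have := Submodule.smul_mem _ t⁻¹ hxL
    rwa [smul_smul, inv_mul_cancel₀ ht, one_smul] at this

theorem factor_lin {α : Type} [DecidableEq α] (T : Finset α) (g : Polynomial ℂ) (hg : g ≠ 0) (hd : g.natDegree ≤ T.card) :
    ∃ (t : ℂ) (u v : α → ℂ), t ≠ 0 ∧ (∀ i, u i ≠ 0 ∨ v i ≠ 0) ∧ g = Polynomial.C t * ∏ i ∈ T, lin (u i) (v i) := by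
  induction T using Finset.induction_on generalizing g with
  | empty =>
    have := Polynomial.eq_C_of_natDegree_eq_zero (Nat.le_zero.1 hd)
    refine ⟨g.coeff 0, fun _ => 1, fun _ => 1, ?_, by simp, by simpa using this⟩
    intro h0
    rw [h0, map_zero] at this
    exact hg this
  | insert i T hi ih =>
    rw [Finset.card_insert_of_notMem hi] at hd
    have aux : ∀ (g' : Polynomial ℂ) (a b : ℂ), (a ≠ 0 ∨ b ≠ 0) → g = lin a b * g' → g'.natDegree ≤ T.card →
        ∃ (t : ℂ) (u v : α → ℂ), t ≠ 0 ∧ (∀ i, u i ≠ 0 ∨ v i ≠ 0) ∧ g = Polynomial.C t * ∏ i ∈ insert i T, lin (u i) (v i) := by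
      intro g' a b hab hgg hd'
      obtain ⟨t, u, v, ht, huv, he⟩ := ih g' (by rintro rfl; exact hg (by simpa using hgg)) hd'
      refine ⟨t, Function.update u i a, Function.update v i b, ht, ?_, ?_⟩
      · intro l
        by_cases hl : l = i
        · subst hl; simpa using hab
        · simpa [hl] using huv l
      · rw [Finset.prod_insert hi, hgg, he, Function.update_self, Function.update_self]
        have : ∏ x ∈ T, lin (Function.update u i a x) (Function.update v i b x) = ∏ x ∈ T, lin (u x) (v x) := by
          refine Finset.prod_congr rfl fun x hx => ?_
          have : x ≠ i := by rintro rfl; exact hi hx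
          simp [this]
        rw [this]; ring
    by_cases hd2 : g.natDegree ≤ T.card
    · exact aux g 1 0 (by simp) (by simp [lin]) hd2
    · obtain ⟨a, ha⟩ := IsAlgClosed.exists_root g (by
        rw [Polynomial.degree_eq_natDegree hg]; intro h0
        have : g.natDegree = 0 := by exact_mod_cast h0
        omega)
      obtain ⟨g', rfl⟩ := Polynomial.dvd_iff_isRoot.2 ha
      refine aux g' (-a) 1 (by simp) ?_ ?_
      · congr 1
        simp [lin]; ring
      · rw [Polynomial.natDegree_mul (left_ne_zero_of_mul hg) (right_ne_zero_of_mul hg), Polynomial.natDegree_X_sub_C] at hd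
        omega

theorem ch_fix {r n j : ℕ} {lam : Fin n → ℕ} (h : isPartitionOf r n lam) (hnr : n ≤ r) (hB : n < j + multOf lam 1)
    (i0 : Fin n) (hi0 : lam i0 = 1) {L : Submodule ℂ (Fin (r+1) → ℂ)} {u v : Fin n → ℂ} (hL : goodFor r n j lam L u v) :
    ∃ u' v', u' i0 = 0 ∧ goodFor r n j lam L u' v' := by
  obtain ⟨huv, hx, hj⟩ := hL
  set q := qP lam u v with hq
  set T := (Finset.univ.erase i0).filter (fun i => lam i = 1) with hT
  set K := (Finset.univ.erase i0).filter (fun i => ¬ lam i = 1) with hK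
  have hTK : T.card + K.card + 1 = n := by
    rw [hT, hK, Finset.card_filter_add_card_filter_not, Finset.card_erase_of_mem (Finset.mem_univ _)]
    simp only [Finset.card_univ, Fintype.card_fin]
    have := i0.2; omega
  have hTc : T.card + 1 = multOf lam 1 := by
    unfold multOf
    rw [hT, Finset.filter_erase, Finset.card_erase_of_mem (by simp [hi0])]
    have : 0 < (Finset.univ.filter fun i => lam i = 1).card := Finset.card_pos.2 ⟨i0, by simp [hi0]⟩
    omega
  set P := ∏ i ∈ K, lin (u i) (v i) with hP
  have hPd : P.natDegree ≤ K.card := natDegree_prod_lin _ _ _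
  have hqd : q.natDegree ≤ r - n := natDegree_qP h u v
  have hq0 : q ≠ 0 := xP_ne_zero _ huv
  have hP0 : P ≠ 0 := Finset.prod_ne_zero_iff.2 fun i _ => lin_ne_zero (huv i)
  have hQd : (q * P * Polynomial.X).natDegree ≤ r - n + K.card + 1 := by
    refine Polynomial.natDegree_mul_le.trans ?_
    have := Polynomial.natDegree_mul_le (p := q) (q := P)
    rw [Polynomial.natDegree_X]; omega
  have hQ0 : q * P * Polynomial.X ≠ 0 := mul_ne_zero (mul_ne_zero hq0 hP0) Polynomial.X_ne_zero
  have hB' := finrank_qSub (r := r) (n := T.card) hQ0 hQd (by omega)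
  have hC' := finrank_qSub (r := r) (n := n) hq0 hqd (by omega)
  have hle : qSub r T.card (q * P * Polynomial.X) ≤ qSub r n q := by
    intro x hx
    obtain ⟨s, hs, rfl⟩ := mem_qSub.1 hx
    refine mem_qSub.2 ⟨P * Polynomial.X * s, ?_, by congr 1; ring⟩
    refine Polynomial.natDegree_mul_le.trans ?_
    have := Polynomial.natDegree_mul_le (p := P) (q := Polynomial.X)
    rw [Polynomial.natDegree_X] at this; omega
  have hsum := Submodule.finrank_sup_add_finrank_inf_eq (L ⊓ qSub r n q) (qSub r T.card (q * P * Polynomial.X))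
  have hsup : Module.finrank ℂ ↥((L ⊓ qSub r n q) ⊔ qSub r T.card (q * P * Polynomial.X)) ≤ n + 1 := by
    rw [← hC']
    exact Submodule.finrank_mono (sup_le inf_le_right hle)
  have hpos : 0 < Module.finrank ℂ ↥((L ⊓ qSub r n q) ⊓ qSub r T.card (q * P * Polynomial.X)) := by omega
  have hne : (L ⊓ qSub r n q) ⊓ qSub r T.card (q * P * Polynomial.X) ≠ ⊥ := by
    intro h0; rw [h0, finrank_bot] at hpos; omega
  obtain ⟨z, ⟨⟨hzL, _⟩, hzB⟩, hz0⟩ := Submodule.exists_mem_ne_zero_of_ne_bot hne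
  obtain ⟨g, hg, hgz⟩ := mem_qSub.1 hzB
  have hg0 : g ≠ 0 := by rintro rfl; apply hz0; rw [← hgz, mul_zero, map_zero]
  obtain ⟨t, a, b, ht, hab, he⟩ := factor_lin T g hg0 hg
  let u' : Fin n → ℂ := fun i => if i = i0 then 0 else if lam i = 1 then a i else u i
  let v' : Fin n → ℂ := fun i => if i = i0 then 1 else if lam i = 1 then b i else v i
  have hq' : qP lam u' v' = q := by
    rw [hq]
    unfold qP xP
    refine Finset.prod_congr rfl fun i _ => ?_
    by_cases hl : lam i = 1
    · simp [hl]
    · have : i ≠ i0 := by rintro rfl; exact hl hi0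
      simp [u', v', hl, this]
  have hx' : q * P * Polynomial.X * g = Polynomial.C t * xP lam u' v' := by
    rw [xP_eq_q_mul h.1, hq', ← Finset.mul_prod_erase Finset.univ (fun i => lin (u' i) (v' i)) (Finset.mem_univ i0),
      ← Finset.prod_filter_mul_prod_filter_not (Finset.univ.erase i0) (fun i => lam i = 1) (fun i => lin (u' i) (v' i)), he]
    have e1 : lin (u' i0) (v' i0) = Polynomial.X := by simp [u', v', lin]
    have e2 : ∏ i ∈ T, lin (u' i) (v' i) = ∏ i ∈ T, lin (a i) (b i) := by
      refine Finset.prod_congr rfl fun i hi => ?_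
      simp only [hT, Finset.mem_filter, Finset.mem_erase] at hi
      simp [u', v', hi.1.1, hi.2]
    have e3 : ∏ i ∈ K, lin (u' i) (v' i) = P := by
      refine Finset.prod_congr rfl fun i hi => ?_
      simp only [hK, Finset.mem_filter, Finset.mem_erase] at hi
      simp [u', v', hi.1.1, hi.2]
    rw [e1, e2, e3]; ring
  refine ⟨u', v', by simp [u'], ?_, ?_, ?_⟩
  · intro i
    simp only [u', v']
    split_ifs
    · exact Or.inr one_ne_zero
    · exact hab i
    · exact huv i
  · rw [← hgz, hx', ← Polynomial.smul_eq_C_mul, map_smul] at hzL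
    have := Submodule.smul_mem _ t⁻¹ hzL
    rwa [smul_smul, inv_mul_cancel₀ ht, one_smul] at this
  · rw [hq']; exact hj

theorem ch_rep {r n j c k : ℕ} {lam : Fin n → ℕ} (h : isPartitionOf r n lam) (hc : 1 + j + c = k)
    (ε : Fin k ≃ Option (Fin j) ⊕ Fin c) {M : Matrix (Fin k) (Fin (r+1)) ℂ} (hM : Module.finrank ℂ (rowSpan M) = k)
    {u v : Fin n → ℂ} (hL : goodFor r n j lam (rowSpan M) u v) :
    ∃ (τ : ℂ) (w : Fin j → Polynomial ℂ) (g : Fin c → Fin (r+1) → ℂ), (∀ i, (w i).natDegree ≤ n) ∧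
      plucker M = τ • plucker (chMat r ε (xP lam u v) (qP lam u v) w g) := by
  obtain ⟨huv, hx, hj⟩ := hL
  set W' := rowSpan M ⊓ qSub r n (qP lam u v) with hW'
  have hxW : vec r (xP lam u v) ∈ W' := by
    refine ⟨hx, mem_qSub.2 ⟨∏ i, lin (u i) (v i), by simpa using natDegree_prod_lin Finset.univ u v, ?_⟩⟩
    rw [xP_eq_q_mul h.1]
  have hx0 : vec r (xP lam u v) ≠ 0 := vec_ne_zero (xP_ne_zero _ huv) ((natDegree_xP _ _ _).trans h.2.le)
  obtain ⟨c', hc'⟩ : ∃ c', 1 + c' = Module.finrank ℂ W' := ⟨Module.finrank ℂ W' - 1, by omega⟩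
  obtain ⟨g', hg', hli'⟩ := extend_family W' rfl (fun _ : Unit => vec r (xP lam u v))
    (by rw [linearIndependent_unique_iff]; exact hx0) (fun _ => hxW) (c := c') (by simpa using hc')
  have hjc : j ≤ c' := by omega
  have hw : ∀ i : Fin j, ∃ s : Polynomial ℂ, s.natDegree ≤ n ∧ vec r (qP lam u v * s) = g' (Fin.castLE hjc i) :=
    fun i => mem_qSub.1 (hg' _).2
  choose w hwd hwe using hw
  let f : Option (Fin j) → Fin (r+1) → ℂ := fun o => o.elim (vec r (xP lam u v)) fun i => vec r (qP lam u v * w i)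
  have hf : LinearIndependent ℂ f := by
    have h1 := hli'.comp (fun o : Option (Fin j) => (o.elim (Sum.inl ()) fun i => Sum.inr (Fin.castLE hjc i) : Unit ⊕ Fin c')) (by
      rintro (_ | a) (_ | b) hab
      · rfl
      · simp at hab
      · simp at hab
      · simpa using hab)
    have e : f = (Sum.elim (fun _ : Unit => vec r (xP lam u v)) g') ∘ (fun o : Option (Fin j) => (o.elim (Sum.inl ()) fun i => Sum.inr (Fin.castLE hjc i) : Unit ⊕ Fin c')) := by
      funext o
      rcases o with _ | i
      · rfl
      · exact hwe i
    rw [e]; exact h1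
  have hfL : ∀ o, f o ∈ rowSpan M := by
    rintro (_ | i)
    · exact hx
    · show vec r _ ∈ _
      rw [hwe]; exact (hg' _).1
  obtain ⟨g, hg, hli⟩ := extend_family (rowSpan M) hM f hf hfL (c := c) (by simp; omega)
  have hrow : ∀ o, chRow r (xP lam u v) (qP lam u v) w g o = Sum.elim f g o := by
    rintro ((_ | i) | l) <;> rfl
  obtain ⟨τ, hτ⟩ := plucker_scale (M' := chMat r ε (xP lam u v) (qP lam u v) w g) (M := M) (by
    intro i
    rw [chMat_apply, hrow]
    rcases ε i with o | l
    · exact hfL o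
    · exact hg l) (by
    rw [chMat_linInd, show chRow r (xP lam u v) (qP lam u v) w g = Sum.elim f g from funext hrow]
    exact hli)
  exact ⟨τ, w, g, hwd, hτ⟩

theorem ch_upper_gen {r n j m k : ℕ} {lam : Fin n → ℕ} (h : isPartitionOf r n lam) (hn0 : 0 < n)
    (hn : n = m + j) (hk : k + m = r) (hjr : j + n + 1 ≤ r) (Z : Finset (Fin n)) {N : ℕ} (hN : N + Z.card = k * (m+1))
    (hZ : ∀ L u v, goodFor r n j lam L u v → ∃ u' v', (∀ i ∈ Z, u' i = 0) ∧ goodFor r n j lam L u' v') :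
    ¬ zChain (zClosure (smoothCHCone r (crlCone r n lam) (n+1) k j)) (N+1) := by
  classical
  obtain ⟨c, hc⟩ : ∃ c, 1 + j + c = k := ⟨k - 1 - j, by omega⟩
  have ε : Fin k ≃ Option (Fin j) ⊕ Fin c := Fintype.equivOfCardEq (by simp; omega)
  have hr : m + 1 + c ≤ r := by omega
  have hcard := card_PZ hn hc Z
  let inst : Fintype (PZ n j m c Z) := Subtype.fintype _
  refine not_zChain_of_param (G := Unit) (fun _ => PZ n j m c Z) (fun _ a => plucker (stdM r lam ε hr (extZ Z a))) ?_ ?_ ?_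
  · intro _ s
    refine plucker_polyFn (fun i l => ?_) s
    exact (famM_polyFn r lam _ _ _ ε i l).comp (fun o => extZ_polyFn Z o)
  · intro _
    have : Fintype.card (PZ n j m c Z) = N := by omega
    refine le_trans (le_of_eq ?_) this.le
    exact Fintype.card_congr (Equiv.refl _)
  · intro p hp
    rw [Set.mem_iUnion]
    refine ⟨(), ?_⟩
    obtain ⟨M, rfl, hM, u, v, hg⟩ := ch_data h hn0 hp
    obtain ⟨u', v', hu', hg'⟩ := hZ _ _ _ hg
    obtain ⟨τ, w, g, hw, he⟩ := ch_rep h hc ε hM hg'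
    rw [he]
    exact ch_closure h hn hc hk hr (by omega) ε Z u' v' hu' w hw g τ

theorem ch_upper {r n j m k : ℕ} {lam : Fin n → ℕ} (h : isPartitionOf r n lam) (hn0 : 0 < n)
    (hn : n = m + j) (hk : k + m = r) (hjr : j + n + 1 ≤ r) :
    ¬ zChain (zClosure (smoothCHCone r (crlCone r n lam) (n+1) k j)) (k * (m+1) + 1) :=
  ch_upper_gen h hn0 hn hk hjr ∅ (by simp) fun L u v hL => ⟨u, v, by simp, hL⟩

theorem ch_upper_B {r n j m k : ℕ} {lam : Fin n → ℕ} (h : isPartitionOf r n lam) (hn0 : 0 < n)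
    (hn : n = m + j) (hk : k + m = r) (hjr : j + n + 1 ≤ r) (hB : n < j + multOf lam 1) :
    ¬ zChain (zClosure (smoothCHCone r (crlCone r n lam) (n+1) k j)) (k * (m+1)) := by
  have hpos : 0 < multOf lam 1 := by omega
  obtain ⟨i0, hi0⟩ := Finset.card_pos.1 hpos
  have hi0' : lam i0 = 1 := by simpa using hi0
  have hkm : 0 < k * (m+1) := Nat.mul_pos (by omega) (by omega)
  obtain ⟨N, hN⟩ : ∃ N, N + 1 = k * (m+1) := ⟨k * (m+1) - 1, by omega⟩
  rw [← hN]
  refine ch_upper_gen h hn0 hn hk hjr {i0} (by simpa using hN) fun L u v hL => ?_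
  obtain ⟨u', v', h1, h2⟩ := ch_fix h (by omega) hB i0 hi0' hL
  exact ⟨u', v', by simpa using h1, h2⟩

end

section
set_option linter.unusedSectionVars false

section elim
variable {σ τ : Type} [Fintype σ] [DecidableEq σ] [Fintype τ] [DecidableEq τ]

/-- evaluation of a polynomial in `τ` with coefficients polynomials in `σ`. -/
def ev2 (u : σ → ℂ) (t : τ → ℂ) : MvPolynomial τ (MvPolynomial σ ℂ) →+* ℂ := eval₂Hom (eval u) t

theorem ev2_map (u : σ → ℂ) (t : τ → ℂ) (F : MvPolynomial τ (MvPolynomial σ ℂ)) :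
    ev2 u t F = eval t (MvPolynomial.map (eval u) F) := by
  rw [eval_map]; rfl

theorem ev2_scale (u : σ → ℂ) (t : τ → ℂ) (c : ℂ) (k : ℕ) (F : MvPolynomial τ (MvPolynomial σ ℂ)) (hF : F.IsHomogeneous k) :
    ev2 u (c • t) F = c ^ k * ev2 u t F := by
  rw [ev2_map, ev2_map]
  have h := hF.map (eval u)
  rw [eval_eq, eval_eq, Finset.mul_sum]
  refine Finset.sum_congr rfl fun e he => ?_
  have hd := h (mem_support_iff.1 he)
  have : ∏ i ∈ e.support, (c • t) i ^ e i = c ^ k * ∏ i ∈ e.support, t i ^ e i := by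
    simp only [Pi.smul_apply, smul_eq_mul, mul_pow, Finset.prod_mul_distrib]
    rw [Finset.prod_pow_eq_pow_sum]
    congr 2
    rw [← hd, Finsupp.weight_apply]
    simp [Finsupp.sum]
  rw [this]; ring

/-- polynomials vanishing on `Z` -/
def vanI (Z : Set (σ ⊕ τ → ℂ)) : Ideal (MvPolynomial τ (MvPolynomial σ ℂ)) where
  carrier := {F | ∀ u t, Sum.elim u t ∈ Z → ev2 u t F = 0}
  zero_mem' := by intro u t _; simp
  add_mem' := by intro a b ha hb u t h; rw [map_add, ha u t h, hb u t h, add_zero]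
  smul_mem' := by intro c a ha u t h; rw [smul_eq_mul, map_mul, ha u t h, mul_zero]

theorem mem_vanI {Z : Set (σ ⊕ τ → ℂ)} {F} : F ∈ vanI Z ↔ ∀ u t, Sum.elim u t ∈ Z → ev2 u t F = 0 := Iff.rfl

theorem vanI_comp {Z : Set (σ ⊕ τ → ℂ)} (hs : ∀ u t, ∀ c : ℂ, c ≠ 0 → Sum.elim u t ∈ Z → Sum.elim u (c • t) ∈ Z)
    {F : MvPolynomial τ (MvPolynomial σ ℂ)} (hF : F ∈ vanI Z) (K : ℕ) : homogeneousComponent K F ∈ vanI Z := by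
  intro u t h
  let p : Polynomial ℂ := ∑ k ∈ Finset.range (F.totalDegree + 1), Polynomial.C (ev2 u t (homogeneousComponent k F)) * Polynomial.X ^ k
  have hp : ∀ c : ℂ, c ≠ 0 → p.eval c = 0 := by
    intro c hc
    have h1 := hF u (c • t) (hs u t c hc h)
    rw [← sum_homogeneousComponent F, map_sum] at h1
    simp only [p, Polynomial.eval_finsetSum, Polynomial.eval_mul, Polynomial.eval_C, Polynomial.eval_pow, Polynomial.eval_X]
    rw [← h1]
    refine Finset.sum_congr rfl fun k _ => ?_
    rw [ev2_scale u t c k _ (homogeneousComponent_isHomogeneous k F), mul_comm]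
  have hp0 : p = 0 := by
    refine Polynomial.eq_zero_of_infinite_isRoot p (Set.Infinite.mono (s := {0}ᶜ) ?_ (Set.Finite.infinite_compl (Set.finite_singleton _)))
    intro c hc
    exact hp c hc
  have hc : p.coeff K = 0 := by rw [hp0]; simp
  simp only [p, Polynomial.finsetSum_coeff, Polynomial.coeff_C_mul_X_pow] at hc
  by_cases hK : K ∈ Finset.range (F.totalDegree + 1)
  · rw [Finset.sum_eq_single K] at hc
    · simpa using hc
    · intro b _ hb; rw [if_neg (Ne.symm hb)]
    · intro h; exact absurd hK h
  · rw [homogeneousComponent_eq_zero K F (by simpa using hK), map_zero]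

theorem elim_block {Z : Set (σ ⊕ τ → ℂ)} (hZ : zClosed Z)
    (hs : ∀ u t, ∀ c : ℂ, c ≠ 0 → Sum.elim u t ∈ Z → Sum.elim u (c • t) ∈ Z) :
    zClosed {u : σ → ℂ | ∃ t : τ → ℂ, t ≠ 0 ∧ Sum.elim u t ∈ Z} := by
  refine Set.Subset.antisymm ?_ (subset_zClosure _)
  intro u0 hu0
  by_contra hcon
  simp only [Set.mem_ofPred_eq, not_exists, not_and] at hcon
  let I := vanI Z
  let J : Ideal (MvPolynomial τ ℂ) := I.map (MvPolynomial.map (eval u0))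
  have hsurj : Function.Surjective (MvPolynomial.map (σ := τ) (eval u0)) :=
    map_surjective _ fun c => ⟨C c, by simp⟩
  have hloc : ∀ t, t ∈ zeroLocus ℂ J → t = 0 := by
    intro t ht
    by_contra ht0
    apply hcon t ht0
    unfold zClosed at hZ
    rw [← hZ]
    intro p hp
    let F : MvPolynomial τ (MvPolynomial σ ℂ) := eval₂Hom (C.comp C) (Sum.elim (fun i => C (X i)) X) p
    have hev : ∀ u t, ev2 u t F = eval (Sum.elim u t) p := by
      intro u t
      have : (ev2 u t).comp (eval₂Hom (C.comp C) (Sum.elim (fun i => C (X i)) X)) = eval (Sum.elim u t) := by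
        apply ringHom_ext
        · intro c; simp [ev2]
        · rintro (i | i) <;> simp [ev2]
      rw [← this]; rfl
    have hFI : F ∈ I := by
      intro u t h
      rw [hev]; exact hp _ h
    rw [← hev, ev2_map]
    have := (mem_zeroLocus_iff.1 ht) _ (Ideal.mem_map_of_mem _ hFI)
    simpa using this
  have hpow : ∀ i : τ, ∃ K : ℕ, (X i : MvPolynomial τ ℂ) ^ K ∈ J := by
    intro i
    have : (X i : MvPolynomial τ ℂ) ∈ J.radical := by
      rw [← vanishingIdeal_zeroLocus_eq_radical (K := ℂ)]
      intro t ht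
      rw [hloc t ht]; simp
    exact this
  choose Ki hKi using hpow
  let K := ∑ i, Ki i
  have hG : ∀ i : τ, ∃ G ∈ I, G.IsHomogeneous K ∧ MvPolynomial.map (eval u0) G = X i ^ K := by
    intro i
    have h1 : (X i : MvPolynomial τ ℂ) ^ K ∈ J := by
      have hle : Ki i ≤ K := Finset.single_le_sum (f := Ki) (fun _ _ => Nat.zero_le _) (Finset.mem_univ i)
      rw [← Nat.sub_add_cancel hle, pow_add]
      exact J.mul_mem_left _ (hKi i)
    obtain ⟨F, hF, hFe⟩ := (Ideal.mem_map_iff_of_surjective _ hsurj).1 h1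
    refine ⟨homogeneousComponent K F, vanI_comp hs hF K, homogeneousComponent_isHomogeneous K F, ?_⟩
    ext e
    rw [coeff_map, coeff_homogeneousComponent, ← hFe]
    split_ifs with he
    · rw [coeff_map]
    · rw [hFe, map_zero]
      symm
      by_contra hne
      exact he (by
        have := (isHomogeneous_X_pow (R := ℂ) i K) hne
        rw [← this, Finsupp.degree_eq_weight_one]
        rfl)
  choose G hGI hGh hGe using hG
  let D := Fintype.card τ * K + 1
  let S : Set (τ →₀ ℕ) := {e | e.degree = D}
  let mk : MvPolynomial τ (MvPolynomial σ ℂ) →ₗ[MvPolynomial σ ℂ] (MvPolynomial τ (MvPolynomial σ ℂ) ⧸ I) :=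
    (Ideal.Quotient.mkₐ (MvPolynomial σ ℂ) I).toLinearMap
  have hmk : ∀ F, mk F = 0 ↔ F ∈ I := fun F => Ideal.Quotient.eq_zero_iff_mem
  have hSf : S.Finite := by
    refine Set.Finite.subset (Set.finite_Iic (Finsupp.equivFunOnFinite.symm fun _ : τ => D)) ?_
    intro e he i
    have he' : e.degree = D := he
    simp only [Finsupp.equivFunOnFinite_symm_apply_apply]
    rw [← he']
    exact Finsupp.le_degree i e
  let N := Submodule.span (MvPolynomial σ ℂ) ((fun e => mk (monomial e 1)) '' S)
  have hNfg : N.FG := Submodule.fg_span (hSf.image _)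
  let m : Ideal (MvPolynomial σ ℂ) := RingHom.ker (eval u0)
  have hhom : ∀ H : MvPolynomial τ (MvPolynomial σ ℂ), H.IsHomogeneous D → MvPolynomial.map (eval u0) H = 0 → mk H ∈ m • N := by
    intro H hH hH0
    rw [H.as_sum, map_sum]
    refine Submodule.sum_mem _ fun e he => ?_
    have : monomial e (coeff e H) = coeff e H • monomial e (1 : MvPolynomial σ ℂ) := by
      rw [smul_monomial, smul_eq_mul, mul_one]
    rw [this, map_smul]
    refine Submodule.smul_mem_smul ?_ (Submodule.subset_span ⟨e, ?_, rfl⟩)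
    · show eval u0 (coeff e H) = 0
      rw [← coeff_map, hH0, coeff_zero]
    · have := hH (mem_support_iff.1 he)
      show e.degree = D
      rw [← this, Finsupp.degree_eq_weight_one]; rfl
  have hin : N ≤ m • N := by
    refine Submodule.span_le.2 ?_
    rintro _ ⟨e, he, rfl⟩
    have he' : e.degree = D := he
    obtain ⟨i, hi⟩ : ∃ i, K < e i := by
      by_contra! hle
      have : e.degree ≤ Fintype.card τ * K := by
        rw [Finsupp.degree_eq_sum]
        refine (Finset.sum_le_sum fun i _ => hle i).trans ?_
        simp
      omega
    let e' := e - Finsupp.single i K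
    have hee : e' + Finsupp.single i K = e := by
      refine tsub_add_cancel_of_le ?_
      rw [Finsupp.single_le_iff]; exact hi.le
    have hmon : (monomial e 1 : MvPolynomial τ (MvPolynomial σ ℂ)) = monomial e' 1 * X i ^ K := by
      rw [X_pow_eq_monomial, monomial_mul, hee, one_mul]
    have hd' : e'.degree + K = D := by
      rw [← he', ← hee, map_add]; simp
    have h1 : (monomial e' (1 : MvPolynomial σ ℂ) * (X i ^ K - G i)).IsHomogeneous D := by
      rw [← hd']
      refine IsHomogeneous.mul (isHomogeneous_monomial _ rfl) ?_
      exact (isHomogeneous_X_pow i K).sub (hGh i)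
    have h2 := hhom _ h1 (by rw [map_mul, map_sub, hGe]; simp)
    have h3 : mk (monomial e 1) = mk (monomial e' (1 : MvPolynomial σ ℂ) * (X i ^ K - G i)) := by
      rw [← sub_eq_zero, ← map_sub, hmk]
      have : monomial e 1 - monomial e' (1 : MvPolynomial σ ℂ) * (X i ^ K - G i) = monomial e' 1 * G i := by
        rw [hmon]; ring
      rw [this]
      exact I.mul_mem_left _ (hGI i)
    show mk (monomial e 1) ∈ m • N
    rw [h3]; exact h2
  obtain ⟨f, hf1, hf⟩ := Submodule.exists_sub_one_mem_and_smul_eq_zero_of_fg_of_le_smul m N hNfg hin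
  have hf1' : eval u0 f = 1 := by
    have : eval u0 (f - 1) = 0 := hf1
    rw [map_sub, map_one] at this
    exact sub_eq_zero.1 this
  have hf0 : eval u0 f = 0 := by
    refine hu0 f ?_
    rintro u ⟨t, ht0, htZ⟩
    obtain ⟨i, hi⟩ := Function.ne_iff.1 ht0
    have h1 := hf (mk (monomial (Finsupp.single i D) 1)) (Submodule.subset_span ⟨_, by simp [S], rfl⟩)
    rw [← map_smul, hmk] at h1
    have h2 := h1 u t htZ
    rw [smul_monomial, smul_eq_mul, mul_one] at h2
    have h3 : ev2 u t (monomial (Finsupp.single i D) f) = eval u f * t i ^ D := by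
      simp [ev2, eval₂_monomial]
    rw [h3] at h2
    exact (mul_eq_zero.1 h2).resolve_right (pow_ne_zero _ hi)
  rw [hf1'] at hf0
  exact one_ne_zero hf0

end elim

end

section
set_option linter.unusedSectionVars false

theorem zClosed_preimage {α β : Type} [Fintype α] [DecidableEq α] [Fintype β] [DecidableEq β] {Z : Set (β → ℂ)} (hZ : zClosed Z)
    (φ : (α → ℂ) → (β → ℂ)) (hφ : ∀ i, PolyFn fun a => φ a i) : zClosed (φ ⁻¹' Z) := by
  refine Set.Subset.antisymm ?_ (subset_zClosure _)
  intro a ha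
  show φ a ∈ Z
  unfold zClosed at hZ
  rw [← hZ]
  intro p hp
  obtain ⟨P, hP⟩ := (PolyFn.eval_poly p).comp hφ
  have := ha P (fun y hy => by rw [← hP]; exact hp _ hy)
  rw [← hP] at this
  exact this

theorem zClosed_zeros {α κ : Type} [Fintype α] [DecidableEq α] (f : κ → (α → ℂ) → ℂ) (hf : ∀ i, PolyFn (f i)) :
    zClosed {a | ∀ i, f i a = 0} := by
  refine Set.Subset.antisymm ?_ (subset_zClosure _)
  intro a ha i
  obtain ⟨P, hP⟩ := hf i
  rw [hP]
  exact ha P (fun y hy => by rw [← hP]; exact hy i)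

theorem zClosed_inter {α : Type} [Fintype α] [DecidableEq α] {S T : Set (α → ℂ)} (hS : zClosed S) (hT : zClosed T) : zClosed (S ∩ T) := by
  refine Set.Subset.antisymm ?_ (subset_zClosure _)
  intro a ha
  unfold zClosed at hS hT
  exact ⟨hS ▸ zClosure_mono Set.inter_subset_left ha, hT ▸ zClosure_mono Set.inter_subset_right ha⟩

/-- scale the block `i` -/
def scB {n : ℕ} (i : Fin n) (c : ℂ) (t : Fin n × Fin 2 → ℂ) : Fin n × Fin 2 → ℂ := fun p => if p.1 = i then c * t p else t p

theorem elim_blocks (n : ℕ) : ∀ {σ : Type} [Fintype σ] [DecidableEq σ] {Z : Set (σ ⊕ (Fin n × Fin 2) → ℂ)} (_ : zClosed Z)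
    (_ : ∀ u t, ∀ i, ∀ c : ℂ, c ≠ 0 → Sum.elim u t ∈ Z → Sum.elim u (scB i c t) ∈ Z),
    zClosed {u : σ → ℂ | ∃ t : Fin n × Fin 2 → ℂ, (∀ i, t (i,0) ≠ 0 ∨ t (i,1) ≠ 0) ∧ Sum.elim u t ∈ Z} := by
  induction n with
  | zero =>
    intro σ _ _ Z hZ hs
    have h1 := zClosed_preimage hZ (fun u : σ → ℂ => Sum.elim u (fun p => p.1.elim0)) (by
      rintro (i | p)
      · exact PolyFn.coord i
      · exact p.1.elim0)
    convert h1 using 1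
    ext u
    constructor
    · rintro ⟨t, _, h⟩
      have : t = fun p => p.1.elim0 := by funext p; exact p.1.elim0
      rw [this] at h; exact h
    · intro h
      exact ⟨_, fun i => i.elim0, h⟩
  | succ n ih =>
    intro σ _ _ Z hZ hs
    let T : (Fin 2 → ℂ) → (Fin n × Fin 2 → ℂ) → (Fin (n+1) × Fin 2 → ℂ) :=
      fun a t p => Fin.cases (a p.2) (fun i => t (i, p.2)) p.1
    have hT : ∀ t : Fin (n+1) × Fin 2 → ℂ, T (fun l => t (0,l)) (fun p => t (p.1.succ, p.2)) = t := by
      intro t; funext ⟨i, l⟩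
      refine Fin.cases ?_ (fun i => ?_) i <;> rfl
    have h1 := zClosed_preimage hZ (fun x : (σ ⊕ Fin 2) ⊕ (Fin n × Fin 2) → ℂ =>
      Sum.elim (fun s => x (Sum.inl (Sum.inl s))) (T (fun l => x (Sum.inl (Sum.inr l))) (fun p => x (Sum.inr p)))) (by
      rintro (i | ⟨i, l⟩)
      · exact PolyFn.coord _
      · refine Fin.cases ?_ (fun i => ?_) i
        · exact PolyFn.coord _
        · exact PolyFn.coord _)
    have h2 := ih h1 (by
      intro u t i c hc h
      have := hs _ _ i.succ c hc h
      show Sum.elim _ _ ∈ Z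
      convert this using 2
      swap
      funext ⟨i', l⟩
      refine Fin.cases ?_ (fun i' => ?_) i'
      · simp [T, scB, Fin.succ_ne_zero, (Fin.succ_ne_zero i).symm]
      · simp [T, scB]
      · rfl)
    have h3 := elim_block h2 (by
      rintro u a c hc ⟨t, ht, h⟩
      refine ⟨t, ht, ?_⟩
      have := hs _ _ 0 c hc h
      show Sum.elim _ _ ∈ Z
      convert this using 2
      swap
      funext ⟨i', l⟩
      refine Fin.cases ?_ (fun i' => ?_) i'
      · simp [T, scB]
      · simp [T, scB, Fin.succ_ne_zero]
      · rfl)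
    convert h3 using 1
    ext u
    constructor
    · rintro ⟨t, ht, h⟩
      refine ⟨fun l => t (0,l), ?_, fun p => t (p.1.succ, p.2), fun i => ht i.succ, ?_⟩
      · intro h0
        rcases ht 0 with h' | h'
        · exact h' (congrFun h0 0)
        · exact h' (congrFun h0 1)
      · rw [Set.mem_preimage]
        simp only [Sum.elim_inl, Sum.elim_inr]
        rw [hT]; exact h
    · rintro ⟨a, ha, t, ht, h⟩
      refine ⟨T a t, ?_, h⟩
      intro i
      refine Fin.cases ?_ (fun i => ?_) i
      · by_contra! hcon
        apply ha
        funext l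
        fin_cases l
        · exact hcon.1
        · exact hcon.2
      · exact ht i

/-- the matrix recovered from Plücker coordinates, in the chart `s0` -/
def Mof {k N : ℕ} (s0 : Fin k → Fin N) (p : (Fin k → Fin N) → ℂ) : Matrix (Fin k) (Fin N) ℂ :=
  Matrix.of fun i c => p (Function.update s0 i c)

theorem Mof_plucker {k N : ℕ} (s0 : Fin k → Fin N) (M : Matrix (Fin k) (Fin N) ℂ) :
    Mof s0 (plucker M) = (M.submatrix id s0).adjugate * M := by
  ext i c
  have h1 : Mof s0 (plucker M) i c = (M.submatrix id s0).cramer (fun l => M l c) i := by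
    rw [Matrix.cramer_apply]
    show (M.submatrix id (Function.update s0 i c)).det = _
    congr 1
    ext a b
    by_cases hb : b = i
    · subst hb; simp
    · simp [hb]
  rw [h1, Matrix.cramer_eq_adjugate_mulVec]
  rfl

theorem Mof_mem {k N : ℕ} (s0 : Fin k → Fin N) (M : Matrix (Fin k) (Fin N) ℂ) (i : Fin k) :
    Mof s0 (plucker M) i ∈ rowSpan M := by
  rw [Mof_plucker]
  have : ((M.submatrix id s0).adjugate * M) i = ∑ l, (M.submatrix id s0).adjugate i l • M l := by
    funext c
    simp [Matrix.mul_apply, Finset.sum_apply]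
  rw [this]
  exact Submodule.sum_mem _ fun l _ => Submodule.smul_mem _ _ (Submodule.subset_span ⟨l, rfl⟩)

theorem Mof_rep {k N : ℕ} (s0 : Fin k → Fin N) (M : Matrix (Fin k) (Fin N) ℂ) {x : Fin N → ℂ} (hx : x ∈ rowSpan M) :
    plucker M s0 • x = ∑ i, x (s0 i) • Mof s0 (plucker M) i := by
  obtain ⟨y, rfl⟩ := (Submodule.mem_span_range_iff_exists_fun ℂ).1 hx
  have e1 : (∑ i, y i • M i) = Matrix.vecMul y M := by
    funext c; simp [Matrix.vecMul, dotProduct, Finset.sum_apply]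
  have e2 : ∑ i, (∑ i, y i • M i) (s0 i) • Mof s0 (plucker M) i = Matrix.vecMul (Matrix.vecMul y (M.submatrix id s0)) (Mof s0 (plucker M)) := by
    funext c; simp [Matrix.vecMul, dotProduct, Finset.sum_apply]
  rw [e2, e1, Mof_plucker, Matrix.vecMul_vecMul, ← Matrix.mul_assoc, Matrix.mul_adjugate, Matrix.smul_mul, Matrix.one_mul]
  simp [Matrix.vecMul_smul, plucker]

end

section
set_option linter.unusedSectionVars false

theorem xP_scB {n : ℕ} (lam : Fin n → ℕ) (i : Fin n) (c : ℂ) (t : Fin n × Fin 2 → ℂ) :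
    xP lam (fun l => scB i c t (l,0)) (fun l => scB i c t (l,1)) =
      Polynomial.C (c ^ lam i) * xP lam (fun l => t (l,0)) (fun l => t (l,1)) := by
  have h1 : ∀ l, lin (scB i c t (l,0)) (scB i c t (l,1)) ^ lam l =
      (if l = i then Polynomial.C (c ^ lam i) else 1) * lin (t (l,0)) (t (l,1)) ^ lam l := by
    intro l
    by_cases hl : l = i
    · subst hl
      have : lin (scB l c t (l,0)) (scB l c t (l,1)) = Polynomial.C c * lin (t (l,0)) (t (l,1)) := by
        simp [scB, lin]; ring
      rw [this, mul_pow, if_pos rfl, map_pow]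
    · simp [scB, hl]
  unfold xP
  rw [Finset.prod_congr rfl fun l _ => h1 l, Finset.prod_mul_distrib, Finset.prod_ite_eq' Finset.univ i]
  simp

/-- closed incidence relation -/
def chRel (r n : ℕ) (lam : Fin n → ℕ) {k : ℕ} (s0 : Fin k → Fin (r+1)) (p : (Fin k → Fin (r+1)) → ℂ) (u v : Fin n → ℂ)
    (φ : Fin (r+1) → ℂ) : Prop :=
  (∀ c : Fin (r+1), p s0 * (xP lam u v).coeff c - ∑ i, (xP lam u v).coeff (s0 i) * Mof s0 p i c = 0) ∧
  (∀ i, ∑ c, φ c * Mof s0 p i c = 0) ∧ (∀ b : Fin (n+1), ∑ c : Fin (r+1), φ c * (qP lam u v * Polynomial.X ^ (b : ℕ)).coeff c = 0)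

theorem chRel_closed (r n : ℕ) (lam : Fin n → ℕ) {k : ℕ} (s0 : Fin k → Fin (r+1)) :
    zClosed {p | ∃ t : Fin n × Fin 2 → ℂ, (∀ i, t (i,0) ≠ 0 ∨ t (i,1) ≠ 0) ∧ ∃ φ, φ ≠ 0 ∧
      chRel r n lam s0 p (fun l => t (l,0)) (fun l => t (l,1)) φ} := by
  let A := ((Fin k → Fin (r+1)) ⊕ (Fin n × Fin 2)) ⊕ Fin (r+1)
  let p : (A → ℂ) → (Fin k → Fin (r+1)) → ℂ := fun a s => a (Sum.inl (Sum.inl s))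
  let U : (A → ℂ) → Fin n → ℂ := fun a i => a (Sum.inl (Sum.inr (i,0)))
  let V : (A → ℂ) → Fin n → ℂ := fun a i => a (Sum.inl (Sum.inr (i,1)))
  let F : (A → ℂ) → Fin (r+1) → ℂ := fun a i => a (Sum.inr i)
  have hp : ∀ s, PolyFn fun a => p a s := fun s => PolyFn.coord _
  have hU : ∀ s, PolyFn fun a => U a s := fun s => PolyFn.coord _
  have hV : ∀ s, PolyFn fun a => V a s := fun s => PolyFn.coord _
  have hF : ∀ s, PolyFn fun a => F a s := fun s => PolyFn.coord _
  have hx := PolyFnP.xP lam hU hV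
  have hq := PolyFnP.qP lam hU hV
  have hM : ∀ i c, PolyFn fun a => Mof s0 (p a) i c := fun i c => PolyFn.coord _
  have hXb : ∀ b : ℕ, PolyFnP fun _ : A → ℂ => (Polynomial.X ^ b : Polynomial ℂ) := fun b => fun k => PolyFn.const _
  have hZ : zClosed {a : A → ℂ | chRel r n lam s0 (p a) (U a) (V a) (F a)} := by
    have h1 := zClosed_zeros (fun (c : Fin (r+1)) a => p a s0 * (xP lam (U a) (V a)).coeff c - ∑ i, (xP lam (U a) (V a)).coeff (s0 i) * Mof s0 (p a) i c)
      (fun c => ((hp s0).mul (hx _)).sub (PolyFn.sum _ fun i _ => (hx _).mul (hM i c)))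
    have h2 := zClosed_zeros (fun (i : Fin k) a => ∑ c, F a c * Mof s0 (p a) i c)
      (fun i => PolyFn.sum _ fun c _ => (hF c).mul (hM i c))
    have h3 := zClosed_zeros (fun (b : Fin (n+1)) a => ∑ c : Fin (r+1), F a c * (qP lam (U a) (V a) * Polynomial.X ^ (b : ℕ)).coeff c)
      (fun b => PolyFn.sum _ fun c _ => (hF c).mul ((hq.mul (hXb b)) c))
    exact zClosed_inter h1 (zClosed_inter h2 h3)
  have hZ1 := elim_block hZ (by
    rintro w φ c hc ⟨h1, h2, h3⟩
    refine ⟨h1, ?_, ?_⟩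
    · intro i
      have := h2 i
      simp only [F, Sum.elim_inr, Pi.smul_apply, smul_eq_mul, mul_assoc, ← Finset.mul_sum] at this ⊢
      exact mul_eq_zero_of_right _ this
    · intro b
      have := h3 b
      simp only [F, Sum.elim_inr, Pi.smul_apply, smul_eq_mul, mul_assoc, ← Finset.mul_sum] at this ⊢
      exact mul_eq_zero_of_right _ this)
  have hZ2 := elim_blocks n hZ1 (by
    rintro u t i c hc ⟨φ, hφ, h1, h2, h3⟩
    refine ⟨φ, hφ, ?_, h2, ?_⟩
    · intro l
      have h1' := h1 l
      have e := xP_scB lam i c t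
      simp only [p, U, V, Sum.elim_inl, Sum.elim_inr] at h1' ⊢
      rw [e]
      simp only [Polynomial.coeff_C_mul]
      have : ∀ a b : ℂ, a - b = 0 → ∀ κ : ℂ, κ * a - κ * b = 0 := fun a b h κ => by rw [← mul_sub, h, mul_zero]
      have h4 := this _ _ h1' (c ^ lam i)
      rw [← h4, Finset.mul_sum]
      congr 1
      · ring
      · exact Finset.sum_congr rfl fun _ _ => by ring
    · intro b
      have h3' := h3 b
      have e := xP_scB (fun i => lam i - 1) i c t
      simp only [qP, U, V, F, Sum.elim_inl, Sum.elim_inr] at h3' ⊢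
      rw [e]
      simp only [mul_assoc, Polynomial.coeff_C_mul]
      have h4 := congrArg (fun z => c ^ (lam i - 1) * z) h3'
      simp only [mul_zero, Finset.mul_sum] at h4
      rw [← h4]
      exact Finset.sum_congr rfl fun _ _ => by ring)
  exact hZ2

theorem exists_functional {N : ℕ} {W : Submodule ℂ (Fin N → ℂ)} (h : Module.finrank ℂ W < N) :
    ∃ φ : Fin N → ℂ, φ ≠ 0 ∧ ∀ y ∈ W, ∑ c, φ c * y c = 0 := by
  have hlt : W < ⊤ := by
    refine lt_of_le_of_ne le_top ?_
    rintro rfl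
    simp at h
  obtain ⟨f, hf0, hf⟩ := Submodule.exists_le_ker_of_lt_top W hlt
  have hrep : ∀ y, f y = ∑ c, f (Pi.single c 1) * y c := by
    intro y
    rw [LinearMap.pi_apply_eq_sum_univ f y]
    refine Finset.sum_congr rfl fun c _ => ?_
    rw [smul_eq_mul, mul_comm]
    congr 2
    funext i
    by_cases hi : i = c
    · subst hi; simp
    · simp [hi, Ne.symm hi]
  refine ⟨fun c => f (Pi.single c 1), ?_, ?_⟩
  · intro h0
    apply hf0
    refine LinearMap.ext fun y => ?_
    rw [LinearMap.zero_apply, hrep y]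
    exact Finset.sum_eq_zero fun c _ => by rw [show f (Pi.single c 1) = 0 from congrFun h0 c, zero_mul]
  · intro y hy
    rw [← hrep]
    exact hf hy

theorem ch_closure_data {r n j m k : ℕ} {lam : Fin n → ℕ} (h : isPartitionOf r n lam) (hn0 : 0 < n)
    (hn : n = m + j) (hk : k + m = r) (hjr : j + n + 1 ≤ r) {M0 : Matrix (Fin k) (Fin (r+1)) ℂ}
    (hM0 : Module.finrank ℂ (rowSpan M0) = k)
    (hp : plucker M0 ∈ zClosure (smoothCHCone r (crlCone r n lam) (n+1) k j)) :
    ∃ (φ : Fin (r+1) → ℂ) (u v : Fin n → ℂ), φ ≠ 0 ∧ (∀ i, u i ≠ 0 ∨ v i ≠ 0) ∧ vec r (xP lam u v) ∈ rowSpan M0 ∧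
      (∀ y ∈ rowSpan M0, ∑ c, φ c * y c = 0) ∧ ∀ b ≤ n, ∑ c, φ c * vec r (qP lam u v * Polynomial.X ^ b) c = 0 := by
  obtain ⟨s0, hs0⟩ := exists_minor_of_linInd M0 (linInd_of_finrank M0 hM0)
  have hcl := chRel_closed r n lam s0
  unfold zClosed at hcl
  have hsub : smoothCHCone r (crlCone r n lam) (n+1) k j ⊆ {p | ∃ t : Fin n × Fin 2 → ℂ, (∀ i, t (i,0) ≠ 0 ∨ t (i,1) ≠ 0) ∧ ∃ φ, φ ≠ 0 ∧
      chRel r n lam s0 p (fun l => t (l,0)) (fun l => t (l,1)) φ} := by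
    intro p hp
    obtain ⟨M, rfl, hM, u, v, huv, hx, hj⟩ := ch_data h hn0 hp
    have hq0 : qP lam u v ≠ 0 := xP_ne_zero _ huv
    have hqd : (qP lam u v).natDegree ≤ r - n := natDegree_qP h u v
    have hC := finrank_qSub (r := r) (n := n) hq0 hqd (by omega)
    have hsum := Submodule.finrank_sup_add_finrank_inf_eq (rowSpan M) (qSub r n (qP lam u v))
    obtain ⟨φ, hφ, hφW⟩ := exists_functional (W := rowSpan M ⊔ qSub r n (qP lam u v)) (by omega)
    refine ⟨fun p => if p.2 = 0 then u p.1 else v p.1, fun i => by simpa using huv i, φ, hφ, ?_⟩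
    simp only [if_true, one_ne_zero, if_false]
    refine ⟨?_, ?_, ?_⟩
    · intro c
      have := congrFun (Mof_rep s0 M hx) c
      simp only [Pi.smul_apply, smul_eq_mul, vec_apply, Finset.sum_apply] at this
      rw [this, sub_self]
    · intro i
      exact hφW _ (Submodule.mem_sup_left (Mof_mem s0 M i))
    · intro b
      refine hφW (vec r (qP lam u v * Polynomial.X ^ (b : ℕ))) (Submodule.mem_sup_right (mem_qSub.2 ⟨_, ?_, rfl⟩))
      rw [Polynomial.natDegree_X_pow]; omega
  have hmem := zClosure_mono hsub hp
  rw [hcl] at hmem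
  obtain ⟨t, ht, φ, hφ, h1, h2, h3⟩ := hmem
  refine ⟨φ, fun l => t (l,0), fun l => t (l,1), hφ, ht, ?_, ?_, ?_⟩
  · set x := vec r (xP lam (fun l => t (l,0)) (fun l => t (l,1))) with hx
    have h4 : plucker M0 s0 • x = ∑ i, x (s0 i) • Mof s0 (plucker M0) i := by
      funext c
      simp only [Pi.smul_apply, smul_eq_mul, Finset.sum_apply]
      exact sub_eq_zero.1 (h1 c)
    have h5 : x = (plucker M0 s0)⁻¹ • ∑ i, x (s0 i) • Mof s0 (plucker M0) i := by
      rw [← h4, smul_smul, inv_mul_cancel₀ hs0, one_smul]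
    rw [h5]
    exact Submodule.smul_mem _ _ (Submodule.sum_mem _ fun i _ => Submodule.smul_mem _ _ (Mof_mem s0 M0 i))
  · intro y hy
    have h4 := Mof_rep s0 M0 hy
    have h5 : plucker M0 s0 * ∑ c, φ c * y c = 0 := by
      have h6 : ∀ c, plucker M0 s0 * y c = ∑ i, y (s0 i) * Mof s0 (plucker M0) i c := by
        intro c
        have := congrFun h4 c
        simpa only [Pi.smul_apply, smul_eq_mul, Finset.sum_apply] using this
      rw [Finset.mul_sum]
      have h7 : ∀ c, plucker M0 s0 * (φ c * y c) = ∑ i, y (s0 i) * (φ c * Mof s0 (plucker M0) i c) := by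
        intro c
        rw [mul_left_comm, h6, Finset.mul_sum]
        exact Finset.sum_congr rfl fun _ _ => by ring
      simp only [h7]
      rw [Finset.sum_comm]
      refine Finset.sum_eq_zero fun i _ => ?_
      rw [← Finset.mul_sum, h2 i, mul_zero]
    exact (mul_eq_zero.1 h5).resolve_left hs0
  · intro b hb
    exact h3 ⟨b, by omega⟩

end

section
set_option linter.unusedSectionVars false

theorem pull_data {r n j m k : ℕ} {lam : Fin n → ℕ} (h : isPartitionOf r n lam) (hn0 : 0 < n)
    (hn : n = m + j) (hk : k + m = r) (hjr : j + n + 1 ≤ r) {a : Fin (r+m+1) → ℂ}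
    (ha : a ∈ apolarPull (r+m) r k (zClosure (smoothCHCone r (crlCone r n lam) (n+1) k j))) :
    ∃ (u v : Fin n → ℂ) (c : Polynomial ℂ), (∀ i, u i ≠ 0 ∨ v i ≠ 0) ∧ c ≠ 0 ∧ c.natDegree ≤ m ∧
      (∀ b ≤ m, alph (r+m) a (xP lam u v * Polynomial.X ^ b) = 0) ∧
      (∀ b ≤ n, alph (r+m) a (qP lam u v * (c * Polynomial.X ^ b)) = 0) := by
  obtain ⟨M, hM, hMk, hp⟩ := ha
  obtain ⟨φ, u, v, hφ, huv, hx, hL, hq⟩ := ch_closure_data h hn0 hn hk hjr hMk hp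
  have hsub : ∀ y, y ∈ apolarSet (r+m) r a → y ∈ rowSpan M := fun y hy => hM ▸ Submodule.subset_span hy
  let K : (Fin (r+1) → ℂ) →ₗ[ℂ] ℂ := ∑ c, φ c • LinearMap.proj c
  have hK : ∀ y, K y = ∑ c, φ c * y c := by
    intro y; simp [K]
  let L : Fin (m+1) → (Fin (r+1) → ℂ) →ₗ[ℂ] ℂ := fun b =>
    (alph (r+m) a) ∘ₗ (LinearMap.mulLeft ℂ (Polynomial.X ^ (b : ℕ) : Polynomial ℂ)) ∘ₗ toP r
  have hLd : ∀ b y, L b y = alph (r+m) a (Polynomial.X ^ (b : ℕ) * toP r y) := fun b y => rfl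
  have hspan : K ∈ Submodule.span ℂ (Set.range L) := by
    refine mem_span_of_iInf_ker_le_ker fun y hy => ?_
    rw [Submodule.mem_iInf] at hy
    rw [LinearMap.mem_ker, hK]
    refine hL y (hsub y ((mem_apolarSet r m a y).2 fun c hc => ?_))
    exact hy ⟨c, by omega⟩
  obtain ⟨g, hg⟩ := (Submodule.mem_span_range_iff_exists_fun ℂ).1 hspan
  let c : Polynomial ℂ := ∑ b : Fin (m+1), Polynomial.C (g b) * Polynomial.X ^ (b : ℕ)
  have hKc : ∀ y, K y = alph (r+m) a (c * toP r y) := by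
    intro y
    rw [← hg]
    simp only [c, LinearMap.sum_apply, LinearMap.smul_apply, hLd, Finset.sum_mul, map_sum, smul_mul_assoc,
      ← Polynomial.smul_eq_C_mul, map_smul]
  refine ⟨u, v, c, huv, ?_, ?_, ?_, ?_⟩
  · intro h0
    apply hφ
    funext i
    have := hKc (Pi.single i 1)
    rw [h0, zero_mul, map_zero, hK] at this
    simpa [Pi.single_apply] using this
  · refine Polynomial.natDegree_sum_le_of_forall_le _ _ fun b _ => ?_
    refine (Polynomial.natDegree_C_mul_X_pow_le _ _).trans ?_
    have := b.2; omega
  · intro b hb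
    have hx2 : vec r (xP lam u v) ∈ apolarSub r m a := by
      rw [hM, span_apolarSet] at hx; exact hx
    have hd : (xP lam u v).natDegree ≤ r := by
      have := natDegree_xP lam u v; rw [h.2] at this; exact this
    have := (mem_apolarSet r m a _).1 hx2 b hb
    rw [toP_vec hd, mul_comm] at this
    exact this
  · intro b hb
    have h1 := hq b hb
    have hn_r : n ≤ r := by omega
    have hd : (qP lam u v * Polynomial.X ^ b).natDegree ≤ r := by
      refine Polynomial.natDegree_mul_le.trans ?_
      have := natDegree_qP h u v
      rw [Polynomial.natDegree_X_pow]; omega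
    rw [← hK, hKc, toP_vec hd] at h1
    rw [← h1]; congr 1; ring

end

section
set_option linter.unusedSectionVars false

theorem div_lin {u v : ℂ} (hv : v ≠ 0) {p : Polynomial ℂ} (h0 : p.eval (-u/v) = 0) :
    ∃ p1, p = lin u v * p1 := by
  obtain ⟨q, hq⟩ := Polynomial.dvd_iff_isRoot.2 h0
  refine ⟨Polynomial.C v⁻¹ * q, ?_⟩
  have : lin u v * Polynomial.C v⁻¹ = Polynomial.X - Polynomial.C (-u/v) := by
    have h1 : Polynomial.C v * Polynomial.C v⁻¹ = (1 : Polynomial ℂ) := by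
      rw [← Polynomial.C_mul, mul_inv_cancel₀ hv, Polynomial.C_1]
    have h2 : Polynomial.C (-u/v) = -(Polynomial.C u * Polynomial.C v⁻¹) := by
      rw [← Polynomial.C_mul, ← Polynomial.C_neg]; congr 1; ring
    rw [h2]; unfold lin
    linear_combination Polynomial.X * h1
  rw [← mul_assoc, this]; exact hq

theorem natDegree_lin_eq {u v : ℂ} (hv : v ≠ 0) : (lin u v).natDegree = 1 := by
  unfold lin
  rw [add_comm]
  exact Polynomial.natDegree_linear hv

theorem natDegree_of_lin_mul {u v : ℂ} (hv : v ≠ 0) (p : Polynomial ℂ) (D : ℕ) (h : (lin u v * p).natDegree ≤ D) :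
    p.natDegree ≤ D - 1 := by
  by_cases hp : p = 0
  · simp [hp]
  · rw [Polynomial.natDegree_mul (lin_ne_zero (Or.inr hv)) hp, natDegree_lin_eq hv] at h
    omega

theorem peel {u v : ℂ} (huv : u ≠ 0 ∨ v ≠ 0) {c : Polynomial ℂ} (hc : c ≠ 0) {m D : ℕ} (hcm : c.natDegree ≤ m)
    (hD : m + 1 ≤ D) :
    (∃ m' c1, m = m' + 1 ∧ c = lin u v * c1 ∧ c1.natDegree ≤ m') ∨
    ∃ g : Polynomial ℂ, g.natDegree ≤ D - m ∧ ∀ s : Polynomial ℂ, s.natDegree ≤ D → ∃ (κ : ℂ) (s1 : Polynomial ℂ),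
      s1.natDegree ≤ D - 1 ∧ s = lin u v * s1 + Polynomial.C κ * (c * g) := by
  by_cases hv : v = 0
  · subst hv
    have hu : u ≠ 0 := by simpa using huv
    have hl : ∀ p : Polynomial ℂ, p = lin u 0 * (Polynomial.C u⁻¹ * p) := by
      intro p
      rw [← mul_assoc]
      have : lin u 0 * Polynomial.C u⁻¹ = 1 := by
        simp [lin, ← Polynomial.C_mul, hu]
      rw [this, one_mul]
    have hdl : ∀ p : Polynomial ℂ, (Polynomial.C u⁻¹ * p).natDegree ≤ p.natDegree := fun p => Polynomial.natDegree_C_mul_le _ _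
    by_cases h : c.coeff m = 0
    · left
      have hlt : c.natDegree < m := by
        refine lt_of_le_of_ne hcm fun h' => ?_
        rw [← h', Polynomial.coeff_natDegree, Polynomial.leadingCoeff_eq_zero] at h
        exact hc h
      exact ⟨m - 1, _, by omega, hl c, (hdl c).trans (by omega)⟩
    · right
      refine ⟨Polynomial.X ^ (D - m), by simp, fun s hs => ?_⟩
      set κ := s.coeff D / c.coeff m with hκ
      refine ⟨κ, Polynomial.C u⁻¹ * (s - Polynomial.C κ * (c * Polynomial.X ^ (D - m))), ?_, ?_⟩
      · refine (hdl _).trans ?_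
        rw [Polynomial.natDegree_le_iff_coeff_eq_zero]
        intro N hN
        rw [Polynomial.coeff_sub, Polynomial.coeff_C_mul]
        obtain ⟨N', rfl⟩ : ∃ N', N = N' + (D - m) := ⟨N - (D-m), by omega⟩
        rw [Polynomial.coeff_mul_X_pow]
        by_cases hNm : N' = m
        · subst hNm
          rw [show N' + (D - N') = D by omega, hκ]; field_simp; ring
        · rw [Polynomial.coeff_eq_zero_of_natDegree_lt (show c.natDegree < N' by omega),
            Polynomial.coeff_eq_zero_of_natDegree_lt (show s.natDegree < N' + (D-m) by omega)]
          ring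
      · rw [← hl]; ring
  · by_cases h : c.eval (-u/v) = 0
    · left
      obtain ⟨c1, hc1⟩ := div_lin hv h
      have hc10 : c1 ≠ 0 := by rintro rfl; exact hc (by simpa using hc1)
      have h2 := hcm
      rw [hc1, Polynomial.natDegree_mul (lin_ne_zero (Or.inr hv)) hc10, natDegree_lin_eq hv] at h2
      exact ⟨m - 1, c1, by omega, hc1, by omega⟩
    · right
      refine ⟨1, by simp, fun s hs => ?_⟩
      set κ := s.eval (-u/v) / c.eval (-u/v) with hκ
      obtain ⟨s1, hs1⟩ := div_lin (p := s - Polynomial.C κ * c) hv (by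
        rw [Polynomial.eval_sub, Polynomial.eval_mul, Polynomial.eval_C, hκ, div_mul_cancel₀ _ h, sub_self])
      refine ⟨κ, s1, natDegree_of_lin_mul (u := u) hv s1 D ?_, ?_⟩
      · rw [← hs1]
        refine (Polynomial.natDegree_sub_le _ _).trans (max_le hs ?_)
        exact (Polynomial.natDegree_C_mul_le _ _).trans (by omega)
      · rw [← hs1]; ring

theorem kill_sub {α : Type} [DecidableEq α] (u v : α → ℂ) (huv : ∀ i, u i ≠ 0 ∨ v i ≠ 0) (A : Finset α) :
    ∀ (m D : ℕ) (c : Polynomial ℂ) (β : Polynomial ℂ →ₗ[ℂ] ℂ), c ≠ 0 → c.natDegree ≤ m → A.card + m ≤ D →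
      (∀ s : Polynomial ℂ, s.natDegree ≤ D - m → β (c * s) = 0) →
      (∀ s : Polynomial ℂ, s.natDegree ≤ D - A.card → β ((∏ i ∈ A, lin (u i) (v i)) * s) = 0) →
      ∃ I ⊆ A, I.card ≤ m ∧ ∀ s : Polynomial ℂ, s.natDegree ≤ D - I.card → β ((∏ i ∈ I, lin (u i) (v i)) * s) = 0 := by
  induction A using Finset.induction_on with
  | empty => intro m D c β _ _ _ _ h; exact ⟨∅, le_rfl, by simp, h⟩
  | insert i A hi ih =>
    intro m D c β hc hcm hD h1 h2
    rw [Finset.card_insert_of_notMem hi] at hD h2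
    rw [Finset.prod_insert hi] at h2
    rcases peel (huv i) hc hcm (show m + 1 ≤ D - A.card by omega) with ⟨m', c1, rfl, rfl, hc1⟩ | ⟨g, hg, hs⟩
    · obtain ⟨I, hI, hIc, hk⟩ := ih m' (D-1) c1 (β ∘ₗ LinearMap.mulLeft ℂ (lin (u i) (v i)))
        (right_ne_zero_of_mul hc) hc1 (by omega) (by
          intro s hs
          have := h1 s (by omega)
          rwa [mul_assoc] at this) (by
          intro s hs
          have := h2 s (by omega)
          rwa [mul_assoc] at this)
      have hiI : i ∉ I := fun h => hi (hI h)
      refine ⟨insert i I, Finset.insert_subset_insert _ hI, ?_, ?_⟩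
      · rw [Finset.card_insert_of_notMem hiI]; omega
      · intro s hs
        rw [Finset.card_insert_of_notMem hiI] at hs
        rw [Finset.prod_insert hiI, mul_assoc]
        exact hk s (by omega)
    · obtain ⟨I, hI, hIc, hk⟩ := ih m D c β hc hcm (by omega) h1 (by
        intro s hsd
        obtain ⟨κ, s1, hs1, rfl⟩ := hs s hsd
        have e : (∏ i ∈ A, lin (u i) (v i)) * (lin (u i) (v i) * s1 + Polynomial.C κ * (c * g)) =
          (lin (u i) (v i) * ∏ i ∈ A, lin (u i) (v i)) * s1 + κ • (c * (g * ∏ i ∈ A, lin (u i) (v i))) := by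
          rw [Polynomial.smul_eq_C_mul]; ring
        rw [e, map_add, map_smul, h2 s1 (by omega), h1 _ ?_, smul_zero, add_zero]
        refine Polynomial.natDegree_mul_le.trans ?_
        have : (∏ i ∈ A, lin (u i) (v i)).natDegree ≤ A.card := by
          refine (Polynomial.natDegree_prod_le _ _).trans ?_
          refine (Finset.sum_le_card_nsmul _ _ 1 fun i _ => natDegree_lin _ _).trans (by simp)
        omega)
      exact ⟨I, hI.trans (Finset.subset_insert _ _), hIc, hk⟩

theorem pull_data2 {r n j m k : ℕ} {lam : Fin n → ℕ} (h : isPartitionOf r n lam) (hn0 : 0 < n)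
    (hn : n = m + j) (hk : k + m = r) (hjr : j + n + 1 ≤ r) {a : Fin (r+m+1) → ℂ}
    (ha : a ∈ apolarPull (r+m) r k (zClosure (smoothCHCone r (crlCone r n lam) (n+1) k j))) :
    ∃ (u v : Fin n → ℂ) (I : Finset (Fin n)), I.card = m ∧ (∀ i, u i ≠ 0 ∨ v i ≠ 0) ∧
      (∀ b ≤ n, alph (r+m) a (xP (muI lam I) u v * Polynomial.X ^ b) = 0) := by
  obtain ⟨u, v, c, huv, hc, hcm, h1, h2⟩ := pull_data h hn0 hn hk hjr ha
  have h2' : ∀ b ≤ n, alph (r+m) a ((qP lam u v * c) * Polynomial.X ^ b) = 0 := fun b hb => by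
    rw [mul_assoc]; exact h2 b hb
  obtain ⟨I, -, hIc, hkill⟩ := kill_sub u v huv Finset.univ m (n+m) c
    (alph (r+m) a ∘ₗ LinearMap.mulLeft ℂ (qP lam u v)) hc hcm (by simp) (by
      intro s hs
      have := alph_mul_le a _ n h2' s (by omega)
      rwa [mul_assoc] at this) (by
      intro s hs
      rw [Finset.card_univ, Fintype.card_fin] at hs
      have := alph_mul_le a _ m h1 s (by omega)
      rw [xP_eq_q_mul h.1, mul_assoc] at this
      exact this)
  obtain ⟨J, hIJ, -, hJ⟩ := Finset.exists_subsuperset_card_eq (Finset.subset_univ I) hIc (by simp; omega)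
  refine ⟨u, v, J, hJ, huv, fun b hb => ?_⟩
  have hsp : ∏ i ∈ J, lin (u i) (v i) = (∏ i ∈ I, lin (u i) (v i)) * ∏ i ∈ J \ I, lin (u i) (v i) := by
    rw [mul_comm, Finset.prod_sdiff hIJ]
  rw [xP_mu_eq h.1, hsp, mul_assoc, mul_assoc]
  refine hkill _ ?_
  refine Polynomial.natDegree_mul_le.trans ?_
  have h3 : (∏ i ∈ J \ I, lin (u i) (v i)).natDegree ≤ (J \ I).card := by
    refine (Polynomial.natDegree_prod_le _ _).trans ?_
    refine (Finset.sum_le_card_nsmul _ _ 1 fun i _ => natDegree_lin _ _).trans (by simp)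
  rw [Finset.card_sdiff_of_subset hIJ] at h3
  rw [Polynomial.natDegree_X_pow]
  omega

end

section
set_option linter.unusedSectionVars false

theorem xP_affine {n : ℕ} (mu : Fin n → ℕ) (u v : Fin n → ℂ) (huv : ∀ i, u i ≠ 0 ∨ v i ≠ 0) (J : Finset (Fin n))
    (hJ : ∀ i, i ∈ J ↔ v i ≠ 0 ∧ 1 ≤ mu i) :
    ∃ t : ℂ, t ≠ 0 ∧ xP mu u v = Polynomial.C t * ∏ i : {i // i ∈ J}, lin (u i / v i) 1 ^ mu i := by
  refine ⟨∏ i, (if v i = 0 then u i else v i) ^ mu i, ?_, ?_⟩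
  · refine Finset.prod_ne_zero_iff.2 fun i _ => pow_ne_zero _ ?_
    by_cases hv : v i = 0
    · simpa [hv] using huv i
    · simp [hv]
  · have h1 : ∏ i : {i // i ∈ J}, lin (u i / v i) 1 ^ mu i = ∏ i ∈ J, lin (u i / v i) 1 ^ mu i :=
      Finset.prod_coe_sort J (fun i => lin (u i / v i) 1 ^ mu i)
    have h2 : ∏ i ∈ J, lin (u i / v i) 1 ^ mu i = ∏ i, if i ∈ J then lin (u i / v i) 1 ^ mu i else 1 := by
      rw [Finset.prod_ite_mem, Finset.univ_inter]
    rw [h1, h2, map_prod, ← Finset.prod_mul_distrib]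
    refine Finset.prod_congr rfl fun i _ => ?_
    by_cases hm : mu i = 0
    · simp [hJ, hm]
    · by_cases hv : v i = 0
      · simp [hJ, hv, lin]
      · have hi : i ∈ J := (hJ i).2 ⟨hv, by omega⟩
        rw [if_pos hi, if_neg hv, Polynomial.C_pow, ← mul_pow]
        congr 1
        simp only [lin, mul_add, ← Polynomial.C_mul, Polynomial.C_1, one_mul]
        rw [mul_div_cancel₀ _ hv]

theorem pull_upper_gen {r n j m k : ℕ} {lam : Fin n → ℕ} (h : isPartitionOf r n lam) (hn0 : 0 < n)
    (hn : n = m + j) (hk : k + m = r) (hjr : j + n + 1 ≤ r) {N : ℕ}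
    (hN : ∀ I : Finset (Fin n), I.card = m → (Finset.univ.filter fun i => 1 ≤ muI lam I i).card + (r + m - n) ≤ N) :
    ¬ zChain (zClosure (apolarPull (r+m) r k (zClosure (smoothCHCone r (crlCone r n lam) (n+1) k j)))) (N+1) := by
  classical
  let G := {g : Finset (Fin n) × Finset (Fin n) // g.1.card = m ∧ ∀ i ∈ g.2, 1 ≤ muI lam g.1 i}
  let e : G → ℕ := fun g => ∑ i : {i // i ∈ g.1.2}, muI lam g.1.1 i
  have he : ∀ g, e g + n ≤ r + m := by
    intro g
    have h1 : e g = ∑ i ∈ g.1.2, muI lam g.1.1 i := Finset.sum_coe_sort g.1.2 (fun i => muI lam g.1.1 i)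
    have h2 : ∑ i ∈ g.1.2, muI lam g.1.1 i ≤ ∑ i, muI lam g.1.1 i :=
      Finset.sum_le_sum_of_subset (Finset.subset_univ _)
    have h3 := sum_muI h g.1.1
    rw [Finset.card_compl, g.2.1, Fintype.card_fin] at h3
    omega
  let Q : ∀ g : G, ({i // i ∈ g.1.2} → ℂ) → Polynomial ℂ := fun g ρ => ∏ i, lin (ρ i) 1 ^ muI lam g.1.1 i
  have hQ : ∀ g, PolyFnP (Q g) := fun g => PolyFnP.prod _ fun i _ =>
    (PolyFnP.lin (PolyFn.coord i) (PolyFn.const 1)).pow _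
  have hmon : ∀ g ρ, (Q g ρ).Monic := fun g ρ => Polynomial.monic_prod_of_monic _ _ fun i _ => (lin_monic _).pow _
  have hdeg : ∀ g ρ, (Q g ρ).natDegree = e g := by
    intro g ρ
    show (∏ i, lin (ρ i) 1 ^ muI lam g.1.1 i).natDegree = _
    rw [Polynomial.natDegree_prod_of_monic _ _ fun i _ => (lin_monic _).pow _]
    refine Finset.sum_congr rfl fun i _ => ?_
    rw [(lin_monic _).natDegree_pow, natDegree_lin_one, mul_one]
  choose φ hφ1 hφ2 hφ3 hφ4 using fun g => exists_solve (r+m) (e g) n (he g) (Q g) (hQ g) (hmon g) (hdeg g)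
  refine not_zChain_of_param (G := G) (fun g => {i // i ∈ g.1.2} ⊕ FreeC (r+m) (e g) n) φ hφ1 ?_ ?_
  · intro g
    have h1 : g.1.2.card ≤ (Finset.univ.filter fun i => 1 ≤ muI lam g.1.1 i).card :=
      Finset.card_le_card fun i hi => by simpa using g.2.2 i hi
    have h2 := hN g.1.1 g.2.1
    have h3 := card_FreeC (r+m) (e g) n (he g)
    rw [Fintype.card_sum, Fintype.card_coe]
    have h4 : ∀ (i1 : Fintype (FreeC (r+m) (e g) n)), @Fintype.card _ i1 = r + m - n := by
      intro i1
      rw [Fintype.card_eq_nat_card] at h3 ⊢; exact h3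
    rw [h4]
    omega
  · intro a ha
    obtain ⟨u, v, I, hI, huv, hkill⟩ := pull_data2 h hn0 hn hk hjr ha
    let J : Finset (Fin n) := Finset.univ.filter fun i => v i ≠ 0 ∧ 1 ≤ muI lam I i
    obtain ⟨t, ht, hx⟩ := xP_affine (muI lam I) u v huv J (by simp [J])
    rw [Set.mem_iUnion]
    let g : G := ⟨(I, J), hI, fun i hi => by simp [J] at hi; exact hi.2⟩
    refine ⟨g, subset_zClosure _ ⟨Sum.elim (fun i => u i / v i) (fun l => a l.1), ?_⟩⟩
    symm
    refine hφ4 g _ a ?_ (fun l => rfl)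
    intro b hb
    have h1 := hkill b hb
    rw [hx, mul_assoc, ← Polynomial.smul_eq_C_mul, map_smul, smul_eq_mul] at h1
    exact (mul_eq_zero.1 h1).resolve_left ht

theorem pull_upper {r n j m k : ℕ} {lam : Fin n → ℕ} (h : isPartitionOf r n lam) (hn0 : 0 < n)
    (hn : n = m + j) (hk : k + m = r) (hjr : j + n + 1 ≤ r) :
    ¬ zChain (zClosure (apolarPull (r+m) r k (zClosure (smoothCHCone r (crlCone r n lam) (n+1) k j)))) (r+m+1) := by
  refine pull_upper_gen h hn0 hn hk hjr fun I hI => ?_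
  have := Finset.card_le_univ (Finset.univ.filter fun i => 1 ≤ muI lam I i)
  rw [Fintype.card_fin] at this
  omega

theorem pull_upper_B {r n j m k : ℕ} {lam : Fin n → ℕ} (h : isPartitionOf r n lam) (hn0 : 0 < n)
    (hn : n = m + j) (hk : k + m = r) (hjr : j + n + 1 ≤ r) (hB : n < j + multOf lam 1) :
    ¬ zChain (zClosure (apolarPull (r+m) r k (zClosure (smoothCHCone r (crlCone r n lam) (n+1) k j)))) (r+m) := by
  obtain ⟨N, hN⟩ : ∃ N, r + m = N + 1 := ⟨r + m - 1, by omega⟩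
  have key := pull_upper_gen h hn0 hn hk hjr (N := N) fun I hI => ?_
  · rw [← hN] at key; exact key
  · have h1 : (Finset.univ.filter fun i => 1 ≤ muI lam I i) ⊆ I ∪ (Finset.univ.filter fun i => lam i = 1)ᶜ := by
      intro i hi
      simp only [Finset.mem_filter, Finset.mem_univ, true_and, Finset.mem_union, Finset.mem_compl] at hi ⊢
      unfold muI at hi
      by_cases hiI : i ∈ I
      · exact Or.inl hiI
      · rw [if_neg hiI] at hi; right; omega
    have h2 := (Finset.card_le_card h1).trans (Finset.card_union_le _ _)
    have h3 : (Finset.univ.filter fun i => lam i = 1)ᶜ.card = n - multOf lam 1 := by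
      rw [Finset.card_compl, Fintype.card_fin]; rfl
    have h5 : multOf lam 1 ≤ n := by
      have := Finset.card_le_univ (Finset.univ.filter fun i => lam i = 1)
      rw [Fintype.card_fin] at this
      exact this
    rw [h3, hI] at h2
    omega

theorem main_thm (r n j : ℕ) (lam : Fin n → ℕ)
    (hpart : isPartitionOf r n lam) (hjn : j ≤ n) (hjr : j + n + 1 ≤ r) :
    (zDimEq (zClosure (apolarPull (r + n - j) r (r - n + j)
          (zClosure (smoothCHCone r (crlCone r n lam) (n+1) (r - n + j) j))))
        (r + n - j)
      ↔ zDimEq (zClosure (smoothCHCone r (crlCone r n lam) (n+1) (r - n + j) j))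
          ((r - n + j) * (n + 1 - j)))
    ∧ (zDimEq (zClosure (smoothCHCone r (crlCone r n lam) (n+1) (r - n + j) j))
          ((r - n + j) * (n + 1 - j))
        ↔ j + multOf lam 1 ≤ n) := by
  classical
  have hn0 : 0 < n := by
    rcases Nat.eq_zero_or_pos n with rfl | h
    · have := hpart.2
      simp at this; omega
    · exact h
  obtain ⟨m, hm⟩ : ∃ m, n = m + j := ⟨n - j, by omega⟩
  obtain ⟨k, hk⟩ : ∃ k, k = r - n + j := ⟨_, rfl⟩
  have hkm : k + m = r := by omega
  rw [← hk, show n + 1 - j = m + 1 by omega, show r + n - j = r + m by omega]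
  by_cases hA : j + multOf lam 1 ≤ n
  · obtain ⟨I, hI1, -, hI⟩ := Finset.exists_subsuperset_card_eq
      (Finset.subset_univ (Finset.univ.filter fun i => lam i = 1)) (n := m) (by
        have : (Finset.univ.filter fun i => lam i = 1).card = multOf lam 1 := rfl
        omega) (by simp; omega)
    have hmu : ∀ i, 1 ≤ muI lam I i := by
      intro i
      have h1 := hpart.1 i
      unfold muI
      split_ifs with hi
      · exact h1
      · have : lam i ≠ 1 := fun h => hi (hI1 (by simpa using h))
        omega
    have hc : zDimEq (zClosure (smoothCHCone r (crlCone r n lam) (n+1) k j)) (k * (m+1)) :=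
      ⟨ch_lower hpart hn0 hm hkm hjr hI hmu, ch_upper hpart hn0 hm hkm hjr⟩
    have hp : zDimEq (zClosure (apolarPull (r+m) r k (zClosure (smoothCHCone r (crlCone r n lam) (n+1) k j)))) (r+m) :=
      ⟨pull_lower hpart hn0 hm hkm hjr hI hmu, pull_upper hpart hn0 hm hkm hjr⟩
    exact ⟨iff_of_true hp hc, iff_of_true hc hA⟩
  · have hB : n < j + multOf lam 1 := by omega
    have hc := ch_upper_B hpart hn0 hm hkm hjr hB
    have hp := pull_upper_B hpart hn0 hm hkm hjr hB
    exact ⟨iff_of_false (fun h => hp h.1) (fun h => hc h.1), iff_of_false (fun h => hc h.1) hA⟩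

end

/-- the closure of the pullback `Ψ_{d,r}⁻¹(CH_j(Δ_λ))` has codimension 1 in
`ℙ^d` (cone of dimension `d = r+n−j`) iff `CH_j(Δ_λ)` has codimension 1 in
`𝔾(r−n−1+j, r)` (Plücker cone of dimension `(r−n+j)(n+1−j)`), which happens exactly when
`j ≤ n − m_1(λ)`. -/
theorem pullback_CH_codim_one_iff (r n j : ℕ) (lam : Fin n → ℕ)
    (hpart : isPartitionOf r n lam) (hjn : j ≤ n) (hjr : j + n + 1 ≤ r) :
    (zDimEq (zClosure (apolarPull (r + n - j) r (r - n + j)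
          (zClosure (smoothCHCone r (crlCone r n lam) (n+1) (r - n + j) j))))
        (r + n - j)
      ↔ zDimEq (zClosure (smoothCHCone r (crlCone r n lam) (n+1) (r - n + j) j))
          ((r - n + j) * (n + 1 - j)))
    ∧ (zDimEq (zClosure (smoothCHCone r (crlCone r n lam) (n+1) (r - n + j) j))
          ((r - n + j) * (n + 1 - j))
        ↔ j + multOf lam 1 ≤ n) := main_thm r n j lam hpart hjn hjr
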